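/- arXiv:1902.05903 — 2 statements merged into one kernel-verified Lean document; each statement's English description precedes it below -/
import Mathlib

section
/- For all fixed integers r ≥ 3, e ≥ 3, v ≥ r+1 with gcd(e-1, er-v) = 1, there exist a constant c > 0 and an integer N such that for every n ≥ N there exists an r-graph H on vertex set [n] with at least c · n^{(er-v)/(e-1)} · (log n)^{1/(e-1)} edges which, for every integer i with 2 ≤ i ≤ e, is 𝒢_r(ir - ⌈(i-1)(er-v)/(e-1)⌉, i)-free, i.e., the union of any i distinct edges of H contains at least ir - ⌈(i-1)(er-v)/(e-1)⌉ + 1 vertices. -/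
set_option linter.unusedSectionVars false
namespace Nib
open Finset

/-- Expectation over a finite product space with coordinate weights `w`. -/
noncomputable def Ex {α κ : Type*} [Fintype α] [DecidableEq α] [Fintype κ]
    (w : α → κ → ℝ) (f : (α → κ) → ℝ) : ℝ :=
  ∑ ω : α → κ, (∏ u, w u (ω u)) * f ω

section
variable {α κ : Type*} [Fintype α] [DecidableEq α] [Fintype κ] {w : α → κ → ℝ}

lemma Ex_add (f g : (α → κ) → ℝ) : Ex w (fun ω => f ω + g ω) = Ex w f + Ex w g := by
  simp only [Ex, mul_add, Finset.sum_add_distrib]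

lemma Ex_sub (f g : (α → κ) → ℝ) : Ex w (fun ω => f ω - g ω) = Ex w f - Ex w g := by
  simp only [Ex, mul_sub, Finset.sum_sub_distrib]

lemma Ex_mul_left (c : ℝ) (f : (α → κ) → ℝ) : Ex w (fun ω => c * f ω) = c * Ex w f := by
  simp only [Ex, Finset.mul_sum]
  exact Finset.sum_congr rfl fun _ _ => by ring

lemma Ex_sum {ι : Type*} (s : Finset ι) (f : ι → (α → κ) → ℝ) :
    Ex w (fun ω => ∑ i ∈ s, f i ω) = ∑ i ∈ s, Ex w (f i) := by
  simp only [Ex, Finset.mul_sum]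
  exact Finset.sum_comm

lemma Ex_prod_coord (φ : α → κ → ℝ) :
    Ex w (fun ω => ∏ u, φ u (ω u)) = ∏ u, ∑ a, w u a * φ u a := by
  classical
  rw [Finset.prod_univ_sum]
  simp only [Ex, Fintype.piFinset_univ]
  exact Finset.sum_congr rfl fun _ _ => by rw [Finset.prod_mul_distrib]

lemma Ex_one (hw : ∀ u, ∑ a, w u a = 1) : Ex w (fun _ => 1) = 1 := by
  have := Ex_prod_coord (w := w) (fun _ _ => 1)
  simpa [hw] using this

lemma Ex_const (hw : ∀ u, ∑ a, w u a = 1) (c : ℝ) : Ex w (fun _ => c) = c := by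
  have := Ex_mul_left (w := w) c (fun _ => 1)
  simpa [Ex_one hw] using this

lemma Ex_coord (hw : ∀ u, ∑ a, w u a = 1) (u : α) (φ : κ → ℝ) :
    Ex w (fun ω => φ (ω u)) = ∑ a, w u a * φ a := by
  have := Ex_prod_coord (w := w) (fun x a => if x = u then φ a else 1)
  rw [Finset.prod_eq_single u] at this
  · simpa [Finset.prod_ite_eq] using this
  · intro b _ hb
    simp [hb, hw]
  · simp

lemma Ex_mono (h0 : ∀ u a, 0 ≤ w u a) {f g : (α → κ) → ℝ} (h : ∀ ω, f ω ≤ g ω) :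
    Ex w f ≤ Ex w g :=
  Finset.sum_le_sum fun ω _ => mul_le_mul_of_nonneg_left (h ω)
    (Finset.prod_nonneg fun _ _ => h0 _ _)

lemma Ex_nonneg (h0 : ∀ u a, 0 ≤ w u a) {f : (α → κ) → ℝ} (h : ∀ ω, 0 ≤ f ω) :
    0 ≤ Ex w f :=
  Finset.sum_nonneg fun ω _ => mul_nonneg (Finset.prod_nonneg fun _ _ => h0 _ _) (h ω)

lemma Ex_exists (h0 : ∀ u a, 0 ≤ w u a) (hw : ∀ u, ∑ a, w u a = 1) (f : (α → κ) → ℝ) :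
    ∃ ω, Ex w f ≤ f ω := by
  by_contra! hcon
  have h1 : Ex w f < Ex w (fun _ => Ex w f) := by
    have hone := Ex_one hw
    unfold Ex at hone
    have hne : ∃ ω : α → κ, 0 < ∏ u, w u (ω u) := by
      by_contra! h
      have : ∑ ω : α → κ, (∏ u, w u (ω u)) * 1 ≤ 0 :=
        Finset.sum_nonpos fun ω _ => by simpa using h ω
      linarith
    obtain ⟨ω0, hω0⟩ := hne
    refine Finset.sum_lt_sum (fun ω _ => mul_le_mul_of_nonneg_left (hcon ω).le
      (Finset.prod_nonneg fun _ _ => h0 _ _)) ⟨ω0, Finset.mem_univ _, ?_⟩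
    exact mul_lt_mul_of_pos_left (hcon ω0) hω0
  rw [Ex_const hw] at h1
  exact lt_irrefl _ h1

/-- `f` depends only on the coordinates in `B`. -/
def Dep (f : (α → κ) → ℝ) (B : Finset α) : Prop :=
  ∀ ω ω' : α → κ, (∀ u ∈ B, ω u = ω' u) → f ω = f ω'

lemma Ex_mul (hw : ∀ u, ∑ a, w u a = 1) {f g : (α → κ) → ℝ} {B C : Finset α}
    (hf : Dep f B) (hg : Dep g C) (hBC : Disjoint B C) :
    Ex w (fun ω => f ω * g ω) = Ex w f * Ex w g := by
  classical
  let mix : (α → κ) × (α → κ) → (α → κ) × (α → κ) := fun x =>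
    (fun u => if u ∈ B then x.1 u else x.2 u, fun u => if u ∈ B then x.2 u else x.1 u)
  have hinv : Function.Involutive mix := by
    rintro ⟨x, y⟩
    simp only [mix, Prod.mk.injEq]
    constructor <;> funext u <;> by_cases h : u ∈ B <;> simp [h]
  have key := Equiv.sum_comp (hinv.toPerm mix) (fun x : (α → κ) × (α → κ) =>
    ((∏ u, w u (x.1 u)) * (f x.1 * g x.1)) * ((∏ u, w u (x.2 u)) * 1))
  rw [Fintype.sum_prod_type, Fintype.sum_prod_type] at key
  have e2 : Ex w (fun ω => f ω * g ω) * Ex w (fun _ => 1) = ∑ x : α → κ, ∑ y : α → κ,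
      ((∏ u, w u (x u)) * (f x * g x)) * ((∏ u, w u (y u)) * 1) := by
    simp only [Ex, Finset.sum_mul_sum]
  rw [Ex_one hw, mul_one] at e2
  rw [e2]
  refine key.symm.trans ?_
  simp only [Ex, Finset.sum_mul_sum]
  refine Finset.sum_congr rfl fun x _ => Finset.sum_congr rfl fun y _ => ?_
  simp only [Function.Involutive.coe_toPerm, mix]
  have h1 : f (fun u => if u ∈ B then x u else y u) = f x :=
    hf _ _ fun u hu => by simp [hu]
  have h2 : g (fun u => if u ∈ B then x u else y u) = g y :=
    hg _ _ fun u hu => by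
      have : u ∉ B := fun h => (Finset.disjoint_left.mp hBC) h hu
      simp [this]
  have h3 : (∏ u, w u (if u ∈ B then x u else y u)) * (∏ u, w u (if u ∈ B then y u else x u))
      = (∏ u, w u (x u)) * ∏ u, w u (y u) := by
    rw [← Finset.prod_mul_distrib, ← Finset.prod_mul_distrib]
    refine Finset.prod_congr rfl fun u _ => ?_
    by_cases h : u ∈ B <;> simp [h, mul_comm]
  rw [h1, h2]
  calc _ = ((∏ u, w u (if u ∈ B then x u else y u)) *
        (∏ u, w u (if u ∈ B then y u else x u))) * (f x * g y) := by ring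
    _ = _ := by rw [h3]; ring

lemma Dep.prod {ι : Type*} {s : Finset ι} {f : ι → (α → κ) → ℝ} {B : ι → Finset α}
    (hf : ∀ i ∈ s, Dep (f i) (B i)) : Dep (fun ω => ∏ i ∈ s, f i ω) (s.biUnion B) := by
  intro ω ω' h
  refine Finset.prod_congr rfl fun i hi => hf i hi _ _ fun u hu => h u ?_
  exact Finset.mem_biUnion.2 ⟨i, hi, hu⟩

lemma Ex_prod (hw : ∀ u, ∑ a, w u a = 1) {ι : Type*} [DecidableEq ι] (s : Finset ι)
    (f : ι → (α → κ) → ℝ) (B : ι → Finset α)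
    (hf : ∀ i ∈ s, Dep (f i) (B i))
    (hB : ∀ i ∈ s, ∀ j ∈ s, i ≠ j → Disjoint (B i) (B j)) :
    Ex w (fun ω => ∏ i ∈ s, f i ω) = ∏ i ∈ s, Ex w (f i) := by
  induction s using Finset.induction_on with
  | empty => simpa using Ex_one hw
  | insert a s ha ih =>
    simp only [Finset.prod_insert ha]
    rw [Ex_mul hw (hf a (by simp)) (Dep.prod (s := s) (f := f) (B := B)
      fun i hi => hf i (by simp [hi])), ih]
    · exact fun i hi => hf i (by simp [hi])
    · exact fun i hi j hj => hB i (by simp [hi]) j (by simp [hj])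
    · rw [Finset.disjoint_biUnion_right]
      intro i hi
      exact hB a (by simp) i (by simp [hi]) (fun h => ha (h ▸ hi))

/-- Chebyshev-type bound for a sum of pairwise independent bounded nonnegative variables. -/
lemma Ex_cheb (h0 : ∀ u a, 0 ≤ w u a) (hw : ∀ u, ∑ a, w u a = 1) {ι : Type*} [DecidableEq ι]
    (s : Finset ι) (T : ι → (α → κ) → ℝ) (B : ι → Finset α) (β m : ℝ) (hβ : 0 ≤ β)
    (hT : ∀ i ∈ s, Dep (T i) (B i))
    (hB : ∀ i ∈ s, ∀ j ∈ s, i ≠ j → Disjoint (B i) (B j))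
    (hT0 : ∀ i ∈ s, ∀ ω, 0 ≤ T i ω) (hT1 : ∀ i ∈ s, ∀ ω, T i ω ≤ β)
    (hm : ∑ i ∈ s, Ex w (T i) ≤ m) :
    Ex w (fun ω => if m + 1 < ∑ i ∈ s, T i ω then 1 else 0) ≤ β * m := by
  set μ := ∑ i ∈ s, Ex w (T i) with hμ
  have hsq : Ex w (fun ω => (∑ i ∈ s, T i ω) * (∑ j ∈ s, T j ω)) ≤ μ * μ + β * μ := by
    have : (fun ω => (∑ i ∈ s, T i ω) * (∑ j ∈ s, T j ω)) =
        fun ω => ∑ i ∈ s, ∑ j ∈ s, T i ω * T j ω := by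
      funext ω; rw [Finset.sum_mul_sum]
    rw [this, Ex_sum]
    simp_rw [Ex_sum]
    have hb : ∀ i ∈ s, ∑ j ∈ s, Ex w (fun ω => T i ω * T j ω) ≤
        ∑ j ∈ s, (Ex w (T i) * Ex w (T j) + if i = j then β * Ex w (T i) else 0) := by
      intro i hi
      refine Finset.sum_le_sum fun j hj => ?_
      by_cases hij : i = j
      · subst hij
        simp only [if_true]
        have h1 : Ex w (fun ω => T i ω * T i ω) ≤ Ex w (fun ω => β * T i ω) :=
          Ex_mono h0 fun ω => mul_le_mul_of_nonneg_right (hT1 i hi ω) (hT0 i hi ω)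
        rw [Ex_mul_left] at h1
        nlinarith [mul_self_nonneg (Ex w (T i))]
      · simp only [hij, if_false, add_zero]
        exact (Ex_mul hw (hT i hi) (hT j hj) (hB i hi j hj hij)).le
    refine (Finset.sum_le_sum hb).trans (le_of_eq ?_)
    simp only [Finset.sum_add_distrib]
    rw [hμ, Finset.sum_mul_sum, Finset.mul_sum]
    congr 1
    refine Finset.sum_congr rfl fun i hi => ?_
    simp [hi]
  have hle : Ex w (fun ω => if m + 1 < ∑ i ∈ s, T i ω then 1 else 0) ≤
      Ex w (fun ω => (∑ i ∈ s, T i ω) * (∑ j ∈ s, T j ω) + (μ * μ - 2 * μ * ∑ i ∈ s, T i ω)) := by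
    refine Ex_mono h0 fun ω => ?_
    split_ifs with h
    · nlinarith
    · nlinarith [sq_nonneg ((∑ i ∈ s, T i ω) - μ)]
  rw [Ex_add, Ex_sub, Ex_const hw, Ex_mul_left, Ex_sum, ← hμ] at hle
  nlinarith

end

/-- Mixed hypergraph with edges of size at least two and girth at least five. -/
structure Good {α : Type*} [DecidableEq α] (G : Finset (Finset α)) : Prop where
  two : ∀ F ∈ G, 2 ≤ F.card
  lin : ∀ F₁ ∈ G, ∀ F₂ ∈ G, ∀ x y, x ≠ y → x ∈ F₁ → y ∈ F₁ → x ∈ F₂ → y ∈ F₂ → F₁ = F₂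
  tri : ∀ F₁ ∈ G, ∀ F₂ ∈ G, ∀ F₃ ∈ G, ∀ x y z, x ≠ y → y ≠ z → x ≠ z →
    x ∈ F₁ → y ∈ F₁ → y ∈ F₂ → z ∈ F₂ → x ∈ F₃ → z ∈ F₃ → F₁ = F₂
  quad : ∀ F₁ ∈ G, ∀ F₂ ∈ G, ∀ F₃ ∈ G, ∀ F₄ ∈ G, ∀ x y z t, x ≠ y → x ≠ z → x ≠ t →
    y ≠ z → y ≠ t → z ≠ t → x ∈ F₁ → y ∈ F₁ → y ∈ F₂ → z ∈ F₂ → z ∈ F₃ → t ∈ F₃ →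
    t ∈ F₄ → x ∈ F₄ → F₁ = F₂ ∨ F₂ = F₃ ∨ F₃ = F₄ ∨ F₄ = F₁

/-- Hypotheses on the coordinate weights of one nibble round:
`0` = selected, `1` = kept, `2` = killed. -/
structure Wt {α : Type*} (w : α → Fin 3 → ℝ) (p : ℝ) (s : α → ℝ) : Prop where
  nn : ∀ u a, 0 ≤ w u a
  one : ∀ u, ∑ a, w u a = 1
  sel : ∀ u, w u 0 = p
  keep : ∀ u, w u 1 = s u

section
variable {α : Type*} [Fintype α] [DecidableEq α] {w : α → Fin 3 → ℝ} {p : ℝ} {s : α → ℝ}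
  {G : Finset (Finset α)}

/-- All of `A` is selected. -/
def Sel (A : Finset α) (ω : α → Fin 3) : Prop := ∀ x ∈ A, ω x = 0

instance (A : Finset α) (ω : α → Fin 3) : Decidable (Sel A ω) := by
  unfold Sel; infer_instance

lemma Sel_congr {A : Finset α} {ω ω' : α → Fin 3} (h : ∀ u ∈ A, ω u = ω' u) :
    Sel A ω ↔ Sel A ω' := by
  unfold Sel
  exact forall₂_congr fun x hx => by rw [h x hx]

lemma Ex_Sel (hW : Wt w p s) (A : Finset α) :
    Ex w (fun ω => if Sel A ω then 1 else 0) = p ^ A.card := by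
  have h1 : (fun ω : α → Fin 3 => if Sel A ω then (1:ℝ) else 0) =
      fun ω => ∏ x ∈ A, if ω x = 0 then (1:ℝ) else 0 := by
    funext ω
    rw [Finset.prod_ite_zero]
    simp [Sel]
  rw [h1, Ex_prod hW.one A (fun x ω => if ω x = 0 then (1:ℝ) else 0) (fun x => {x})]
  · have : ∀ x ∈ A, Ex w (fun ω => if ω x = 0 then (1:ℝ) else 0) = p := by
      intro x _
      rw [Ex_coord hW.one x (fun a => if a = 0 then (1:ℝ) else 0)]
      simp [hW.sel]
    rw [Finset.prod_congr rfl this]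
    simp
  · intro i _ ω ω' h
    have := h i (by simp)
    simp only [this]
  · intro i _ j _ hij
    simpa using hij

/-- `u` is kept and is not closed by an edge of `𝓕`. -/
def Surv (𝓕 : Finset (Finset α)) (u : α) (ω : α → Fin 3) : Prop :=
  ω u = 1 ∧ ∀ F ∈ 𝓕, ¬ Sel (F.erase u) ω

instance (𝓕 : Finset (Finset α)) (u : α) (ω : α → Fin 3) : Decidable (Surv 𝓕 u ω) := by
  unfold Surv; infer_instance

/-- Coordinates which `Surv 𝓕 u` looks at. -/
def Blk (𝓕 : Finset (Finset α)) (u : α) : Finset α :=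
  insert u (𝓕.biUnion fun F => F.erase u)

lemma Surv_congr {𝓕 : Finset (Finset α)} {u : α} {ω ω' : α → Fin 3}
    (h : ∀ x ∈ Blk 𝓕 u, ω x = ω' x) : Surv 𝓕 u ω ↔ Surv 𝓕 u ω' := by
  unfold Surv
  rw [h u (by simp [Blk])]
  refine and_congr_right fun _ => forall₂_congr fun F hF => not_congr (Sel_congr fun x hx => ?_)
  refine h x ?_
  unfold Blk
  exact Finset.mem_insert_of_mem (Finset.mem_biUnion.2 ⟨F, hF, hx⟩)

lemma Ex_Surv (hW : Wt w p s) (hG : Good G) {𝓕 : Finset (Finset α)} {u : α}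
    (hsub : ∀ F ∈ 𝓕, F ∈ G ∧ u ∈ F) :
    Ex w (fun ω => if Surv 𝓕 u ω then 1 else 0) = s u * ∏ F ∈ 𝓕, (1 - p ^ (F.card - 1)) := by
  have h1 : (fun ω : α → Fin 3 => if Surv 𝓕 u ω then (1:ℝ) else 0) =
      fun ω => (if ω u = 1 then (1:ℝ) else 0) *
        ∏ F ∈ 𝓕, if ¬ Sel (F.erase u) ω then (1:ℝ) else 0 := by
    funext ω
    rw [Finset.prod_ite_zero]
    by_cases h : ω u = 1 <;> simp [Surv, h]
  have hd : ∀ F ∈ 𝓕, Dep (fun ω : α → Fin 3 => if ¬ Sel (F.erase u) ω then (1:ℝ) else 0)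
      (F.erase u) := by
    intro F _ ω ω' h
    simp only [Sel_congr h]
  rw [h1, Ex_mul hW.one (B := {u}) (C := 𝓕.biUnion fun F => F.erase u) _ (Dep.prod hd),
    Ex_prod hW.one 𝓕 _ (fun F => F.erase u) hd]
  · rw [Ex_coord hW.one u (fun a => if a = 1 then (1:ℝ) else 0)]
    congr 1
    · simp [hW.keep]
    · refine Finset.prod_congr rfl fun F hF => ?_
      have : (fun ω : α → Fin 3 => if ¬ Sel (F.erase u) ω then (1:ℝ) else 0) =
          fun ω => 1 - if Sel (F.erase u) ω then (1:ℝ) else 0 := by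
        funext ω
        by_cases h : Sel (F.erase u) ω <;> simp [h]
      rw [this, Ex_sub, Ex_one hW.one, Ex_Sel hW, Finset.card_erase_of_mem (hsub F hF).2]
  · intro F₁ h₁ F₂ h₂ hne
    rw [Finset.disjoint_left]
    intro x hx1 hx2
    rw [Finset.mem_erase] at hx1 hx2
    exact hne (hG.lin F₁ (hsub _ h₁).1 F₂ (hsub _ h₂).1 x u hx1.1 hx1.2 (hsub _ h₁).2 hx2.2
      (hsub _ h₂).2)
  · rw [Finset.disjoint_left]
    intro x hx
    simp only [Finset.mem_singleton] at hx
    subst hx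
    simp
  · intro ω ω' h
    have := h u (by simp)
    simp only [this]

/-- Edges through `u`. -/
def Thru (G : Finset (Finset α)) (u : α) : Finset (Finset α) := G.filter fun F => u ∈ F

/-- Edges through `u` avoiding `v`. -/
def ThruA (G : Finset (Finset α)) (v u : α) : Finset (Finset α) :=
  G.filter fun F => u ∈ F ∧ v ∉ F

/-- Future weight of `u`, seen from `v`. -/
noncomputable def Y (G : Finset (Finset α)) (b' : ℝ) (v u : α) (ω : α → Fin 3) : ℝ :=
  if ω u = 0 then 1 else if Surv (ThruA G v u) u ω then b' else 0

lemma Y_dep (b' : ℝ) (v u : α) : Dep (Y G b' v u) (Blk (ThruA G v u) u) := by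
  intro ω ω' h
  unfold Y
  rw [h u (by simp [Blk])]
  simp only [Surv_congr h]

lemma blk_disj (hG : Good G) {v u₁ u₂ : α} {F₁ F₂ : Finset α} (hF₁ : F₁ ∈ G) (hF₂ : F₂ ∈ G)
    (hv₁ : v ∈ F₁) (hv₂ : v ∈ F₂) (hu₁ : u₁ ∈ F₁) (hu₂ : u₂ ∈ F₂) (h1 : u₁ ≠ v) (h2 : u₂ ≠ v)
    (hne : u₁ ≠ u₂) : Disjoint (Blk (ThruA G v u₁) u₁) (Blk (ThruA G v u₂) u₂) := by
  rw [Finset.disjoint_left]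
  intro x hx1 hx2
  simp only [Blk, ThruA, Finset.mem_insert, Finset.mem_biUnion, Finset.mem_filter,
    Finset.mem_erase] at hx1 hx2
  -- an edge through both neighbours that avoids `v` is impossible
  have key : ∀ E ∈ G, u₁ ∈ E → u₂ ∈ E → v ∉ E → False := by
    intro E hE a b c
    have e1 := hG.tri E hE F₂ hF₂ F₁ hF₁ u₁ u₂ v hne h2 h1 a b hu₂ hv₂ hu₁ hv₁
    exact c (e1 ▸ hv₂)
  rcases hx1 with rfl | ⟨E₁, ⟨hE₁, a1, c1⟩, hx1, m1⟩
  · rcases hx2 with rfl | ⟨E₂, ⟨hE₂, a2, c2⟩, hx2, m2⟩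
    · exact hne rfl
    · exact key E₂ hE₂ m2 a2 c2
  · rcases hx2 with rfl | ⟨E₂, ⟨hE₂, a2, c2⟩, hx2, m2⟩
    · exact key E₁ hE₁ a1 m1 c1
    · have hxv : x ≠ v := fun h => c1 (h ▸ m1)
      rcases hG.quad F₁ hF₁ E₁ hE₁ E₂ hE₂ F₂ hF₂ v u₁ x u₂ h1.symm hxv.symm h2.symm hx1.symm
        hne hx2 hv₁ hu₁ a1 m1 m2 a2 hu₂ hv₂ with h | h | h | h
      · exact c1 (h ▸ hv₁)
      · subst h
        exact key E₁ hE₁ a1 a2 c1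
      · exact c2 (h ▸ hv₂)
      · subst h
        -- both neighbours in the same edge
        have e := hG.tri E₁ hE₁ E₂ hE₂ F₂ hF₂ u₁ x u₂ hx1.symm hx2 hne a1 m1 m2 a2 hu₁ hu₂
        subst e
        exact key E₁ hE₁ a1 a2 c1

/-- Capped future weight of the edge `F` seen from `v`. -/
noncomputable def T (G : Finset (Finset α)) (b' : ℝ) (v : α) (F : Finset α) (ω : α → Fin 3) : ℝ :=
  if Sel (F.erase v) ω then 0 else ∏ u ∈ F.erase v, Y G b' v u ω

lemma T_dep (b' : ℝ) (v : α) (F : Finset α) :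
    Dep (T G b' v F) ((F.erase v).biUnion fun u => Blk (ThruA G v u) u) := by
  intro ω ω' h
  unfold T
  have h1 : Sel (F.erase v) ω ↔ Sel (F.erase v) ω' := Sel_congr fun u hu =>
    h u (Finset.mem_biUnion.2 ⟨u, hu, by simp [Blk]⟩)
  have h2 : ∏ u ∈ F.erase v, Y G b' v u ω = ∏ u ∈ F.erase v, Y G b' v u ω' :=
    Dep.prod (fun u _ => Y_dep b' v u) ω ω' h
  simp only [h1, h2]

lemma T_disj (hG : Good G) {v : α} {F₁ F₂ : Finset α} (hF₁ : F₁ ∈ G) (hF₂ : F₂ ∈ G)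
    (hv₁ : v ∈ F₁) (hv₂ : v ∈ F₂) (hne : F₁ ≠ F₂) :
    Disjoint ((F₁.erase v).biUnion fun u => Blk (ThruA G v u) u)
      ((F₂.erase v).biUnion fun u => Blk (ThruA G v u) u) := by
  rw [Finset.disjoint_biUnion_left]
  intro u₁ h₁
  rw [Finset.disjoint_biUnion_right]
  intro u₂ h₂
  rw [Finset.mem_erase] at h₁ h₂
  refine blk_disj hG hF₁ hF₂ hv₁ hv₂ h₁.2 h₂.2 h₁.1 h₂.1 ?_
  rintro rfl
  exact hne (hG.lin _ hF₁ _ hF₂ u₁ v h₁.1 h₁.2 hv₁ h₂.2 hv₂)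

lemma Y_nonneg {b' : ℝ} (hb : 0 ≤ b') (v u : α) (ω) : 0 ≤ Y G b' v u ω := by
  unfold Y; split_ifs <;> simp [hb]

lemma Y_le_one {b' : ℝ} (hb : b' ≤ 1) (v u : α) (ω) : Y G b' v u ω ≤ 1 := by
  unfold Y; split_ifs <;> simp [hb]

lemma T_nonneg {b' : ℝ} (hb : 0 ≤ b') (v : α) (F) (ω) : 0 ≤ T G b' v F ω := by
  unfold T; split_ifs
  · simp
  · exact Finset.prod_nonneg fun u _ => Y_nonneg hb _ _ _

lemma T_le {b' : ℝ} (hb : 0 ≤ b') (hb1 : b' ≤ 1) (v : α) (F) (ω) : T G b' v F ω ≤ b' := by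
  unfold T; split_ifs with h
  · exact hb
  · unfold Sel at h
    push Not at h
    obtain ⟨u, hu, hne⟩ := h
    rw [← Finset.mul_prod_erase _ _ hu]
    have h1 : Y G b' v u ω ≤ b' := by
      unfold Y; rw [if_neg hne]; split_ifs <;> simp [hb]
    have h2 : ∏ x ∈ (F.erase v).erase u, Y G b' v x ω ≤ 1 :=
      Finset.prod_le_one (fun x _ => Y_nonneg hb _ _ _) fun x _ => Y_le_one hb1 _ _ _
    have h3 : 0 ≤ ∏ x ∈ (F.erase v).erase u, Y G b' v x ω :=
      Finset.prod_nonneg (fun x _ => Y_nonneg hb _ _ _)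
    have h4 := Y_nonneg (G := G) hb v u ω
    nlinarith

/-- Survival rate of `u` without the coin. -/
noncomputable def Q (G : Finset (Finset α)) (p : ℝ) (u : α) : ℝ :=
  ∏ F ∈ Thru G u, (1 - p ^ (F.card - 1))

lemma Ex_Y_le (hW : Wt w p s) (hG : Good G) (hp0 : 0 ≤ p) (hp1 : p < 1)
    (hs : ∀ u, s u * Q G p u = 1 / 2) {b b' : ℝ} (hb' : 0 ≤ b')
    (hbb : b' = 2 * (b - p) * (1 - p)) {v u : α} {F : Finset α} (hF : F ∈ G) (hv : v ∈ F)
    (hu : u ∈ F) (huv : u ≠ v) : Ex w (Y G b' v u) ≤ b := by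
  have h1 : Y G b' v u = fun ω => (if ω u = 0 then (1:ℝ) else 0) +
      b' * (if Surv (ThruA G v u) u ω then 1 else 0) := by
    funext ω
    unfold Y
    by_cases h : ω u = 0
    · have : ¬ Surv (ThruA G v u) u ω := by
        intro hS; have := hS.1; rw [h] at this; exact absurd this (by decide)
      simp [h, this]
    · simp [h]
  rw [h1, Ex_add, Ex_mul_left, Ex_Surv hW hG (fun F hF => by
    simp only [ThruA, Finset.mem_filter] at hF; exact ⟨hF.1, hF.2.1⟩),
    Ex_coord hW.one u (fun a => if a = 0 then (1:ℝ) else 0)]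
  have h2 : Thru G u = insert F (ThruA G v u) := by
    ext E
    simp only [Thru, ThruA, Finset.mem_filter, Finset.mem_insert]
    constructor
    · rintro ⟨hE, huE⟩
      by_cases hvE : v ∈ E
      · exact Or.inl (hG.lin E hE F hF u v huv huE hvE hu hv)
      · exact Or.inr ⟨hE, huE, hvE⟩
    · rintro (rfl | h)
      · exact ⟨hF, hu⟩
      · exact ⟨h.1, h.2.1⟩
  have h3 : F ∉ ThruA G v u := by simp [ThruA, hv]
  have h4 := hs u
  unfold Q at h4
  rw [h2, Finset.prod_insert h3] at h4
  set P := ∏ F ∈ ThruA G v u, (1 - p ^ (F.card - 1))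
  have h5 : p ^ (F.card - 1) ≤ p := by
    have := hG.two F hF
    calc p ^ (F.card - 1) ≤ p ^ 1 := pow_le_pow_of_le_one hp0 hp1.le (by omega)
      _ = p := pow_one p
  have hP : 0 < s u * P := by
    have : 0 < (1 - p ^ (F.card - 1)) * (s u * P) := by nlinarith
    exact pos_of_mul_pos_right this (by linarith)
  have h6 : (1 - p) * (s u * P) ≤ 1 / 2 := by nlinarith
  have h7 : (∑ a, w u a * if a = 0 then (1:ℝ) else 0) = p := by simp [hW.sel]
  rw [h7]
  have hbp : 0 ≤ b - p := by
    by_contra hneg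
    push Not at hneg
    nlinarith [mul_pos_of_neg_of_neg hneg (by linarith : -(1-p) < 0)]
  calc p + b' * (s u * P) = p + 2 * (b - p) * ((1 - p) * (s u * P)) := by rw [hbb]; ring
    _ ≤ p + 2 * (b - p) * (1 / 2) := by gcongr
    _ = b := by ring

lemma Ex_T_le (hW : Wt w p s) (hG : Good G) (hp0 : 0 ≤ p) (hp1 : p < 1)
    (hs : ∀ u, s u * Q G p u = 1 / 2) {b b' : ℝ} (hb' : 0 ≤ b')
    (hbb : b' = 2 * (b - p) * (1 - p)) {v : α} {F : Finset α} (hF : F ∈ G) (hv : v ∈ F) :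
    Ex w (T G b' v F) ≤ b ^ (F.card - 1) := by
  have h1 : Ex w (T G b' v F) ≤ Ex w (fun ω => ∏ u ∈ F.erase v, Y G b' v u ω) := by
    refine Ex_mono hW.nn fun ω => ?_
    unfold T; split_ifs
    · exact Finset.prod_nonneg fun u _ => Y_nonneg hb' _ _ _
    · exact le_rfl
  refine h1.trans ?_
  rw [Ex_prod hW.one _ _ (fun u => Blk (ThruA G v u) u) (fun u _ => Y_dep b' v u)]
  · rw [← Finset.card_erase_of_mem hv]
    refine (Finset.prod_le_prod (g := fun _ => b) ?_ ?_).trans_eq (Finset.prod_const _)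
    · exact fun u _ => Ex_nonneg hW.nn (Y_nonneg hb' _ _)
    · intro u hu
      rw [Finset.mem_erase] at hu
      exact Ex_Y_le hW hG hp0 hp1 hs hb' hbb hF hv hu.2 hu.1
  · intro u₁ h₁ u₂ h₂ hne
    rw [Finset.mem_erase] at h₁ h₂
    exact blk_disj hG hF hF hv hv h₁.2 h₂.2 h₁.1 h₂.1 hne

/-- Weighted degree. -/
noncomputable def Wd (G : Finset (Finset α)) (b : ℝ) (v : α) : ℝ :=
  ∑ F ∈ Thru G v, b ^ (F.card - 1)

/-- Future weighted degree. -/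
noncomputable def Z (G : Finset (Finset α)) (b' : ℝ) (v : α) (ω : α → Fin 3) : ℝ :=
  ∑ F ∈ Thru G v, T G b' v F ω

lemma Ex_Z (hW : Wt w p s) (hG : Good G) (hp0 : 0 ≤ p) (hp1 : p < 1)
    (hs : ∀ u, s u * Q G p u = 1 / 2) {b b' m : ℝ} (hb' : 0 ≤ b') (hb1 : b' ≤ 1)
    (hbb : b' = 2 * (b - p) * (1 - p)) {v : α} (hm : Wd G b v ≤ m) :
    Ex w (fun ω => if m + 1 < Z G b' v ω then 1 else 0) ≤ b' * m := by
  unfold Z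
  refine Ex_cheb hW.nn hW.one (Thru G v) (T G b' v)
    (fun F => (F.erase v).biUnion fun u => Blk (ThruA G v u) u) b' m hb'
    (fun F _ => T_dep b' v F) ?_ (fun F _ => T_nonneg hb' v F) (fun F _ => T_le hb' hb1 v F) ?_
  · intro F₁ h₁ F₂ h₂ hne
    simp only [Thru, Finset.mem_filter] at h₁ h₂
    exact T_disj hG h₁.1 h₂.1 h₁.2 h₂.2 hne
  · refine le_trans (Finset.sum_le_sum fun F hF => ?_) hm
    simp only [Thru, Finset.mem_filter] at hF
    exact Ex_T_le hW hG hp0 hp1 hs hb' hbb hF.1 hF.2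

end

section
variable {α : Type*} [Fintype α] [DecidableEq α] {G : Finset (Finset α)}

/-- The trace hypergraph after one round. -/
def Tr (G : Finset (Finset α)) (V' S : Finset α) : Finset (Finset α) :=
  (G.filter fun F => F ⊆ V' ∪ S ∧ (F ∩ V').Nonempty).image fun F => F ∩ V'

lemma mem_Tr {V' S E : Finset α} : E ∈ Tr G V' S ↔
    ∃ F ∈ G, F ⊆ V' ∪ S ∧ (F ∩ V').Nonempty ∧ F ∩ V' = E := by
  simp only [Tr, Finset.mem_image, Finset.mem_filter]
  constructor
  · rintro ⟨F, ⟨h1, h2, h3⟩, h4⟩; exact ⟨F, h1, h2, h3, h4⟩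
  · rintro ⟨F, h1, h2, h3, h4⟩; exact ⟨F, ⟨h1, h2, h3⟩, h4⟩

lemma tr_two (hG : Good G) {V' S : Finset α} {ω : α → Fin 3}
    (hS : ∀ u ∈ S, ω u = 0) (hV : ∀ u ∈ V', Surv (Thru G u) u ω) {F : Finset α} (hF : F ∈ G)
    (hFs : F ⊆ V' ∪ S) (hne : (F ∩ V').Nonempty) : 2 ≤ (F ∩ V').card := by
  by_contra hlt
  have h1 : (F ∩ V').card = 1 := by
    have := hne.card_pos
    omega
  obtain ⟨v, hv⟩ := Finset.card_eq_one.1 h1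
  have hvm : v ∈ F ∩ V' := by rw [hv]; simp
  rw [Finset.mem_inter] at hvm
  refine (hV v hvm.2).2 F (by simp [Thru, hF, hvm.1]) ?_
  intro x hx
  rw [Finset.mem_erase] at hx
  rcases Finset.mem_union.1 (hFs hx.2) with h | h
  · have : x ∈ F ∩ V' := Finset.mem_inter.2 ⟨hx.2, h⟩
    rw [hv, Finset.mem_singleton] at this
    exact absurd this hx.1
  · exact hS x h

lemma tr_inj (hG : Good G) {V' S : Finset α} {ω : α → Fin 3}
    (hS : ∀ u ∈ S, ω u = 0) (hV : ∀ u ∈ V', Surv (Thru G u) u ω) :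
    Set.InjOn (fun F => F ∩ V') (G.filter fun F => F ⊆ V' ∪ S ∧ (F ∩ V').Nonempty : Finset _) := by
  intro F₁ h₁ F₂ h₂ heq
  simp only [Finset.coe_filter, Set.mem_ofPred_eq] at h₁ h₂ heq
  have := tr_two hG hS hV h₁.1 h₁.2.1 h₁.2.2
  obtain ⟨x, hx, y, hy, hxy⟩ := Finset.one_lt_card.1 (by omega : 1 < (F₁ ∩ V').card)
  have hx2 := hx
  have hy2 := hy
  rw [heq] at hx2 hy2
  rw [Finset.mem_inter] at hx hy hx2 hy2
  exact hG.lin F₁ h₁.1 F₂ h₂.1 x y hxy hx.1 hy.1 hx2.1 hy2.1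

lemma tr_good (hG : Good G) {V' S : Finset α} {ω : α → Fin 3}
    (hS : ∀ u ∈ S, ω u = 0) (hV : ∀ u ∈ V', Surv (Thru G u) u ω) : Good (Tr G V' S) where
  two := by
    intro E hE
    obtain ⟨F, h1, h2, h3, rfl⟩ := mem_Tr.1 hE
    exact tr_two hG hS hV h1 h2 h3
  lin := by
    intro E₁ h₁ E₂ h₂ x y hxy a b c d
    obtain ⟨F₁, k₁, -, -, rfl⟩ := mem_Tr.1 h₁
    obtain ⟨F₂, k₂, -, -, rfl⟩ := mem_Tr.1 h₂
    rw [Finset.mem_inter] at a b c d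
    rw [hG.lin F₁ k₁ F₂ k₂ x y hxy a.1 b.1 c.1 d.1]
  tri := by
    intro E₁ h₁ E₂ h₂ E₃ h₃ x y z n1 n2 n3 a b c d e f
    obtain ⟨F₁, k₁, -, -, rfl⟩ := mem_Tr.1 h₁
    obtain ⟨F₂, k₂, -, -, rfl⟩ := mem_Tr.1 h₂
    obtain ⟨F₃, k₃, -, -, rfl⟩ := mem_Tr.1 h₃
    rw [Finset.mem_inter] at a b c d e f
    rw [hG.tri F₁ k₁ F₂ k₂ F₃ k₃ x y z n1 n2 n3 a.1 b.1 c.1 d.1 e.1 f.1]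
  quad := by
    intro E₁ h₁ E₂ h₂ E₃ h₃ E₄ h₄ x y z t n1 n2 n3 n4 n5 n6 a b c d e f g h
    obtain ⟨F₁, k₁, -, -, rfl⟩ := mem_Tr.1 h₁
    obtain ⟨F₂, k₂, -, -, rfl⟩ := mem_Tr.1 h₂
    obtain ⟨F₃, k₃, -, -, rfl⟩ := mem_Tr.1 h₃
    obtain ⟨F₄, k₄, -, -, rfl⟩ := mem_Tr.1 h₄
    rw [Finset.mem_inter] at a b c d e f g h
    rcases hG.quad F₁ k₁ F₂ k₂ F₃ k₃ F₄ k₄ x y z t n1 n2 n3 n4 n5 n6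
      a.1 b.1 c.1 d.1 e.1 f.1 g.1 h.1 with r | r | r | r <;> simp [r]

lemma tr_Wd (hG : Good G) {V' S : Finset α} {ω : α → Fin 3} {b' : ℝ} (hb' : 0 ≤ b')
    (hS : ∀ u ∈ S, ω u = 0) (hV : ∀ u ∈ V', Surv (Thru G u) u ω) {v : α} (hv : v ∈ V') :
    Wd (Tr G V' S) b' v ≤ Z G b' v ω := by
  unfold Wd Z
  have h1 : Thru (Tr G V' S) v =
      (G.filter fun F => F ⊆ V' ∪ S ∧ v ∈ F).image fun F => F ∩ V' := by
    ext E
    simp only [Thru, Finset.mem_filter, Finset.mem_image, mem_Tr]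
    constructor
    · rintro ⟨⟨F, h1, h2, h3, rfl⟩, h4⟩
      exact ⟨F, ⟨h1, h2, (Finset.mem_inter.1 h4).1⟩, rfl⟩
    · rintro ⟨F, ⟨h1, h2, h3⟩, rfl⟩
      have : v ∈ F ∩ V' := Finset.mem_inter.2 ⟨h3, hv⟩
      exact ⟨⟨F, h1, h2, ⟨v, this⟩, rfl⟩, this⟩
  rw [h1, Finset.sum_image]
  · have h2 : (G.filter fun F => F ⊆ V' ∪ S ∧ v ∈ F) ⊆ Thru G v := by
      intro F hF
      simp only [Finset.mem_filter] at hF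
      simp [Thru, hF.1, hF.2.2]
    refine le_trans (Finset.sum_le_sum fun F hF => ?_)
      (Finset.sum_le_sum_of_subset_of_nonneg h2 fun F _ _ => T_nonneg hb' v F ω)
    simp only [Finset.mem_filter] at hF
    obtain ⟨hF, hFs, hvF⟩ := hF
    have hns : ¬ Sel (F.erase v) ω := (hV v hv).2 F (by simp [Thru, hF, hvF])
    unfold T
    rw [if_neg hns]
    have h3 : ∀ u ∈ F.erase v, Y G b' v u ω = if u ∈ V' then b' else 1 := by
      intro u hu
      rw [Finset.mem_erase] at hu
      by_cases huV : u ∈ V'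
      · rw [if_pos huV]
        have hs := hV u huV
        unfold Y
        rw [if_neg (by rw [hs.1]; decide), if_pos]
        refine ⟨hs.1, fun E hE => hs.2 E ?_⟩
        simp only [ThruA, Finset.mem_filter] at hE
        simp [Thru, hE.1, hE.2.1]
      · rw [if_neg huV]
        have : u ∈ S := (Finset.mem_union.1 (hFs hu.2)).resolve_left huV
        unfold Y
        rw [if_pos (hS u this)]
    rw [Finset.prod_congr rfl h3, Finset.prod_ite]
    simp only [Finset.prod_const, one_pow, mul_one]
    refine le_of_eq ?_
    congr 1
    have h4 : (F.erase v).filter (fun x => x ∈ V') = (F ∩ V').erase v := by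
      ext x; simp only [Finset.mem_filter, Finset.mem_erase, Finset.mem_inter]; tauto
    rw [h4, Finset.card_erase_of_mem (Finset.mem_inter.2 ⟨hvF, hv⟩)]
  · intro F₁ h₁ F₂ h₂ heq
    refine tr_inj hG hS hV ?_ ?_ heq
    · simp only [Finset.coe_filter, Set.mem_ofPred_eq] at h₁ ⊢
      exact ⟨h₁.1, h₁.2.1, v, Finset.mem_inter.2 ⟨h₁.2.2, hv⟩⟩
    · simp only [Finset.coe_filter, Set.mem_ofPred_eq] at h₂ ⊢
      exact ⟨h₂.1, h₂.2.1, v, Finset.mem_inter.2 ⟨h₂.2.2, hv⟩⟩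

lemma tr_count (hG : Good G) {V' S S' : Finset α} {ω : α → Fin 3}
    (hS : ∀ u ∈ S, ω u = 0) (hV : ∀ u ∈ V', Surv (Thru G u) u ω) (hS' : S' ⊆ V') :
    (G.filter fun F => F ⊆ S ∪ S').card ≤
      (G.filter fun F => F ⊆ S).card + ((Tr G V' S).filter fun F => F ⊆ S').card := by
  have hdisj : ∀ x ∈ V', x ∉ S := by
    intro x hx hxS
    have := (hV x hx).1
    rw [hS x hxS] at this
    exact absurd this (by decide)
  have h1 : (G.filter fun F => F ⊆ S ∪ S') ⊆ (G.filter fun F => F ⊆ S) ∪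
      (G.filter fun F => F ⊆ S ∪ S' ∧ (F ∩ V').Nonempty) := by
    intro F hF
    simp only [Finset.mem_filter, Finset.mem_union] at hF ⊢
    by_cases h : (F ∩ V').Nonempty
    · exact Or.inr ⟨hF.1, hF.2, h⟩
    · left
      refine ⟨hF.1, fun x hx => ?_⟩
      rcases Finset.mem_union.1 (hF.2 hx) with h' | h'
      · exact h'
      · exact absurd ⟨x, Finset.mem_inter.2 ⟨hx, hS' h'⟩⟩ h
  refine (Finset.card_le_card h1).trans ((Finset.card_union_le _ _).trans ?_)
  refine Nat.add_le_add_left ?_ _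
  refine Finset.card_le_card_of_injOn (fun F => F ∩ V') ?_ ?_
  · intro F hF
    simp only [Finset.coe_filter, Set.mem_ofPred_eq, mem_Tr] at hF ⊢
    obtain ⟨hF, hFs, hne⟩ := hF
    refine ⟨⟨F, hF, ?_, hne, rfl⟩, ?_⟩
    · intro x hx
      rcases Finset.mem_union.1 (hFs hx) with h | h
      · exact Finset.mem_union_right _ h
      · exact Finset.mem_union_left _ (hS' h)
    · intro x hx
      rw [Finset.mem_inter] at hx
      exact (Finset.mem_union.1 (hFs hx.1)).resolve_left (hdisj x hx.2)
  · intro F₁ h₁ F₂ h₂ heq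
    have aux : ∀ F ∈ (G.filter fun F => F ⊆ S ∪ S' ∧ (F ∩ V').Nonempty),
        F ∈ (G.filter fun F => F ⊆ V' ∪ S ∧ (F ∩ V').Nonempty) := by
      intro F hF
      simp only [Finset.mem_filter] at hF ⊢
      refine ⟨hF.1, fun x hx => ?_, hF.2.2⟩
      rcases Finset.mem_union.1 (hF.2.1 hx) with h | h
      · exact Finset.mem_union_right _ h
      · exact Finset.mem_union_left _ (hS' h)
    exact tr_inj hG hS hV (aux _ h₁) (aux _ h₂) heq

lemma prod_ge {ι : Type*} (s : Finset ι) (f : ι → ℝ) (h0 : ∀ i ∈ s, 0 ≤ f i)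
    (h1 : ∀ i ∈ s, f i ≤ 1) : 1 - ∑ i ∈ s, f i ≤ ∏ i ∈ s, (1 - f i) := by
  classical
  induction s using Finset.induction_on with
  | empty => simp
  | insert a s ha ih =>
    rw [Finset.sum_insert ha, Finset.prod_insert ha]
    have ih := ih (fun i hi => h0 i (by simp [hi])) fun i hi => h1 i (by simp [hi])
    have a0 := h0 a (by simp)
    have a1 := h1 a (by simp)
    have hs : 0 ≤ ∑ i ∈ s, f i := Finset.sum_nonneg fun i hi => h0 i (by simp [hi])
    nlinarith [mul_le_mul_of_nonneg_left ih (by linarith : 0 ≤ 1 - f a)]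

lemma card_filter_real {β : Type*} (s : Finset β) (P : β → Prop) [DecidablePred P] :
    ((s.filter P).card : ℝ) = ∑ x ∈ s, if P x then (1:ℝ) else 0 := by
  simp

lemma round_arith {L b β p b' m : ℝ} (hL : 1 ≤ L) (hb : 0 < b)
    (hβL : β * L ≤ 1 / (12 * L)) (hm0 : 0 ≤ m) (hmL : m + 1 ≤ L) (hbβ : 2 * b ≤ β)
    (hp : p = b / (4 * L)) (hbb : b' = 2 * (b - p) * (1 - p)) (hb'0 : 0 < b')
    (hb'2 : b' ≤ 2 * b) :
    (m + 1) / (8 * L) * b ≤ p * (3 / 4) + m / (8 * L) * b' * (1 / 2 - b' * L) := by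
  have hLpos : 0 < L := by linarith
  obtain ⟨x, hx⟩ : ∃ x, x = 1 / (4 * L) := ⟨_, rfl⟩
  have hx0 : 0 < x := by rw [hx]; positivity
  have hxL : x * L = 1 / 4 := by rw [hx]; field_simp
  have hpx : p = b * x := by rw [hp, hx]; ring
  have hp0 : 0 < p := by rw [hpx]; positivity
  have hmx : m * x ≤ 1 / 4 := by nlinarith
  have hcx : m / (8 * L) = m * x / 2 := by rw [hx]; field_simp; ring
  have hlhs : (m + 1) / (8 * L) * b = (m + 1) * x / 2 * b := by rw [hx]; field_simp; norm_num
  have hβ0 : 0 < β := by linarith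
  have hbL : 2 * (b' * L) + p ≤ x := by
    have e1 : β * L ≤ x / 3 := by
      refine hβL.trans (le_of_eq ?_); rw [hx]; field_simp; norm_num
    have e2 : β ≤ x / 3 := by nlinarith
    have e3 : b' * L ≤ β * L := mul_le_mul_of_nonneg_right (by linarith) hLpos.le
    have e4 : p ≤ β := by
      rw [hp, div_le_iff₀ (by positivity)]; nlinarith
    linarith
  have hx1 : x ≤ 1 / 4 := by nlinarith
  have hbL0 : 0 ≤ b' * L := by positivity
  have hfac : b * (1 - 2 * x) ≤ b' * (1 / 2 - b' * L) := by
    have e0 : b - p = b * (1 - x) := by rw [hpx]; ring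
    have h2 : b' / 2 = b * (1 - x) * (1 - p) := by rw [hbb, e0]; ring
    have e1 : b' * (1 / 2 - b' * L) = b * ((1 - x) * ((1 - p) * (1 - 2 * (b' * L)))) := by
      have : b' * (1 / 2 - b' * L) = (b' / 2) * (1 - 2 * (b' * L)) := by ring
      rw [this, h2]; ring
    rw [e1]
    refine mul_le_mul_of_nonneg_left ?_ hb.le
    have e2 : 1 - x ≤ (1 - p) * (1 - 2 * (b' * L)) := by
      have : 0 ≤ p * (b' * L) := by positivity
      linarith
    have e3 := mul_le_mul_of_nonneg_left e2 (by linarith : 0 ≤ 1 - x)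
    have e4 : 0 ≤ x * x := by positivity
    linarith
  rw [hlhs, hcx, hpx]
  have h4 : m * x / 2 * (b * (1 - 2 * x)) ≤ m * x / 2 * (b' * (1 / 2 - b' * L)) :=
    mul_le_mul_of_nonneg_left hfac (by positivity)
  have h5 : 0 ≤ b * x * (1 / 4 - m * x) := by
    apply mul_nonneg (by positivity); linarith
  linarith

theorem nibble (L β : ℝ) (hL : 1 ≤ L) (hβ : β ≤ 1 / (12 * L ^ 2)) :
    ∀ m : ℕ, (m : ℝ) ≤ L → ∀ (G : Finset (Finset α)) (V : Finset α) (b : ℝ), Good G →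
      (∀ F ∈ G, F ⊆ V) → 0 < b → b * 2 ^ m ≤ β → (∀ v ∈ V, Wd G b v ≤ L - m) →
      ∃ S ⊆ V, (m : ℝ) / (8 * L) * b * V.card ≤
        (S.card : ℝ) - ((G.filter fun F => F ⊆ S).card : ℝ) := by
  intro m
  induction m with
  | zero =>
    intro _ G V b hG _ _ _ _
    refine ⟨∅, by simp, ?_⟩
    have : G.filter (fun F => F ⊆ ∅) = ∅ := by
      rw [Finset.filter_eq_empty_iff]
      intro F hF h
      have := hG.two F hF
      rw [Finset.subset_empty.1 h] at this
      simp at this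
    rw [this]
    simp
  | succ m ih =>
    intro hmL G V b hG hGV hb hbβ hWd
    push_cast at hmL hWd
    have hLpos : 0 < L := by linarith
    have hβ1 : β * (12 * L ^ 2) ≤ 1 := by
      rw [le_div_iff₀ (by positivity)] at hβ; exact hβ
    have h2m : (1:ℝ) ≤ 2 ^ m := one_le_pow₀ (by norm_num)
    have hbβ' : 2 * b ≤ β := by rw [pow_succ] at hbβ; nlinarith
    have hβ0 : 0 < β := by linarith
    have hβL : β * L ≤ 1 / (12 * L) := by
      rw [le_div_iff₀ (by positivity)]; nlinarith
    have hinvL : 1 / (12 * L) ≤ 1 / 12 := by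
      apply one_div_le_one_div_of_le <;> linarith
    have hβ12 : β ≤ 1 / 12 := by nlinarith
    obtain ⟨p, hp⟩ : ∃ p, p = b / (4 * L) := ⟨_, rfl⟩
    have hpL : p * (4 * L) = b := by rw [hp]; field_simp
    have hp0 : 0 < p := by rw [hp]; positivity
    have hpb : p ≤ b := by nlinarith
    have hp1 : p ≤ 1 / 12 := by linarith
    obtain ⟨b', hbb⟩ : ∃ b', b' = 2 * (b - p) * (1 - p) := ⟨_, rfl⟩
    have hpb' : p < b := by nlinarith
    have hb'0 : 0 < b' := by
      rw [hbb]; exact mul_pos (mul_pos two_pos (by linarith)) (by linarith)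
    have hb'2 : b' ≤ 2 * b := by
      rw [hbb]; nlinarith
    have hb'1 : b' ≤ 1 := by linarith
    have hb'β : b' * 2 ^ m ≤ β := by rw [pow_succ] at hbβ; nlinarith
    -- closing probabilities
    have hclose : ∀ v, ∑ F ∈ Thru G v, p ^ (F.card - 1) ≤ 1 / 4 := by
      intro v
      by_cases hv : v ∈ V
      · have h1 : ∀ F ∈ Thru G v, p ^ (F.card - 1) ≤ b ^ (F.card - 1) * (1 / (4 * L)) := by
          intro F hF
          have hF2 := hG.two F (by simp only [Thru, Finset.mem_filter] at hF; exact hF.1)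
          have hx0 : (0:ℝ) ≤ 1 / (4 * L) := by positivity
          have hx1 : 1 / (4 * L) ≤ 1 := by
            rw [div_le_one (by positivity)]; linarith
          have : p = b * (1 / (4 * L)) := by rw [hp]; ring
          rw [this, mul_pow]
          refine mul_le_mul_of_nonneg_left ?_ (by positivity)
          calc (1 / (4 * L)) ^ (F.card - 1) ≤ (1 / (4 * L)) ^ 1 :=
                pow_le_pow_of_le_one hx0 hx1 (by omega)
            _ = _ := pow_one _
        refine (Finset.sum_le_sum h1).trans ?_
        rw [← Finset.sum_mul]
        have h2 := hWd v hv
        unfold Wd at h2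
        have h3 : ∑ F ∈ Thru G v, b ^ (F.card - 1) ≤ L := by
          have : (0:ℝ) ≤ m := Nat.cast_nonneg m
          linarith
        calc _ ≤ L * (1 / (4 * L)) := mul_le_mul_of_nonneg_right h3 (by positivity)
          _ = 1 / 4 := by field_simp
      · have : Thru G v = ∅ := by
          unfold Thru
          rw [Finset.filter_eq_empty_iff]
          exact fun F hF h => hv (hGV F hF h)
        rw [this]; simp
    have hQ : ∀ u, 3 / 4 ≤ Q G p u := by
      intro u
      have := prod_ge (Thru G u) (fun F => p ^ (F.card - 1)) (fun F _ => by positivity)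
        (fun F _ => pow_le_one₀ hp0.le (by linarith))
      have h2 := hclose u
      unfold Q
      linarith
    let s : α → ℝ := fun u => 1 / 2 / Q G p u
    have hs : ∀ u, s u * Q G p u = 1 / 2 := by
      intro u
      have := hQ u
      simp only [s]
      field_simp
    have hs0 : ∀ u, 0 ≤ s u := fun u => div_nonneg (by norm_num) (by linarith [hQ u])
    have hs1 : ∀ u, s u ≤ 2 / 3 := by
      intro u
      have := hQ u
      simp only [s]
      rw [div_le_iff₀ (by linarith)]
      linarith
    let w : α → Fin 3 → ℝ := fun u => ![p, s u, 1 - p - s u]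
    have hW : Wt w p s := by
      refine ⟨?_, ?_, fun u => rfl, fun u => rfl⟩
      · intro u a
        fin_cases a
        · exact hp0.le
        · exact hs0 u
        · have := hs1 u
          simp only [w]
          change 0 ≤ 1 - p - s u
          linarith
      · intro u
        simp only [w, Fin.sum_univ_three]
        change p + s u + (1 - p - s u) = 1
        ring
    -- the random sets
    let S₀ : (α → Fin 3) → Finset α := fun ω => V.filter fun u => ω u = 0
    let V' : (α → Fin 3) → Finset α := fun ω =>
      V.filter fun u => Surv (Thru G u) u ω ∧ Z G b' u ω ≤ L - m
    let c : ℝ := (m : ℝ) / (8 * L)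
    have hc0 : 0 ≤ c := by positivity
    have hExS : Ex w (fun ω => ((S₀ ω).card : ℝ)) = p * V.card := by
      simp only [S₀, card_filter_real]
      rw [Ex_sum]
      have : ∀ u ∈ V, Ex w (fun ω => if ω u = 0 then (1:ℝ) else 0) = p := by
        intro u _
        rw [Ex_coord hW.one u (fun a => if a = 0 then (1:ℝ) else 0)]
        simp [hW.sel]
      rw [Finset.sum_congr rfl this]
      simp [mul_comm]
    have hExE : Ex w (fun ω => ((G.filter fun F => F ⊆ S₀ ω).card : ℝ)) ≤ p * V.card * (1 / 4) := by
      simp only [card_filter_real]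
      rw [Ex_sum]
      have h1 : ∀ F ∈ G, Ex w (fun ω => if F ⊆ S₀ ω then (1:ℝ) else 0) ≤
          ∑ v ∈ V, if v ∈ F then p * p ^ (F.card - 1) else 0 := by
        intro F hF
        have hle : Ex w (fun ω => if F ⊆ S₀ ω then (1:ℝ) else 0) ≤ p ^ F.card := by
          rw [← Ex_Sel hW F]
          refine Ex_mono hW.nn fun ω => ?_
          by_cases h : F ⊆ S₀ ω
          · have : Sel F ω := fun x hx => (Finset.mem_filter.1 (h hx)).2
            simp [h, this]
          · rw [if_neg h]; split_ifs <;> norm_num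
        have h2 := hG.two F hF
        obtain ⟨v, hv⟩ : F.Nonempty := Finset.card_pos.1 (by omega)
        have h3 := Finset.single_le_sum
          (f := fun v => if v ∈ F then p * p ^ (F.card - 1) else 0) (s := V)
          (fun i _ => by split_ifs <;> positivity) (hGV F hF hv)
        simp only [hv, if_true] at h3
        refine hle.trans (le_trans (le_of_eq ?_) h3)
        rw [← pow_succ']
        congr 1
        omega
      refine (Finset.sum_le_sum h1).trans ?_
      rw [Finset.sum_comm]
      have h2 : ∀ v ∈ V, ∑ F ∈ G, (if v ∈ F then p * p ^ (F.card - 1) else 0) ≤ p * (1 / 4) := by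
        intro v _
        rw [← Finset.sum_filter, ← Finset.mul_sum]
        exact mul_le_mul_of_nonneg_left (hclose v) hp0.le
      refine (Finset.sum_le_sum h2).trans (le_of_eq ?_)
      simp; ring
    have hExV : (1 / 2 - b' * L) * V.card ≤ Ex w (fun ω => ((V' ω).card : ℝ)) := by
      simp only [V', card_filter_real]
      rw [Ex_sum]
      have h1 : ∀ u ∈ V, 1 / 2 - b' * L ≤
          Ex w (fun ω => if Surv (Thru G u) u ω ∧ Z G b' u ω ≤ L - m then (1:ℝ) else 0) := by
        intro u hu
        have hA := Ex_Surv hW hG (𝓕 := Thru G u) (u := u) (fun F hF => by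
          simpa [Thru] using hF)
        have hA' : Ex w (fun ω => if Surv (Thru G u) u ω then 1 else 0) = 1 / 2 := by
          rw [hA]; exact hs u
        have hB := Ex_Z hW hG hp0.le (by linarith) hs hb'0.le hb'1 hbb (hWd u hu)
        have hm0 : (0:ℝ) ≤ m := Nat.cast_nonneg m
        have hC : b' * (L - (m + 1)) ≤ b' * L := by
          apply mul_le_mul_of_nonneg_left _ hb'0.le; linarith
        have hD : Ex w (fun ω => (if Surv (Thru G u) u ω then (1:ℝ) else 0) -
            (if L - (m + 1) + 1 < Z G b' u ω then 1 else 0)) ≤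
            Ex w (fun ω => if Surv (Thru G u) u ω ∧ Z G b' u ω ≤ L - m then (1:ℝ) else 0) := by
          refine Ex_mono hW.nn fun ω => ?_
          by_cases h1 : Surv (Thru G u) u ω <;> by_cases h2 : Z G b' u ω ≤ L - m
          · simp only [h1, h2, if_true, and_self]
            split_ifs <;> norm_num
          · have : L - (m + 1) + 1 < Z G b' u ω := by linarith
            simp [h1, h2, this]
          · simp only [h1, if_false, false_and]
            split_ifs <;> norm_num
          · simp only [h1, if_false, false_and]
            split_ifs <;> norm_num
        rw [Ex_sub, hA'] at hD
        linarith
      have h2 := Finset.sum_le_sum h1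
      rw [Finset.sum_const, nsmul_eq_mul] at h2
      linarith
    obtain ⟨ω, hω⟩ := Ex_exists hW.nn hW.one (fun ω => ((S₀ ω).card : ℝ) -
      ((G.filter fun F => F ⊆ S₀ ω).card : ℝ) + c * b' * ((V' ω).card : ℝ))
    rw [Ex_add, Ex_sub, Ex_mul_left, hExS] at hω
    have hS : ∀ u ∈ S₀ ω, ω u = 0 := fun u hu => (Finset.mem_filter.1 hu).2
    have hV : ∀ u ∈ V' ω, Surv (Thru G u) u ω := fun u hu => (Finset.mem_filter.1 hu).2.1
    obtain ⟨S', hS'V, hS'⟩ := ih (by linarith) (Tr G (V' ω) (S₀ ω)) (V' ω) b' (tr_good hG hS hV)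
      (by
        intro E hE
        obtain ⟨F, -, -, -, rfl⟩ := mem_Tr.1 hE
        exact Finset.inter_subset_right) hb'0 hb'β
      (fun v hv => (tr_Wd hG hb'0.le hS hV hv).trans (Finset.mem_filter.1 hv).2.2)
    refine ⟨S₀ ω ∪ S', Finset.union_subset (Finset.filter_subset _ _)
      (hS'V.trans (Finset.filter_subset _ _)), ?_⟩
    have hcard : ((S₀ ω ∪ S').card : ℝ) = (S₀ ω).card + S'.card := by
      rw [Finset.card_union_of_disjoint]
      · push_cast; rfl
      · rw [Finset.disjoint_left]
        intro x hx hx'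
        have h1 := (hV x (hS'V hx')).1
        rw [hS x hx] at h1
        exact absurd h1 (by decide)
    have hcount : ((G.filter fun F => F ⊆ S₀ ω ∪ S').card : ℝ) ≤
        (G.filter fun F => F ⊆ S₀ ω).card + ((Tr G (V' ω) (S₀ ω)).filter fun F => F ⊆ S').card := by
      exact_mod_cast tr_count hG hS hV hS'V
    rw [hcard]
    have hN : (0:ℝ) ≤ V.card := Nat.cast_nonneg _
    have hmain : ((m + 1 : ℕ) : ℝ) / (8 * L) * b ≤
        p * (3 / 4) + c * b' * (1 / 2 - b' * L) := by
      have := round_arith hL hb hβL (Nat.cast_nonneg m) hmL hbβ' hp hbb hb'0 hb'2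
      push_cast
      exact this
    have h6 : c * b' * ((1 / 2 - b' * L) * V.card) ≤
        c * b' * Ex w (fun ω => ((V' ω).card : ℝ)) :=
      mul_le_mul_of_nonneg_left hExV (by positivity)
    have h7 := mul_le_mul_of_nonneg_right hmain hN
    linarith

/-- Independent sets in uniform hypergraphs of girth at least five. -/
theorem indep (G : Finset (Finset α)) (V : Finset α) (k R : ℕ) (b D : ℝ) (hG : Good G)
    (hGV : ∀ F ∈ G, F ⊆ V) (hk : ∀ F ∈ G, F.card = k) (hb : 0 < b) (hR : 1 ≤ R)
    (hdeg : ∀ v ∈ V, ((G.filter fun F => v ∈ F).card : ℝ) ≤ D) (hD : D * b ^ (k - 1) ≤ R)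
    (hbR : b * 2 ^ R ≤ 1 / (48 * (R : ℝ) ^ 2)) :
    ∃ I ⊆ V, (∀ F ∈ G, ¬ F ⊆ I) ∧ 1 / 16 * b * V.card ≤ (I.card : ℝ) := by
  have hR' : (1:ℝ) ≤ R := by exact_mod_cast hR
  obtain ⟨S, hSV, hS⟩ := nibble (α := α) (2 * R) (1 / (48 * (R : ℝ) ^ 2)) (by linarith)
    (le_of_eq (by ring)) R (by linarith) G V b hG hGV hb hbR (by
      intro v hv
      unfold Wd Thru
      have : ∀ F ∈ G.filter (fun F => v ∈ F), b ^ (F.card - 1) = b ^ (k - 1) := by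
        intro F hF
        rw [hk F (Finset.mem_filter.1 hF).1]
      rw [Finset.sum_congr rfl this, Finset.sum_const, nsmul_eq_mul]
      have := mul_le_mul_of_nonneg_right (hdeg v hv) (by positivity : 0 ≤ b ^ (k - 1))
      linarith)
  -- delete one vertex per remaining edge
  have hne : ∀ F ∈ G, F.Nonempty := fun F hF => Finset.card_pos.1 (by have := hG.two F hF; omega)
  rcases isEmpty_or_nonempty α with hα | hα
  · refine ⟨∅, by simp, fun F hF => ?_, ?_⟩
    · obtain ⟨x, -⟩ := hne F hF
      exact (hα.false x).elim
    · have : V = ∅ := Finset.eq_empty_of_isEmpty V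
      simp [this]
  choose! pick hpick using hne
  let X := (G.filter fun F => F ⊆ S).image pick
  refine ⟨S \ X, Finset.sdiff_subset.trans hSV, ?_, ?_⟩
  · intro F hF hsub
    have h1 := hsub (hpick F hF)
    rw [Finset.mem_sdiff] at h1
    exact h1.2 (Finset.mem_image.2 ⟨F, Finset.mem_filter.2 ⟨hF, hsub.trans Finset.sdiff_subset⟩, rfl⟩)
  · have h1 : S.card ≤ (S \ X).card + X.card := by
      have := Finset.card_le_card_sdiff_add_card (s := S) (t := X)
      omega
    have h2 : X.card ≤ (G.filter fun F => F ⊆ S).card := Finset.card_image_le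
    have h3 : (S.card : ℝ) ≤ (S \ X).card + (G.filter fun F => F ⊆ S).card := by
      exact_mod_cast h1.trans (Nat.add_le_add_left h2 _)
    have h4 : (R : ℝ) / (8 * (2 * R)) = 1 / 16 := by field_simp; norm_num
    rw [h4] at hS
    linarith

end

section
variable {α : Type*} [Fintype α] [DecidableEq α]

lemma alter (𝓡 : Finset α) (Bad Aux : Finset (Finset α)) (hBad : ∀ U ∈ Bad, U.Nonempty)
    (p lam : ℝ) (hp0 : 0 ≤ p) (hp1 : p ≤ 1) (hlam : 0 ≤ lam) :
    ∃ A ⊆ 𝓡, (∀ U ∈ Bad, ¬ U ⊆ A) ∧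
      p * 𝓡.card - ∑ U ∈ Bad, p ^ U.card - lam * ∑ U ∈ Aux, p ^ U.card ≤
        (A.card : ℝ) - lam * ((Aux.filter fun U => U ⊆ A).card : ℝ) := by
  rcases isEmpty_or_nonempty α with hα | hα
  · have h𝓡 : 𝓡 = ∅ := Finset.eq_empty_of_isEmpty 𝓡
    refine ⟨∅, by simp, fun U hU => ?_, ?_⟩
    · obtain ⟨x, -⟩ := hBad U hU
      exact (hα.false x).elim
    · have hU : ∀ U : Finset α, U = ∅ := fun U => Finset.eq_empty_of_isEmpty U
      have h1 : 0 ≤ ∑ U ∈ Bad, p ^ U.card := Finset.sum_nonneg fun U _ => by positivity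
      have h2 : ∑ U ∈ Aux, p ^ U.card = Aux.card := by
        have h2' : ∀ U ∈ Aux, p ^ U.card = 1 := by
          intro U _
          rw [hU U]
          simp
        rw [Finset.sum_congr rfl h2']
        simp
      have h3 : Aux.filter (fun U => U ⊆ ∅) = Aux :=
        Finset.filter_true_of_mem fun U _ => by rw [hU U]
      rw [h2, h3, h𝓡]
      simp only [Finset.card_empty, Nat.cast_zero]
      linarith
  let w : α → Fin 3 → ℝ := fun _ => ![p, 0, 1 - p]
  have hW : Wt w p (fun _ => 0) := by
    refine ⟨?_, ?_, fun u => rfl, fun u => rfl⟩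
    · intro u a
      fin_cases a
      · exact hp0
      · exact le_rfl
      · change 0 ≤ 1 - p
        linarith
    · intro u
      simp only [w, Fin.sum_univ_three]
      change p + 0 + (1 - p) = 1
      ring
  let A₀ : (α → Fin 3) → Finset α := fun ω => 𝓡.filter fun u => ω u = 0
  have hfam : ∀ 𝓕 : Finset (Finset α),
      Ex w (fun ω => ((𝓕.filter fun U => U ⊆ A₀ ω).card : ℝ)) ≤ ∑ U ∈ 𝓕, p ^ U.card := by
    intro 𝓕
    simp only [card_filter_real]
    rw [Ex_sum]
    refine Finset.sum_le_sum fun U _ => ?_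
    rw [← Ex_Sel hW U]
    refine Ex_mono hW.nn fun ω => ?_
    by_cases h : U ⊆ A₀ ω
    · have : Sel U ω := fun x hx => (Finset.mem_filter.1 (h hx)).2
      simp [h, this]
    · rw [if_neg h]; split_ifs <;> norm_num
  have hcard : Ex w (fun ω => ((A₀ ω).card : ℝ)) = p * 𝓡.card := by
    simp only [A₀, card_filter_real]
    rw [Ex_sum]
    have : ∀ u ∈ 𝓡, Ex w (fun ω => if ω u = 0 then (1:ℝ) else 0) = p := by
      intro u _
      rw [Ex_coord hW.one u (fun a => if a = 0 then (1:ℝ) else 0)]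
      simp [hW.sel]
    rw [Finset.sum_congr rfl this]
    simp [mul_comm]
  obtain ⟨ω, hω⟩ := Ex_exists hW.nn hW.one (fun ω => ((A₀ ω).card : ℝ) -
      ((Bad.filter fun U => U ⊆ A₀ ω).card : ℝ) -
      lam * ((Aux.filter fun U => U ⊆ A₀ ω).card : ℝ))
  rw [Ex_sub, Ex_sub, Ex_mul_left, hcard] at hω
  have h1 := hfam Bad
  have h2 := mul_le_mul_of_nonneg_left (hfam Aux) hlam
  choose! pick hpick using hBad
  let X := (Bad.filter fun U => U ⊆ A₀ ω).image pick
  refine ⟨A₀ ω \ X, Finset.sdiff_subset.trans (Finset.filter_subset _ _), ?_, ?_⟩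
  · intro U hU hsub
    have h1 := hsub (hpick U hU)
    rw [Finset.mem_sdiff] at h1
    exact h1.2 (Finset.mem_image.2 ⟨U, Finset.mem_filter.2
      ⟨hU, hsub.trans Finset.sdiff_subset⟩, rfl⟩)
  · have h3 : (A₀ ω).card ≤ (A₀ ω \ X).card + X.card := by
      have := Finset.card_le_card_sdiff_add_card (s := A₀ ω) (t := X)
      omega
    have h4 : X.card ≤ (Bad.filter fun U => U ⊆ A₀ ω).card := Finset.card_image_le
    have h5 : ((A₀ ω).card : ℝ) ≤ (A₀ ω \ X).card + (Bad.filter fun U => U ⊆ A₀ ω).card := by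
      exact_mod_cast h3.trans (Nat.add_le_add_left h4 _)
    have h6 : (Aux.filter fun U => U ⊆ A₀ ω \ X).card ≤ (Aux.filter fun U => U ⊆ A₀ ω).card := by
      refine Finset.card_le_card fun U hU => ?_
      rw [Finset.mem_filter] at hU ⊢
      exact ⟨hU.1, hU.2.trans Finset.sdiff_subset⟩
    have h7 : lam * ((Aux.filter fun U => U ⊆ A₀ ω \ X).card : ℝ) ≤
        lam * ((Aux.filter fun U => U ⊆ A₀ ω).card : ℝ) :=
      mul_le_mul_of_nonneg_left (by exact_mod_cast h6) hlam
    linarith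

lemma prune (A : Finset α) (G : Finset (Finset α)) (e : ℕ) (D : ℝ) (hD : 0 < D)
    (hGA : ∀ F ∈ G, F ⊆ A) (hGe : ∀ F ∈ G, F.card = e)
    (hcnt : 2 * e * (G.card : ℝ) ≤ D * A.card) :
    ∃ B ⊆ A, (∀ v ∈ B, ((G.filter fun F => v ∈ F).card : ℝ) ≤ D) ∧
      (A.card : ℝ) / 2 ≤ B.card := by
  let B := A.filter fun v => ((G.filter fun F => v ∈ F).card : ℝ) ≤ D
  refine ⟨B, Finset.filter_subset _ _, fun v hv => (Finset.mem_filter.1 hv).2, ?_⟩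
  have h1 : ∑ v ∈ A, ((G.filter fun F => v ∈ F).card : ℝ) = e * G.card := by
    simp only [card_filter_real]
    rw [Finset.sum_comm]
    have : ∀ F ∈ G, ∑ v ∈ A, (if v ∈ F then (1:ℝ) else 0) = e := by
      intro F hF
      rw [← card_filter_real]
      rw [Finset.filter_mem_eq_inter, Finset.inter_eq_right.2 (hGA F hF), hGe F hF]
    rw [Finset.sum_congr rfl this]
    simp [mul_comm]
  have h2 : D * ((A \ B).card : ℝ) ≤ ∑ v ∈ A, ((G.filter fun F => v ∈ F).card : ℝ) := by
    have h3 : ∑ v ∈ A \ B, D ≤ ∑ v ∈ A \ B, ((G.filter fun F => v ∈ F).card : ℝ) := by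
      refine Finset.sum_le_sum fun v hv => ?_
      rw [Finset.mem_sdiff] at hv
      by_contra hcon
      push Not at hcon
      exact hv.2 (Finset.mem_filter.2 ⟨hv.1, hcon.le⟩)
    rw [Finset.sum_const, nsmul_eq_mul] at h3
    refine le_trans (by linarith) (h3.trans ?_)
    exact Finset.sum_le_sum_of_subset_of_nonneg Finset.sdiff_subset fun v _ _ => Nat.cast_nonneg _
  rw [h1] at h2
  have h4 : ((A \ B).card : ℝ) + B.card = A.card := by
    exact_mod_cast Finset.card_sdiff_add_card_eq_card (Finset.filter_subset _ _ : B ⊆ A)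
  have h5 : D * ((A \ B).card : ℝ) ≤ D * (A.card / 2) := by linarith
  have h6 := le_of_mul_le_mul_left h5 hD
  linarith

end

section
variable {n : ℕ}

lemma count_sup (s : ℕ) (hs : s ≤ n) (𝓕 : Finset (Finset (Finset (Fin n))))
    (h𝓕 : ∀ U ∈ 𝓕, (U.sup id).card ≤ s) : 𝓕.card ≤ n ^ s * 2 ^ 2 ^ s := by
  have h1 : 𝓕 ⊆ (Finset.powersetCard s (Finset.univ : Finset (Fin n))).biUnion
      fun X => X.powerset.powerset := by
    intro U hU
    obtain ⟨X, hX1, hX2, hX3⟩ := Finset.exists_subsuperset_card_eq (Finset.subset_univ (U.sup id))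
      (h𝓕 U hU) (by simpa using hs)
    rw [Finset.mem_biUnion]
    refine ⟨X, Finset.mem_powersetCard.2 ⟨hX2, hX3⟩, ?_⟩
    rw [Finset.mem_powerset]
    intro F hF
    rw [Finset.mem_powerset]
    exact (Finset.le_sup (f := id) hF : F ≤ U.sup id).trans hX1
  refine (Finset.card_le_card h1).trans (Finset.card_biUnion_le.trans ?_)
  have h2 : ∀ X ∈ Finset.powersetCard s (Finset.univ : Finset (Fin n)),
      X.powerset.powerset.card = 2 ^ 2 ^ s := by
    intro X hX
    rw [Finset.card_powerset, Finset.card_powerset, (Finset.mem_powersetCard.1 hX).2]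
  rw [Finset.sum_congr rfl h2, Finset.sum_const, Finset.card_powersetCard, smul_eq_mul]
  refine Nat.mul_le_mul_right _ ?_
  simpa using Nat.choose_le_pow n s

/-- Scaled excess of a family of `r`-sets. -/
def hx (q r t : ℕ) (U : Finset (Finset (Fin n))) : ℤ :=
  q * (U.sup id).card - U.card * (q * r - t)

lemma hx_submod (q r t : ℕ) (U T : Finset (Finset (Fin n))) :
    hx q r t (U ∪ T) + hx q r t (U ∩ T) ≤ hx q r t U + hx q r t T := by
  unfold hx
  have h1 : ((U ∪ T).card : ℤ) + (U ∩ T).card = U.card + T.card := by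
    exact_mod_cast Finset.card_union_add_card_inter U T
  have h2 : (((U ∪ T).sup id).card : ℤ) + ((U ∩ T).sup id).card ≤
      (U.sup id).card + (T.sup id).card := by
    have h3 := Finset.card_union_add_card_inter (U.sup id) (T.sup id)
    have h4 : (U ∩ T).sup id ⊆ U.sup id ∩ T.sup id :=
      Finset.subset_inter (Finset.sup_mono Finset.inter_subset_left)
        (Finset.sup_mono Finset.inter_subset_right)
    have h5 := Finset.card_le_card h4
    rw [Finset.sup_union]
    change ((U.sup id ∪ T.sup id).card : ℤ) + _ ≤ _
    omega
  have h6 : (q : ℤ) * (((U ∪ T).sup id).card + ((U ∩ T).sup id).card) ≤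
      q * ((U.sup id).card + (T.sup id).card) :=
    mul_le_mul_of_nonneg_left h2 (Int.natCast_nonneg q)
  have h7 : (((U ∪ T).card : ℤ) + (U ∩ T).card) * (q * r - t) =
      (U.card + T.card) * (q * r - t) := by rw [h1]
  linarith

/-- The auxiliary hypergraph of dense `e`-tuples. -/
def Ax (e v : ℕ) (A : Finset (Finset (Fin n))) : Finset (Finset (Finset (Fin n))) :=
  (A.powersetCard e).filter fun U => (U.sup id).card ≤ v

lemma mem_Ax {e v : ℕ} {A U : Finset (Finset (Fin n))} :
    U ∈ Ax e v A ↔ U ⊆ A ∧ U.card = e ∧ (U.sup id).card ≤ v := by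
  simp only [Ax, Finset.mem_filter, Finset.mem_powersetCard]
  tauto

lemma hx_strict {q r t e : ℕ} (hq : e = q + 1) (hco : Nat.Coprime q t)
    {U : Finset (Finset (Fin n))} (h2 : 2 ≤ U.card) (hlt : U.card < e) : hx q r t U ≠ t := by
  intro h
  unfold hx at h
  have h1 : (q : ℤ) ∣ ((U.card : ℤ) - 1) * t := by
    refine ⟨U.card * r - (U.sup id).card, ?_⟩
    linarith
  have h3 : (q : ℤ) ∣ ((U.card - 1 : ℕ) : ℤ) * t := by
    rw [Nat.cast_sub (by omega)]; simpa using h1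
  have h4 : q ∣ (U.card - 1) * t := by exact_mod_cast h3
  have h5 := hco.dvd_of_dvd_mul_right h4
  have := Nat.le_of_dvd (by omega) h5
  omega

lemma ax_good {q r t e v : ℕ} (hq : e = q + 1) (he : 3 ≤ e) (hco : Nat.Coprime q t)
    (htv : t + v = e * r) {A : Finset (Finset (Fin n))}
    (hA : ∀ U ⊆ A, U.Nonempty → U.card ≤ 4 * e → (t : ℤ) ≤ hx q r t U) : Good (Ax e v A) := by
  have hE : ∀ F ∈ Ax e v A, hx q r t F ≤ t := by
    intro F hF
    obtain ⟨-, h1, h2⟩ := mem_Ax.1 hF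
    unfold hx
    rw [h1]
    have h3 : (q : ℤ) * (F.sup id).card ≤ q * v := by
      apply mul_le_mul_of_nonneg_left _ (Int.natCast_nonneg q); exact_mod_cast h2
    have h4 : (t : ℤ) + v = e * r := by exact_mod_cast htv
    have h5 : (v : ℤ) = e * r - t := by linarith
    have h6 : (e : ℤ) = q + 1 := by exact_mod_cast hq
    rw [h5] at h3
    have : (q:ℤ) * (e * r - t) - e * (q * r - t) = (e - q) * t := by ring
    rw [h6] at this h3 ⊢
    linarith
  -- gluing an edge to a tight family
  have glue : ∀ P ⊆ A, ∀ F ∈ Ax e v A, hx q r t P ≤ t → P.card ≤ 3 * e → (P ∩ F).Nonempty →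
      hx q r t (P ∪ F) ≤ t ∧ (2 ≤ (P ∩ F).card → F ⊆ P) := by
    intro P hP F hF h1 h2 h3
    obtain ⟨hFA, hFc, -⟩ := mem_Ax.1 hF
    have h4 := hx_submod q r t P F
    have h5 := hE F hF
    have hsub : P ∩ F ⊆ F := Finset.inter_subset_right
    have hcle := Finset.card_le_card hsub
    have h6 := hA (P ∩ F) (hsub.trans hFA) h3 (by omega)
    refine ⟨by linarith, fun h7 => ?_⟩
    by_contra hcon
    have h8 : (P ∩ F).card < e := by
      rcases Nat.lt_or_ge (P ∩ F).card e with h | h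
      · exact h
      · exact absurd (Finset.inter_eq_right.1 (Finset.eq_of_subset_of_card_le hsub (by omega))) hcon
    have h9 := hx_strict (r := r) hq hco h7 h8
    have h10 : hx q r t (P ∪ F) < t := by
      have : (t : ℤ) < hx q r t (P ∩ F) := lt_of_le_of_ne h6 (Ne.symm h9)
      linarith
    have h11 := hA (P ∪ F) (Finset.union_subset hP hFA)
      (h3.mono (Finset.inter_subset_left.trans Finset.subset_union_left))
      ((Finset.card_union_le _ _).trans (by omega))
    linarith
  have two_le : ∀ {X : Finset (Finset (Fin n))} {x y}, x ≠ y → x ∈ X → y ∈ X → 2 ≤ X.card := by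
    intro X x y hxy hx hy
    exact Finset.one_lt_card.2 ⟨x, hx, y, hy, hxy⟩
  have lin : ∀ F₁ ∈ Ax e v A, ∀ F₂ ∈ Ax e v A, ∀ x y, x ≠ y → x ∈ F₁ → y ∈ F₁ → x ∈ F₂ →
      y ∈ F₂ → F₁ = F₂ := by
    intro F₁ h₁ F₂ h₂ x y hxy a b c d
    obtain ⟨hA1, hc1, -⟩ := mem_Ax.1 h₁
    obtain ⟨hA2, hc2, -⟩ := mem_Ax.1 h₂
    have hg := glue F₁ hA1 F₂ h₂ (hE _ h₁) (by omega) ⟨x, Finset.mem_inter.2 ⟨a, c⟩⟩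
    have hs := hg.2 (two_le hxy (Finset.mem_inter.2 ⟨a, c⟩) (Finset.mem_inter.2 ⟨b, d⟩))
    exact (Finset.eq_of_subset_of_card_le hs (by omega)).symm
  have third : ∀ F ∈ Ax e v A, ∀ x z : Finset (Fin n), ∃ w ∈ F, w ≠ x ∧ w ≠ z := by
    intro F hF x z
    obtain ⟨-, hc, -⟩ := mem_Ax.1 hF
    by_contra! hcon
    have : F ⊆ {x, z} := by
      intro w hw
      by_cases h : w = x
      · simp [h]
      · simp [hcon w hw h]
    have := Finset.card_le_card this
    have h2 := Finset.card_le_two (a := x) (b := z)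
    omega
  have tri : ∀ F₁ ∈ Ax e v A, ∀ F₂ ∈ Ax e v A, ∀ F₃ ∈ Ax e v A, ∀ x y z, x ≠ y → y ≠ z → x ≠ z →
      x ∈ F₁ → y ∈ F₁ → y ∈ F₂ → z ∈ F₂ → x ∈ F₃ → z ∈ F₃ → F₁ = F₂ := by
    intro F₁ h₁ F₂ h₂ F₃ h₃ x y z hxy hyz hxz a b c d f g
    obtain ⟨hA1, hc1, -⟩ := mem_Ax.1 h₁
    obtain ⟨hA2, hc2, -⟩ := mem_Ax.1 h₂
    have hg := glue F₁ hA1 F₂ h₂ (hE _ h₁) (by omega) ⟨y, Finset.mem_inter.2 ⟨b, c⟩⟩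
    have hxm : x ∈ (F₁ ∪ F₂) ∩ F₃ := by simp [a, f]
    have hzm : z ∈ (F₁ ∪ F₂) ∩ F₃ := by simp [d, g]
    have hg2 := glue (F₁ ∪ F₂) (Finset.union_subset hA1 hA2) F₃ h₃ hg.1
      ((Finset.card_union_le _ _).trans (by omega)) ⟨x, hxm⟩
    have hs := hg2.2 (two_le hxz hxm hzm)
    obtain ⟨w, hw, hwx, hwz⟩ := third F₃ h₃ x z
    rcases Finset.mem_union.1 (hs hw) with h | h
    · have e1 := lin F₁ h₁ F₃ h₃ w x hwx h a hw f
      exact lin F₁ h₁ F₂ h₂ y z hyz b (e1 ▸ g) c d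
    · have e1 := lin F₂ h₂ F₃ h₃ w z hwz h d hw g
      exact lin F₁ h₁ F₂ h₂ x y hxy a b (e1 ▸ f) c
  refine ⟨fun F hF => ?_, lin, tri, ?_⟩
  · obtain ⟨-, hc, -⟩ := mem_Ax.1 hF
    omega
  · intro F₁ h₁ F₂ h₂ F₃ h₃ F₄ h₄ x y z u hxy hxz hxu hyz hyu hzu a b c d f g k l
    obtain ⟨hA1, hc1, -⟩ := mem_Ax.1 h₁
    obtain ⟨hA2, hc2, -⟩ := mem_Ax.1 h₂
    obtain ⟨hA3, hc3, -⟩ := mem_Ax.1 h₃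
    have hg := glue F₁ hA1 F₂ h₂ (hE _ h₁) (by omega) ⟨y, Finset.mem_inter.2 ⟨b, c⟩⟩
    have hc12 := Finset.card_union_le F₁ F₂
    have hg2 := glue (F₁ ∪ F₂) (Finset.union_subset hA1 hA2) F₃ h₃ hg.1 (by omega)
      ⟨z, by simp [d, f]⟩
    have hc123 := Finset.card_union_le (F₁ ∪ F₂) F₃
    have hxm : x ∈ (F₁ ∪ F₂ ∪ F₃) ∩ F₄ := by simp [a, l]
    have hum : u ∈ (F₁ ∪ F₂ ∪ F₃) ∩ F₄ := by simp [g, k]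
    have hg3 := glue (F₁ ∪ F₂ ∪ F₃) (Finset.union_subset (Finset.union_subset hA1 hA2) hA3) F₄ h₄
      hg2.1 (by omega) ⟨x, hxm⟩
    have hs := hg3.2 (two_le hxu hxm hum)
    obtain ⟨w, hw, hwx, hwu⟩ := third F₄ h₄ x u
    rcases Finset.mem_union.1 (hs hw) with h | h
    · rcases Finset.mem_union.1 h with h | h
      · exact Or.inr (Or.inr (Or.inr (lin F₄ h₄ F₁ h₁ w x hwx hw l h a)))
      · by_cases hwy : w = y
        · subst hwy
          exact Or.inr (Or.inr (Or.inr (lin F₄ h₄ F₁ h₁ w x hwx hw l b a)))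
        · exact Or.inl (tri F₁ h₁ F₂ h₂ F₄ h₄ x y w hxy (Ne.symm hwy) (Ne.symm hwx) a b c h l hw)
    · exact Or.inr (Or.inr (Or.inl (lin F₃ h₃ F₄ h₄ w u hwu h g hw k)))

/-- Too dense small configurations. -/
def Bd (n q r t e : ℕ) : Finset (Finset (Finset (Fin n))) :=
  Finset.univ.filter fun U => 2 ≤ U.card ∧ U.card ≤ 4 * e ∧
    q * (U.sup id).card + (U.card - 1) * t < U.card * (q * r)

lemma bd_sum {q r t e : ℕ} (hn : 4 * e * r ≤ n) (p X : ℝ) (hp : 0 ≤ p)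
    (hX : ∀ m s : ℕ, 2 ≤ m → m ≤ 4 * e → q * s + (m - 1) * t < m * (q * r) →
      (n : ℝ) ^ s * p ^ m ≤ X) (hX0 : 0 ≤ X) :
    ∑ U ∈ Bd n q r t e, p ^ U.card ≤
      ((4 * e + 1) * (4 * e * r + 1) * 2 ^ 2 ^ (4 * e * r) : ℕ) * X := by
  have hmaps : ∀ U ∈ Bd n q r t e, (U.card, (U.sup id).card) ∈
      (Finset.range (4 * e + 1) ×ˢ Finset.range (4 * e * r + 1)) := by
    intro U hU
    simp only [Bd, Finset.mem_filter, Finset.mem_univ, true_and] at hU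
    obtain ⟨h1, h2, h3⟩ := hU
    simp only [Finset.mem_product, Finset.mem_range]
    refine ⟨by omega, ?_⟩
    have h4 : q * (U.sup id).card < q * (U.card * r) := by
      calc _ ≤ q * (U.sup id).card + (U.card - 1) * t := Nat.le_add_right _ _
        _ < _ := h3
        _ = _ := by ring
    have h5 := lt_of_mul_lt_mul_left h4 (Nat.zero_le q)
    have h6 : U.card * r ≤ 4 * e * r := Nat.mul_le_mul_right _ h2
    omega
  rw [← Finset.sum_fiberwise_of_maps_to hmaps]
  have hfib : ∀ a ∈ (Finset.range (4 * e + 1) ×ˢ Finset.range (4 * e * r + 1)),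
      ∑ U ∈ (Bd n q r t e).filter (fun U => (U.card, (U.sup id).card) = a), p ^ U.card ≤
        ((2 ^ 2 ^ (4 * e * r) : ℕ) : ℝ) * X := by
    rintro ⟨m, s⟩ ha
    simp only [Finset.mem_product, Finset.mem_range] at ha
    rcases (Finset.eq_empty_or_nonempty
      ((Bd n q r t e).filter (fun U => (U.card, (U.sup id).card) = (m, s)))) with h | ⟨U₀, hU₀⟩
    · rw [h]; simp only [Finset.sum_empty]; positivity
    · have hb : (n : ℝ) ^ s * p ^ m ≤ X := by
        simp only [Bd, Finset.mem_filter, Finset.mem_univ, true_and, Prod.mk.injEq] at hU₀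
        obtain ⟨⟨h1, h2, h3⟩, h4, h5⟩ := hU₀
        rw [h4, h5] at h3
        exact hX m s (h4 ▸ h1) (h4 ▸ h2) h3
      have h1 : ∀ U ∈ (Bd n q r t e).filter (fun U => (U.card, (U.sup id).card) = (m, s)),
          p ^ U.card = p ^ m := by
        intro U hU
        rw [Finset.mem_filter, Prod.mk.injEq] at hU
        rw [hU.2.1]
      rw [Finset.sum_congr rfl h1, Finset.sum_const, nsmul_eq_mul]
      have h2 := count_sup s (by omega : s ≤ n)
        ((Bd n q r t e).filter (fun U => (U.card, (U.sup id).card) = (m, s))) (by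
          intro U hU
          rw [Finset.mem_filter, Prod.mk.injEq] at hU
          exact hU.2.2.le)
      have h3 : n ^ s * 2 ^ 2 ^ s ≤ n ^ s * 2 ^ 2 ^ (4 * e * r) := by
        apply Nat.mul_le_mul_left
        apply Nat.pow_le_pow_right (by norm_num)
        apply Nat.pow_le_pow_right (by norm_num)
        omega
      have h4 : ((((Bd n q r t e).filter
          (fun U => (U.card, (U.sup id).card) = (m, s))).card : ℕ) : ℝ) ≤
          (n : ℝ) ^ s * ((2 ^ 2 ^ (4 * e * r) : ℕ) : ℝ) := by
        exact_mod_cast h2.trans h3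
      calc _ ≤ (n : ℝ) ^ s * ((2 ^ 2 ^ (4 * e * r) : ℕ) : ℝ) * p ^ m :=
            mul_le_mul_of_nonneg_right h4 (by positivity)
        _ = ((2 ^ 2 ^ (4 * e * r) : ℕ) : ℝ) * ((n : ℝ) ^ s * p ^ m) := by ring
        _ ≤ _ := mul_le_mul_of_nonneg_left hb (by positivity)
  refine (Finset.sum_le_sum hfib).trans (le_of_eq ?_)
  rw [Finset.sum_const, Finset.card_product, Finset.card_range, Finset.card_range, nsmul_eq_mul]
  push_cast
  ring

lemma not_bd {q r t e : ℕ} {A : Finset (Finset (Fin n))} (hr : ∀ F ∈ A, F.card = r)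
    (hA : ∀ U ∈ Bd n q r t e, ¬ U ⊆ A) :
    ∀ U ⊆ A, U.Nonempty → U.card ≤ 4 * e → (t : ℤ) ≤ hx q r t U := by
  intro U hUA hne hc
  have hpos := hne.card_pos
  by_cases h2 : 2 ≤ U.card
  · have h3 : U ∉ Bd n q r t e := fun h => hA U h hUA
    simp only [Bd, Finset.mem_filter, Finset.mem_univ, true_and, not_and, not_lt] at h3
    have h4 := h3 h2 hc
    have h5 : (U.card : ℤ) * (q * r) ≤ q * (U.sup id).card + ((U.card - 1 : ℕ) : ℤ) * t := by
      exact_mod_cast h4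
    rw [Nat.cast_sub hpos] at h5
    unfold hx
    push_cast at h5
    linarith
  · have h1 : U.card = 1 := by omega
    obtain ⟨F, rfl⟩ := Finset.card_eq_one.1 h1
    unfold hx
    have : ({F} : Finset (Finset (Fin n))).sup id = F := by simp
    rw [this, hr F (hUA (by simp)), h1]
    push_cast
    linarith

end

section

lemma free_of {n q r t e v : ℕ} (hq : e = q + 1) (he : 3 ≤ e) (hco : Nat.Coprime q t)
    (htv : t + v = e * r) {I : Finset (Finset (Fin n))}
    (hI : ∀ U ⊆ I, U.Nonempty → U.card ≤ 4 * e → (t : ℤ) ≤ hx q r t U)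
    (hAx : ∀ F ∈ Ax e v I, False) (i : ℕ) (hi2 : 2 ≤ i) (hie : i ≤ e)
    (S : Finset (Finset (Fin n))) (hS : S ⊆ I) (hSi : S.card = i) :
    (i : ℤ) * r - ⌈(((i : ℚ) - 1) * ((e : ℚ) * r - v)) / ((e : ℚ) - 1)⌉ + 1
              ≤ ((S.sup id).card : ℤ) := by
  have hq0 : (0 : ℚ) < q := by
    have : 0 < q := by omega
    exact_mod_cast this
  have e1 : (e : ℚ) - 1 = q := by rw [hq]; push_cast; ring
  have e2 : (e : ℚ) * r - v = t := by
    have : (t : ℚ) + v = e * r := by exact_mod_cast htv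
    linarith
  rw [e1, e2]
  rcases hie.lt_or_eq with hlt | rfl
  · have h1 := hI S hS (Finset.card_pos.1 (by omega)) (by omega)
    have h2 := hx_strict (r := r) hq hco (U := S) (by omega) (by omega)
    have h3 : (t : ℤ) < hx q r t S := lt_of_le_of_ne h1 (Ne.symm h2)
    unfold hx at h3
    rw [hSi] at h3
    have h4 : (t : ℚ) < q * (S.sup id).card - i * (q * r - t) := by exact_mod_cast h3
    have h5 := Int.le_ceil (((i : ℚ) - 1) * t / q)
    rw [div_le_iff₀ hq0] at h5
    have h6 : ((i : ℚ) * r - ⌈((i : ℚ) - 1) * t / q⌉) * q < (S.sup id).card * q := by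
      linarith
    have h7 := lt_of_mul_lt_mul_right h6 hq0.le
    have h8 : (i : ℤ) * r - ⌈((i : ℚ) - 1) * t / q⌉ < (S.sup id).card := by exact_mod_cast h7
    omega
  · have h1 : ¬ (S.sup id).card ≤ v := fun h => hAx S (mem_Ax.2 ⟨hS, hSi, h⟩)
    rw [e1, mul_div_assoc, mul_div_cancel₀ _ hq0.ne']
    rw [Int.ceil_natCast]
    have h2 : (t : ℤ) + v = i * r := by exact_mod_cast htv
    omega

lemma step1 {n q r t e v : ℕ} (hn : 4 * e * r ≤ n) (hvn : v ≤ n)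
    (p lam X M : ℝ) (hp0 : 0 ≤ p) (hp1 : p ≤ 1) (hlam : 0 < lam) (he : 3 ≤ e)
    (hX : ∀ m s : ℕ, 2 ≤ m → m ≤ 4 * e → q * s + (m - 1) * t < m * (q * r) →
      (n : ℝ) ^ s * p ^ m ≤ X) (hX0 : 0 ≤ X)
    (hM : M ≤ p * (n.choose r : ℝ) - ((4*e+1)*(4*e*r+1)*2^2^(4*e*r) : ℕ) * X -
      lam * (((n : ℝ) ^ v * 2 ^ 2 ^ v) * p ^ e)) (hM0 : 0 ≤ M) :
    ∃ B : Finset (Finset (Fin n)), (∀ F ∈ B, F.card = r) ∧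
      (∀ U ⊆ B, U.Nonempty → U.card ≤ 4 * e → (t : ℤ) ≤ hx q r t U) ∧
      (∀ F ∈ B, (((Ax e v B).filter fun U => F ∈ U).card : ℝ) ≤ 2 * e / lam) ∧
      M / 2 ≤ B.card := by
  have he0 : (0 : ℝ) < e := by
    have : 0 < e := by omega
    exact_mod_cast this
  obtain ⟨A, hA, hAbad, hAc⟩ := alter (Finset.powersetCard r (Finset.univ : Finset (Fin n)))
    (Bd n q r t e) (Ax e v (Finset.powersetCard r (Finset.univ : Finset (Fin n)))) (by
      intro U hU
      simp only [Bd, Finset.mem_filter] at hU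
      exact Finset.card_pos.1 (by omega)) p lam hp0 hp1 hlam.le
  have hAr : ∀ F ∈ A, F.card = r := fun F hF => (Finset.mem_powersetCard.1 (hA hF)).2
  have hAx : (Ax e v (Finset.powersetCard r (Finset.univ : Finset (Fin n)))).filter
      (fun U => U ⊆ A) = Ax e v A := by
    ext U
    rw [Finset.mem_filter, mem_Ax, mem_Ax]
    constructor
    · rintro ⟨⟨-, h1, h2⟩, h3⟩
      exact ⟨h3, h1, h2⟩
    · rintro ⟨h1, h2, h3⟩
      exact ⟨⟨h1.trans hA, h2, h3⟩, h1⟩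
  have hbd := bd_sum (q := q) (r := r) (t := t) (e := e) hn p X hp0 hX hX0
  have haux : ∑ U ∈ Ax e v (Finset.powersetCard r (Finset.univ : Finset (Fin n))), p ^ U.card ≤
      ((n : ℝ) ^ v * 2 ^ 2 ^ v) * p ^ e := by
    have h1 : ∀ U ∈ Ax e v (Finset.powersetCard r (Finset.univ : Finset (Fin n))),
        p ^ U.card = p ^ e := by
      intro U hU
      rw [(mem_Ax.1 hU).2.1]
    rw [Finset.sum_congr rfl h1, Finset.sum_const, nsmul_eq_mul]
    refine mul_le_mul_of_nonneg_right ?_ (by positivity)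
    have h2 := count_sup v hvn (Ax e v (Finset.powersetCard r (Finset.univ : Finset (Fin n))))
      fun U hU => (mem_Ax.1 hU).2.2
    exact_mod_cast h2
  have haux' := mul_le_mul_of_nonneg_left haux hlam.le
  rw [hAx, Finset.card_powersetCard, Finset.card_univ, Fintype.card_fin] at hAc
  have hMA : M ≤ A.card - lam * ((Ax e v A).card : ℝ) := by linarith
  have hAx0 : 0 ≤ lam * ((Ax e v A).card : ℝ) := by positivity
  obtain ⟨B, hBA, hBd, hBc⟩ := prune A (Ax e v A) e (2 * e / lam) (by positivity)
    (fun F hF => (mem_Ax.1 hF).1) (fun F hF => (mem_Ax.1 hF).2.1) (by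
      rw [div_mul_eq_mul_div, le_div_iff₀ hlam]
      have : lam * ((Ax e v A).card : ℝ) ≤ A.card := by linarith
      have := mul_le_mul_of_nonneg_left this (by positivity : 0 ≤ 2 * (e:ℝ))
      linarith)
  refine ⟨B, fun F hF => hAr F (hBA hF), fun U hU => not_bd hAr hAbad U (hU.trans hBA),
    fun F hF => le_trans ?_ (hBd F hF), by linarith⟩
  refine Nat.cast_le.2 (Finset.card_le_card fun U hU => ?_)
  rw [Finset.mem_filter, mem_Ax] at hU ⊢
  exact ⟨⟨hU.1.1.trans hBA, hU.1.2⟩, hU.2⟩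

lemma step2 {n q r t e v : ℕ} (hq : e = q + 1) (he : 3 ≤ e) (hco : Nat.Coprime q t)
    (htv : t + v = e * r) (hn : 4 * e * r ≤ n) (hvn : v ≤ n)
    (p lam X M b : ℝ) (R : ℕ) (hp0 : 0 ≤ p) (hp1 : p ≤ 1) (hlam : 0 < lam)
    (hX : ∀ m s : ℕ, 2 ≤ m → m ≤ 4 * e → q * s + (m - 1) * t < m * (q * r) →
      (n : ℝ) ^ s * p ^ m ≤ X) (hX0 : 0 ≤ X)
    (hM : M ≤ p * (n.choose r : ℝ) - ((4*e+1)*(4*e*r+1)*2^2^(4*e*r) : ℕ) * X -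
      lam * (((n : ℝ) ^ v * 2 ^ 2 ^ v) * p ^ e)) (hM0 : 0 ≤ M)
    (hb : 0 < b) (hR : 1 ≤ R) (hD : 2 * e / lam * b ^ q ≤ R)
    (hbR : b * 2 ^ R ≤ 1 / (48 * (R : ℝ) ^ 2)) :
    ∃ H : Finset (Finset (Fin n)), (∀ F ∈ H, F.card = r) ∧ 1 / 32 * b * M ≤ H.card ∧
      ∀ i : ℕ, 2 ≤ i → i ≤ e → ∀ S ⊆ H, S.card = i →
        (i : ℤ) * r - ⌈(((i : ℚ) - 1) * ((e : ℚ) * r - v)) / ((e : ℚ) - 1)⌉ + 1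
              ≤ ((S.sup id).card : ℤ) := by
  obtain ⟨B, hBr, hBh, hBd, hBc⟩ := step1 hn hvn p lam X M hp0 hp1 hlam he hX hX0 hM hM0
  have hG : Good (Ax e v B) := ax_good hq he hco htv hBh
  obtain ⟨I, hIB, hI, hIc⟩ := indep (Ax e v B) B e R b (2 * e / lam) hG
    (fun F hF => (mem_Ax.1 hF).1) (fun F hF => (mem_Ax.1 hF).2.1) hb hR hBd
    (by rw [hq, Nat.add_sub_cancel, ← hq]; exact hD) hbR
  refine ⟨I, fun F hF => hBr F (hIB hF), ?_, free_of hq he hco htv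
    (fun U hU => hBh U (hU.trans hIB)) ?_⟩
  · refine le_trans ?_ hIc
    have := mul_le_mul_of_nonneg_left hBc (by positivity : 0 ≤ 1 / 16 * b)
    linarith
  · intro F hF
    obtain ⟨h1, h2⟩ := mem_Ax.1 hF
    exact hI F (mem_Ax.2 ⟨h1.trans hIB, h2⟩) h1

end

section

set_option maxHeartbeats 2000000 in
lemma main_pos {q r t e v : ℕ} (hr : 3 ≤ r) (hq : e = q + 1) (he : 3 ≤ e) (hco : Nat.Coprime q t)
    (htv : t + v = e * r) (hv : r + 1 ≤ v) :
    ∃ c : ℝ, 0 < c ∧ ∃ N : ℕ, ∀ n : ℕ, N ≤ n →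
      ∃ H : Finset (Finset (Fin n)),
        (∀ A ∈ H, A.card = r) ∧
        c * (n : ℝ) ^ ((t : ℝ) / (q : ℝ)) * Real.log n ^ ((1 : ℝ) / (q : ℝ)) ≤ H.card ∧
        ∀ i : ℕ, 2 ≤ i → i ≤ e →
          ∀ S ⊆ H, S.card = i →
            (i : ℤ) * r - ⌈(((i : ℚ) - 1) * ((e : ℚ) * r - v)) / ((e : ℚ) - 1)⌉ + 1
              ≤ ((S.sup id).card : ℤ) := by
  have hq2 : (2 : ℝ) ≤ q := by
    have : 2 ≤ q := by omega
    exact_mod_cast this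
  have hq0 : (0 : ℝ) < q := by linarith
  have heq : (e : ℝ) = q + 1 := by exact_mod_cast hq
  have he0 : (0 : ℝ) < e := by linarith
  have htvR : (t : ℝ) + v = e * r := by exact_mod_cast htv
  have hvR : (r : ℝ) + 1 ≤ v := by exact_mod_cast hv
  obtain ⟨τ, hτ⟩ : ∃ τ : ℝ, τ = t / q := ⟨_, rfl⟩
  have hτq : q * τ = t := by rw [hτ]; field_simp
  obtain ⟨ε, hε⟩ : ∃ ε : ℝ, ε = 1 / (4 * e * q) := ⟨_, rfl⟩
  have hε0 : 0 < ε := by rw [hε]; positivity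
  have hεq : 4 * e * q * ε = 1 := by rw [hε]; field_simp
  have hqε : 4 * (e : ℝ) * ε = 1 / q := by rw [hε]; field_simp
  have hτr : τ + ε ≤ r := by
    have h1 : (q : ℝ) * (τ + ε) ≤ q * r := by
      have h2 : q * ε ≤ 1 := by nlinarith [mul_pos hq0 hε0]
      have h3 : q * τ + 1 ≤ q * r := by rw [hτq]; nlinarith
      linarith
    exact le_of_mul_le_mul_left h1 hq0
  obtain ⟨c1, hc1⟩ : ∃ c1 : ℝ, c1 = 1 / (2 ^ r * r.factorial) := ⟨_, rfl⟩
  have hc10 : 0 < c1 := by rw [hc1]; positivity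
  obtain ⟨K, hK⟩ : ∃ K : ℝ, K = (((4*e+1)*(4*e*r+1)*2^2^(4*e*r) : ℕ) : ℝ) := ⟨_, rfl⟩
  obtain ⟨C3, hC3⟩ : ∃ C3 : ℝ, C3 = 2 ^ 2 ^ v := ⟨_, rfl⟩
  have hC30 : 0 < C3 := by rw [hC3]; positivity
  obtain ⟨C4, hC4⟩ : ∃ C4 : ℝ, C4 = 8 * e * C3 / c1 := ⟨_, rfl⟩
  have hC40 : 0 < C4 := by rw [hC4]; positivity
  obtain ⟨C5, hC5⟩ : ∃ C5 : ℝ, C5 = C4 ^ (-(1 / (q : ℝ))) := ⟨_, rfl⟩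
  have hC50 : 0 < C5 := by rw [hC5]; positivity
  have hC45 : C4 * C5 ^ q = 1 := by
    rw [hC5, ← Real.rpow_natCast, ← Real.rpow_mul hC40.le]
    rw [show -(1 / (q : ℝ)) * q = -1 by field_simp, Real.rpow_neg_one]
    exact mul_inv_cancel₀ hC40.ne'
  have hcast : Filter.Tendsto (fun n : ℕ => (n : ℝ)) Filter.atTop Filter.atTop :=
    tendsto_natCast_atTop_atTop
  have ev1 : ∀ᶠ n : ℕ in Filter.atTop, K ≤ c1 / 4 * (n : ℝ) ^ ε :=
    (((tendsto_rpow_atTop hε0).const_mul_atTop (by positivity : 0 < c1 / 4)).comp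
      hcast).eventually_ge_atTop K
  have ev2 : ∀ᶠ n : ℕ in Filter.atTop, 2 ≤ ε / 2 * Real.log n :=
    ((Real.tendsto_log_atTop.const_mul_atTop (by positivity : 0 < ε / 2)).comp
      hcast).eventually_ge_atTop 2
  have ev3 : ∀ᶠ n : ℕ in Filter.atTop,
      48 * C5 * (ε / 2) ^ 3 * Real.log n ^ 3 ≤ (n : ℝ) ^ (ε / 2) := by
    have h1 := (isLittleO_log_rpow_rpow_atTop 3 (half_pos hε0)).bound
      (c := 1 / (48 * C5 * (ε / 2) ^ 3)) (by positivity)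
    have h2 := hcast.eventually h1
    filter_upwards [h2, ev2] with n hn hn2
    have hlog : 0 ≤ Real.log n := by
      by_contra hcon
      push Not at hcon
      nlinarith
    rw [Real.norm_of_nonneg (by positivity), Real.norm_of_nonneg (by positivity)] at hn
    rw [show (3 : ℝ) = ((3 : ℕ) : ℝ) by norm_num, Real.rpow_natCast] at hn
    rw [one_div, inv_mul_eq_div, le_div_iff₀ (by positivity)] at hn
    linarith
  obtain ⟨N, hN⟩ := Filter.eventually_atTop.1 ((ev1.and (ev2.and ev3)).and
    (Filter.eventually_ge_atTop (4 * e * r + v + 2 * r + 1)))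
  refine ⟨1 / 64 * c1 * C5 * (ε / 4) ^ (1 / (q : ℝ)), by positivity, N, fun n hnN => ?_⟩
  obtain ⟨⟨hk1, hk2, hk3⟩, hk4⟩ := hN n hnN
  have hn0 : (0 : ℝ) < n := by
    have : 0 < n := by omega
    exact_mod_cast this
  have hn1 : (1 : ℝ) ≤ n := by
    have : 1 ≤ n := by omega
    exact_mod_cast this
  have hlog : 0 < Real.log n := by
    by_contra hcon
    push Not at hcon
    nlinarith
  obtain ⟨R, hR⟩ : ∃ R : ℕ, R = ⌊ε / 2 * Real.log n⌋₊ := ⟨_, rfl⟩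
  have hRle : (R : ℝ) ≤ ε / 2 * Real.log n := by
    rw [hR]; exact Nat.floor_le (by positivity)
  have hRlt : ε / 2 * Real.log n < R + 1 := by
    rw [hR]; exact Nat.lt_floor_add_one _
  have hR1' : (1 : ℝ) < R := by linarith
  have hR1 : 1 ≤ R := by
    have : 1 < R := by exact_mod_cast hR1'
    omega
  have hRge : ε / 4 * Real.log n ≤ R := by linarith
  have hR0 : (0 : ℝ) < R := by linarith
  have hyε : 0 < (n : ℝ) ^ ε := by positivity
  obtain ⟨b, hb⟩ : ∃ b : ℝ, b = (R : ℝ) ^ (1 / (q : ℝ)) * C5 * (n : ℝ) ^ (-ε) := ⟨_, rfl⟩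
  have hb0 : 0 < b := by rw [hb]; positivity
  obtain ⟨lam, hlam⟩ : ∃ lam : ℝ, lam = c1 / 4 / C3 * (n : ℝ) ^ (-(q * ε)) := ⟨_, rfl⟩
  have hlam0 : 0 < lam := by rw [hlam]; positivity
  obtain ⟨p, hp⟩ : ∃ p : ℝ, p = (n : ℝ) ^ (τ - r + ε) := ⟨_, rfl⟩
  have hp0 : 0 ≤ p := by rw [hp]; positivity
  have hp1 : p ≤ 1 := by
    rw [hp]
    exact Real.rpow_le_one_of_one_le_of_nonpos hn1 (by linarith)
  have hch : c1 * (n : ℝ) ^ r ≤ (n.choose r : ℝ) := by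
    have h1 := Nat.pow_le_choose (α := ℝ) r n
    refine le_trans ?_ h1
    have h2 : (n : ℝ) / 2 ≤ ((n + 1 - r : ℕ) : ℝ) := by
      rw [Nat.cast_sub (by omega)]
      have : 2 * (r : ℝ) ≤ n := by
        have : 2 * r ≤ n := by omega
        exact_mod_cast this
      push_cast
      linarith
    have h3 := pow_le_pow_left₀ (by positivity) h2 r
    have h4 := div_le_div_of_nonneg_right h3 (by positivity : (0:ℝ) ≤ r.factorial)
    have h5 : c1 * (n : ℝ) ^ r = ((n : ℝ) / 2) ^ r / r.factorial := by
      rw [hc1, div_pow]; field_simp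
    rw [h5]
    exact_mod_cast h4
  have hpch : c1 * (n : ℝ) ^ (τ + ε) ≤ p * (n.choose r : ℝ) := by
    have h1 := mul_le_mul_of_nonneg_left hch hp0
    have h2 : (n : ℝ) ^ (τ + ε) = p * (n : ℝ) ^ r := by
      rw [hp, ← Real.rpow_natCast (n : ℝ) r, ← Real.rpow_add hn0]
      congr 1; ring
    rw [h2]; linarith
  have hKX : K * (n : ℝ) ^ τ ≤ c1 / 4 * (n : ℝ) ^ (τ + ε) := by
    have h1 := mul_le_mul_of_nonneg_right hk1 (by positivity : 0 ≤ (n : ℝ) ^ τ)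
    rw [Real.rpow_add hn0]; linarith
  have hlamX : lam * (((n : ℝ) ^ v * 2 ^ 2 ^ v) * p ^ e) = c1 / 4 * (n : ℝ) ^ (τ + ε) := by
    have h1 : (n : ℝ) ^ (-(q * ε)) * ((n : ℝ) ^ v * p ^ e) = (n : ℝ) ^ (τ + ε) := by
      rw [hp, ← Real.rpow_natCast, ← Real.rpow_natCast, ← Real.rpow_mul hn0.le,
        ← Real.rpow_add hn0, ← Real.rpow_add hn0]
      congr 1
      rw [heq] at htvR ⊢
      linear_combination htvR + hτq
    rw [← hC3, hlam, ← h1]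
    field_simp
  have hpow : ∀ m s : ℕ, 2 ≤ m → m ≤ 4 * e → q * s + (m - 1) * t < m * (q * r) →
      (n : ℝ) ^ s * p ^ m ≤ (n : ℝ) ^ τ := by
    intro m s hm2 hm4 hms
    rw [hp, ← Real.rpow_natCast, ← Real.rpow_natCast, ← Real.rpow_mul hn0.le,
        ← Real.rpow_add hn0]
    refine Real.rpow_le_rpow_of_exponent_le hn1 ?_
    have h1 : (q : ℝ) * s + (m - 1) * t + 1 ≤ m * (q * r) := by
      have h2 : q * s + (m - 1) * t + 1 ≤ m * (q * r) := hms
      have h3 : ((q * s + (m - 1) * t + 1 : ℕ) : ℝ) ≤ ((m * (q * r) : ℕ) : ℝ) := by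
        exact_mod_cast h2
      push_cast [Nat.cast_sub (by omega : 1 ≤ m)] at h3
      exact h3
    have h4 : (m : ℝ) * ε * q ≤ 1 := by
      have h5 : (m : ℝ) ≤ 4 * e := by exact_mod_cast hm4
      have h6 := mul_le_mul_of_nonneg_right h5 (by positivity : 0 ≤ ε * q)
      linarith
    have h7 : (q : ℝ) * (s + (τ - r + ε) * m) ≤ q * τ := by
      rw [← hτq] at h1
      linarith
    exact le_of_mul_le_mul_left h7 hq0
  have hbq : 2 * e / lam * b ^ q ≤ R := by
    have h1 : b ^ q = R * C5 ^ q * (n : ℝ) ^ (-(q * ε)) := by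
      rw [hb, mul_pow, mul_pow, ← Real.rpow_natCast ((R : ℝ) ^ (1 / (q:ℝ))),
        ← Real.rpow_mul hR0.le, ← Real.rpow_natCast ((n : ℝ) ^ (-ε)), ← Real.rpow_mul hn0.le]
      rw [show 1 / (q : ℝ) * q = 1 by field_simp, Real.rpow_one]
      congr 2; ring
    have h2 : 2 * e / lam * b ^ q = R * (C4 * C5 ^ q) := by
      have h3 : (n : ℝ) ^ (-(q * ε)) ≠ 0 := by positivity
      rw [h1, hlam, hC4]
      field_simp
      ring
    rw [h2, hC45, mul_one]
  have hbR : b * 2 ^ R ≤ 1 / (48 * (R : ℝ) ^ 2) := by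
    have h1 : (2 : ℝ) ^ R ≤ (n : ℝ) ^ (ε / 2) := by
      have h2 : (2 : ℝ) ^ R ≤ Real.exp 1 ^ R :=
        pow_le_pow_left₀ (by norm_num) (by have := Real.add_one_le_exp 1; linarith) R
      rw [← Real.exp_nat_mul, mul_one] at h2
      refine h2.trans ?_
      rw [Real.rpow_def_of_pos hn0]
      exact Real.exp_le_exp.2 (by linarith)
    have h3 : (R : ℝ) ^ (1 / (q : ℝ)) ≤ R := by
      have := Real.rpow_le_rpow_of_exponent_le hR1'.le
        (show 1 / (q : ℝ) ≤ 1 by rw [div_le_one hq0]; linarith)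
      simpa using this
    have h4 : b ≤ R * C5 * (n : ℝ) ^ (-ε) := by
      rw [hb]; gcongr
    rw [le_div_iff₀ (by positivity)]
    have h5 : (R : ℝ) ^ 3 ≤ (ε / 2 * Real.log n) ^ 3 := pow_le_pow_left₀ hR0.le hRle 3
    have h6 : 48 * C5 * (R : ℝ) ^ 3 ≤ (n : ℝ) ^ (ε / 2) := by
      refine le_trans ?_ hk3
      have := mul_le_mul_of_nonneg_left h5 (by positivity : 0 ≤ 48 * C5)
      rw [mul_pow] at this
      linarith
    have h7 : (n : ℝ) ^ (-ε) * ((n : ℝ) ^ (ε / 2) * (n : ℝ) ^ (ε / 2)) = 1 := by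
      rw [← Real.rpow_add hn0, ← Real.rpow_add hn0]
      rw [show -ε + (ε / 2 + ε / 2) = 0 by ring, Real.rpow_zero]
    calc b * 2 ^ R * (48 * (R : ℝ) ^ 2)
        ≤ (R * C5 * (n : ℝ) ^ (-ε)) * (n : ℝ) ^ (ε / 2) * (48 * (R : ℝ) ^ 2) := by gcongr
      _ = (n : ℝ) ^ (-ε) * ((n : ℝ) ^ (ε / 2) * (48 * C5 * (R : ℝ) ^ 3)) := by ring
      _ ≤ (n : ℝ) ^ (-ε) * ((n : ℝ) ^ (ε / 2) * (n : ℝ) ^ (ε / 2)) := by gcongr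
      _ = 1 := h7
  obtain ⟨H, hHr, hHc, hHf⟩ := step2 hq he hco htv (by omega : 4 * e * r ≤ n)
    (by omega : v ≤ n) p lam ((n : ℝ) ^ τ) (c1 / 2 * (n : ℝ) ^ (τ + ε)) b R hp0 hp1 hlam0
    hpow (by positivity) (by rw [← hK, hlamX]; linarith) (by positivity) hb0 hR1 hbq hbR
  refine ⟨H, hHr, le_trans ?_ hHc, hHf⟩
  rw [← hτ]
  have h1 : 1 / 32 * b * (c1 / 2 * (n : ℝ) ^ (τ + ε)) =
      1 / 64 * c1 * C5 * (n : ℝ) ^ τ * (R : ℝ) ^ (1 / (q : ℝ)) := by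
    have h2 : (n : ℝ) ^ (-ε) * (n : ℝ) ^ (τ + ε) = (n : ℝ) ^ τ := by
      rw [← Real.rpow_add hn0]; congr 1; ring
    rw [hb, ← h2]; ring
  have h3 : (ε / 4) ^ (1 / (q : ℝ)) * Real.log n ^ (1 / (q : ℝ)) ≤ (R : ℝ) ^ (1 / (q : ℝ)) := by
    rw [← Real.mul_rpow (by positivity) hlog.le]
    exact Real.rpow_le_rpow (by positivity) hRge (by positivity)
  rw [h1]
  have h4 := mul_le_mul_of_nonneg_left h3 (by positivity : 0 ≤ 1 / 64 * c1 * C5 * (n : ℝ) ^ τ)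
  linarith

lemma main_neg {r e v : ℕ} (τ κ : ℝ) (hτ : τ < 0) :
    ∃ c : ℝ, 0 < c ∧ ∃ N : ℕ, ∀ n : ℕ, N ≤ n →
      ∃ H : Finset (Finset (Fin n)),
        (∀ A ∈ H, A.card = r) ∧
        c * (n : ℝ) ^ τ * Real.log n ^ κ ≤ H.card ∧
        ∀ i : ℕ, 2 ≤ i → i ≤ e →
          ∀ S ⊆ H, S.card = i →
            (i : ℤ) * r - ⌈(((i : ℚ) - 1) * ((e : ℚ) * r - v)) / ((e : ℚ) - 1)⌉ + 1
              ≤ ((S.sup id).card : ℤ) := by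
  have hcast : Filter.Tendsto (fun n : ℕ => (n : ℝ)) Filter.atTop Filter.atTop :=
    tendsto_natCast_atTop_atTop
  have h1 := hcast.eventually ((isLittleO_log_rpow_rpow_atTop κ (neg_pos.2 hτ)).bound
      (c := 1) (by positivity))
  obtain ⟨N, hN⟩ := Filter.eventually_atTop.1 (h1.and (Filter.eventually_ge_atTop (r + 1)))
  refine ⟨1, one_pos, N, fun n hn => ?_⟩
  obtain ⟨h2, h3⟩ := hN n hn
  have hn0 : (0 : ℝ) < n := by
    have : 0 < n := by omega
    exact_mod_cast this
  obtain ⟨F, -, hF⟩ := Finset.exists_subset_card_eq (s := (Finset.univ : Finset (Fin n))) (n := r)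
    (by simp; omega)
  refine ⟨{F}, by simpa using hF, ?_, ?_⟩
  · rw [Real.norm_of_nonneg (by positivity : 0 ≤ (n : ℝ) ^ (-τ)), one_mul] at h2
    have h4 := (le_abs_self _).trans h2
    have h5 := mul_le_mul_of_nonneg_left h4 (by positivity : 0 ≤ (n : ℝ) ^ τ)
    rw [← Real.rpow_add hn0, add_neg_cancel, Real.rpow_zero] at h5
    simpa using h5
  · intro i hi _ S hS hSi
    have := Finset.card_le_card hS
    rw [Finset.card_singleton] at this
    omega

end

end Nib

/-- Theorem 1.3: for fixed `r ≥ 3`, `e ≥ 3`, `v ≥ r+1` with `gcd(e-1, er-v) = 1`, for all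
sufficiently large `n` there is an `r`-graph on `[n]` with `Ω(n^((er-v)/(e-1)) (log n)^(1/(e-1)))`
edges which is `𝒢_r(ir - ⌈(i-1)(er-v)/(e-1)⌉, i)`-free for every `2 ≤ i ≤ e`. -/
theorem stmt_0 (r e v : ℕ) (hr : 3 ≤ r) (he : 3 ≤ e) (hv : r + 1 ≤ v)
    (hgcd : Int.gcd ((e : ℤ) - 1) ((e : ℤ) * r - v) = 1) :
    ∃ c : ℝ, 0 < c ∧ ∃ N : ℕ, ∀ n : ℕ, N ≤ n →
      ∃ H : Finset (Finset (Fin n)),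
        (∀ A ∈ H, A.card = r) ∧
        c * (n : ℝ) ^ (((e : ℝ) * r - v) / ((e : ℝ) - 1)) *
          Real.log n ^ ((1 : ℝ) / ((e : ℝ) - 1)) ≤ H.card ∧
        ∀ i : ℕ, 2 ≤ i → i ≤ e →
          ∀ S ⊆ H, S.card = i →
            (i : ℤ) * r - ⌈(((i : ℚ) - 1) * ((e : ℚ) * r - v)) / ((e : ℚ) - 1)⌉ + 1
              ≤ ((S.sup id).card : ℤ) := by
  obtain ⟨q, hq⟩ : ∃ q, e = q + 1 := ⟨e - 1, by omega⟩
  have heR : (e : ℝ) - 1 = q := by rw [hq]; push_cast; ring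
  have heZ : (e : ℤ) - 1 = q := by rw [hq]; push_cast; ring
  rw [heR]
  rcases Nat.lt_or_ge (e * r) v with hlt | hge
  · refine Nib.main_neg _ _ ?_
    have h1 : (e : ℝ) * r < v := by exact_mod_cast hlt
    have h2 : (0 : ℝ) < q := by
      have : 0 < q := by omega
      exact_mod_cast this
    exact div_neg_of_neg_of_pos (by linarith) h2
  · obtain ⟨t, ht⟩ : ∃ t, t + v = e * r := ⟨e * r - v, by omega⟩
    have h1 : (e : ℝ) * r - v = t := by
      have : (t : ℝ) + v = e * r := by exact_mod_cast ht
      linarith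
    have h2 : (e : ℤ) * r - v = t := by
      have : (t : ℤ) + v = e * r := by exact_mod_cast ht
      linarith
    rw [h1]
    rw [heZ, h2, Int.gcd_natCast_natCast] at hgcd
    exact Nib.main_pos hr hq he hgcd ht hv
end

section
/- For all fixed integers r ≥ 3, e ≥ 3, v ≥ r+1 with gcd(e-1, er-v) = 1, one has f_r(n,v,e) = Ω(n^{(er-v)/(e-1)} (log n)^{1/(e-1)}); that is, there exist a constant c > 0 and an integer N such that for every n ≥ N there exists a 𝒢_r(v,e)-free r-graph on vertex set [n] with at least c · n^{(er-v)/(e-1)} · (log n)^{1/(e-1)} edges. -/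
namespace SparseHG

open Classical in
/-- `u` and `v` are linked: some edge contains both and all its other vertices were selected. -/
def Lnk {V : Type} (E : Finset (Finset V)) (I : Finset V) (u v : V) : Prop :=
  u ≠ v ∧ ∃ e ∈ E, u ∈ e ∧ v ∈ e ∧ ∀ x ∈ e, x ≠ u → x ≠ v → x ∈ I

open Classical in
/-- weight of an edge -/
noncomputable def TT {V : Type} (l : ℝ) (I : Finset V) (ξ : V → ℝ) (e : Finset V) : ℝ :=
  ((e \ I).card : ℝ) * l ^ ((e \ I).card - 1) * ∏ u ∈ e \ I, ξ u

open Classical in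
/-- killing rate -/
noncomputable def kr {V : Type} [Fintype V] (E : Finset (Finset V)) (I : Finset V) (ξ : V → ℝ)
    (u : V) : ℝ := ∑ v, if Lnk E I u v then ξ v else 0

open Classical in
/-- weights after selecting `v` -/
noncomputable def jmp {V : Type} (E : Finset (Finset V)) (I : Finset V) (ξ : V → ℝ)
    (v : V) : V → ℝ := fun u => if u = v ∨ Lnk E I u v then 0 else ξ u

/-- main potential -/
noncomputable def Psi {V : Type} [Fintype V] (E : Finset (Finset V)) (q l : ℝ) (I : Finset V)
    (ξ : V → ℝ) : ℝ := ∑ u, ξ u - (1 / q) * ∑ e ∈ E, TT l I ξ e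

open Classical in
structure Inv {V : Type} (E : Finset (Finset V)) (I : Finset V) (ξ : V → ℝ) : Prop where
  nonneg : ∀ u, 0 ≤ ξ u
  zero : ∀ u ∈ I, ξ u = 0
  indep : ∀ e ∈ E, ¬ e ⊆ I
  alive : ∀ u, ξ u ≠ 0 → ∀ e ∈ E, u ∈ e → ¬ (∀ x ∈ e, x ≠ u → x ∈ I)

theorem Lnk.symm {V : Type} {E : Finset (Finset V)} {I : Finset V} {u v : V}
    (h : Lnk E I u v) : Lnk E I v u := by
  obtain ⟨h1, e, he, hu, hv, hx⟩ := h
  exact ⟨h1.symm, e, he, hv, hu, fun x hxe h1 h2 => hx x hxe h2 h1⟩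

theorem jmp_le {V : Type} (E : Finset (Finset V)) (I : Finset V) (ξ : V → ℝ)
    (h : ∀ u, 0 ≤ ξ u) (v u : V) : jmp E I ξ v u ≤ ξ u := by
  unfold jmp; split_ifs
  · exact h u
  · exact le_rfl

theorem jmp_nonneg {V : Type} (E : Finset (Finset V)) (I : Finset V) (ξ : V → ℝ)
    (h : ∀ u, 0 ≤ ξ u) (v u : V) : 0 ≤ jmp E I ξ v u := by
  unfold jmp; split_ifs
  · exact le_rfl
  · exact h u

theorem TT_nonneg {V : Type} {l : ℝ} (hl : 0 ≤ l) (I : Finset V) {ξ : V → ℝ}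
    (h : ∀ u, 0 ≤ ξ u) (e : Finset V) : 0 ≤ TT l I ξ e := by
  unfold TT
  refine mul_nonneg (by positivity) (Finset.prod_nonneg (fun i _ => h i))

open Classical in
theorem Inv.jump {V : Type} {E : Finset (Finset V)} {I : Finset V} {ξ : V → ℝ}
    (h : Inv E I ξ) {v : V} (hv : ξ v ≠ 0) : Inv E (insert v I) (jmp E I ξ v) where
  nonneg := jmp_nonneg E I ξ h.nonneg v
  zero := by
    intro u hu
    rcases Finset.mem_insert.1 hu with rfl | hu
    · simp [jmp]
    · unfold jmp; split_ifs
      · rfl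
      · exact h.zero u hu
  indep := by
    intro e he hsub
    by_cases hve : v ∈ e
    · refine h.alive v hv e he hve ?_
      intro x hx hxv
      exact (Finset.mem_insert.1 (hsub hx)).resolve_left hxv
    · refine h.indep e he ?_
      intro x hx
      refine (Finset.mem_insert.1 (hsub hx)).resolve_left ?_
      rintro rfl; exact hve hx
  alive := by
    intro u hu e he hue hall
    unfold jmp at hu
    split_ifs at hu with h1
    · exact hu rfl
    push Not at h1
    by_cases hve : v ∈ e
    · refine h1.2 ⟨h1.1, e, he, hue, hve, ?_⟩
      intro x hx hxu hxv
      exact (Finset.mem_insert.1 (hall x hx hxu)).resolve_left hxv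
    · refine h.alive u hu e he hue ?_
      intro x hx hxu
      refine (Finset.mem_insert.1 (hall x hx hxu)).resolve_left ?_
      rintro rfl; exact hve hx

theorem Inv.mono {V : Type} {E : Finset (Finset V)} {I : Finset V} {ξ ξ' : V → ℝ}
    (h : Inv E I ξ) (h0 : ∀ u, 0 ≤ ξ' u) (h1 : ∀ u, ξ u = 0 → ξ' u = 0) : Inv E I ξ' where
  nonneg := h0
  zero := fun u hu => h1 u (h.zero u hu)
  indep := h.indep
  alive := fun u hu => h.alive u (fun h' => hu (h1 u h'))

theorem lnk_unique {V : Type} {E : Finset (Finset V)} {I : Finset V}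
    (hlin : ∀ e ∈ E, ∀ e' ∈ E, ∀ u u', u ≠ u' → u ∈ e → u' ∈ e → u ∈ e' → u' ∈ e' → e = e')
    (htri : ∀ e ∈ E, ∀ e₁ ∈ E, ∀ e₂ ∈ E, ∀ u u' v, u ≠ u' → u ≠ v → u' ≠ v → u ∈ e → u ∈ e₁ →
      u' ∈ e → u' ∈ e₂ → v ∈ e₁ → v ∈ e₂ → e = e₁ ∨ e = e₂ ∨ e₁ = e₂)
    {e : Finset V} (he : e ∈ E) {u u' v : V} (hu : u ∈ e) (hu' : u' ∈ e) (huI : u ∉ I)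
    (huI' : u' ∉ I) (h1 : Lnk E I u v) (h2 : Lnk E I u' v) : u = u' := by
  by_contra hne
  obtain ⟨huv, e₁, he1, hue1, hve1, hx1⟩ := h1
  obtain ⟨huv', e₂, he2, hue2, hve2, hx2⟩ := h2
  have n1 : e ≠ e₁ := by
    rintro rfl
    exact huI' (hx1 u' hu' (Ne.symm hne) huv')
  have n2 : e ≠ e₂ := by
    rintro rfl
    exact huI (hx2 u hu hne huv)
  have n3 : e₁ ≠ e₂ := by
    rintro rfl
    exact n1 (hlin e he e₁ he1 u u' hne hu hu' hue1 hue2)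
  rcases htri e he e₁ he1 e₂ he2 u u' v hne huv huv' hu hue1 hu' hue2 hve1 hve2 with h | h | h
  · exact n1 h
  · exact n2 h
  · exact n3 h

open Classical in
/-- generator inequality for one edge -/
theorem gen_edge {V : Type} [Fintype V] {E : Finset (Finset V)} {I : Finset V} {ξ : V → ℝ}
    (hlin : ∀ e ∈ E, ∀ e' ∈ E, ∀ u u', u ≠ u' → u ∈ e → u' ∈ e → u ∈ e' → u' ∈ e' → e = e')
    (htri : ∀ e ∈ E, ∀ e₁ ∈ E, ∀ e₂ ∈ E, ∀ u u' v, u ≠ u' → u ≠ v → u' ≠ v → u ∈ e → u ∈ e₁ →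
      u' ∈ e → u' ∈ e₂ → v ∈ e₁ → v ∈ e₂ → e = e₁ ∨ e = e₂ ∨ e₁ = e₂)
    (h : Inv E I ξ) {l : ℝ} (hl : 0 < l) {e : Finset V} (he : e ∈ E) :
    TT l I ξ e * (∑ u ∈ e \ I, kr E I ξ u - (((e \ I).card : ℝ) - 1) / l)
      + ∑ v, ξ v * (TT l (insert v I) (jmp E I ξ v) e - TT l I ξ e) ≤ 0 := by
  have hnn := h.nonneg
  have hT : 0 ≤ TT l I ξ e := TT_nonneg hl.le I hnn e
  set A := e \ I with hA
  set T := TT l I ξ e with hTdef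
  have hAne : A.Nonempty := by
    rw [Finset.nonempty_iff_ne_empty]
    intro h0
    exact h.indep e he (Finset.sdiff_eq_empty_iff_subset.1 h0)
  have hm1 : (1:ℝ) ≤ A.card := by exact_mod_cast hAne.card_pos
  -- zero criterion
  have hz : ∀ v, (∃ u ∈ A, u ≠ v ∧ jmp E I ξ v u = 0) →
      TT l (insert v I) (jmp E I ξ v) e = 0 := by
    rintro v ⟨u, hu, huv, h0⟩
    unfold TT
    rw [Finset.prod_eq_zero (i := u) _ h0, mul_zero]
    simp only [hA, Finset.mem_sdiff, Finset.mem_insert] at hu ⊢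
    tauto
  -- per-v inequality
  have key : ∀ v, ξ v * (TT l (insert v I) (jmp E I ξ v) e - T)
      + T * (ξ v * ((A.filter (fun u => Lnk E I u v)).card : ℝ))
      ≤ if v ∈ A then T * (A.card - 1) / (l * A.card) else 0 := by
    intro v
    have hc : (A.filter (fun u => Lnk E I u v)).card ≤ 1 := by
      rw [Finset.card_le_one]
      intro a ha b hb
      simp only [hA, Finset.mem_filter, Finset.mem_sdiff] at ha hb
      exact lnk_unique hlin htri he ha.1.1 hb.1.1 ha.1.2 hb.1.2 ha.2 hb.2
    have hrhs : 0 ≤ if v ∈ A then T * (A.card - 1) / (l * A.card) else 0 := by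
      split_ifs
      · have : (0:ℝ) ≤ A.card - 1 := by linarith
        positivity
      · exact le_rfl
    by_cases hc0 : (A.filter (fun u => Lnk E I u v)).card = 0
    · rw [hc0]
      simp only [Nat.cast_zero, mul_zero, add_zero]
      by_cases hvA : v ∈ A
      · rw [if_pos hvA]
        have hve : v ∈ e := (Finset.mem_sdiff.1 hvA).1
        have hvI : v ∉ I := (Finset.mem_sdiff.1 hvA).2
        have hset : e \ insert v I = A.erase v := by
          ext x; simp only [hA, Finset.mem_sdiff, Finset.mem_insert, Finset.mem_erase]; tauto
        have hTv : TT l (insert v I) (jmp E I ξ v) e ≤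
            ((A.card : ℝ) - 1) * l ^ (A.card - 1 - 1) * ∏ u ∈ A.erase v, ξ u := by
          unfold TT
          rw [hset, Finset.card_erase_of_mem hvA, Nat.cast_sub hAne.card_pos, Nat.cast_one]
          have : (0:ℝ) ≤ A.card - 1 := by linarith
          gcongr with i hi
          · intro i _; exact jmp_nonneg E I ξ hnn v i
          · exact jmp_le E I ξ hnn v i
        have hprod : ξ v * ∏ u ∈ A.erase v, ξ u = ∏ u ∈ A, ξ u := Finset.mul_prod_erase A ξ hvA
        have hle : ξ v * TT l (insert v I) (jmp E I ξ v) e ≤ T * (A.card - 1) / (l * A.card) := by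
          calc ξ v * TT l (insert v I) (jmp E I ξ v) e
              ≤ ξ v * (((A.card : ℝ) - 1) * l ^ (A.card - 1 - 1) * ∏ u ∈ A.erase v, ξ u) :=
                mul_le_mul_of_nonneg_left hTv (hnn v)
            _ = ((A.card : ℝ) - 1) * l ^ (A.card - 1 - 1) * ∏ u ∈ A, ξ u := by
                rw [← hprod]; ring
            _ = T * (A.card - 1) / (l * A.card) := by
                have hTe : T = (A.card : ℝ) * l ^ (A.card - 1) * ∏ u ∈ A, ξ u := rfl
                rw [hTe]
                rcases Nat.lt_or_ge 1 A.card with h2 | h2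
                · obtain ⟨j, hj⟩ : ∃ j, A.card = j + 2 := ⟨A.card - 2, by omega⟩
                  rw [hj]
                  simp only [Nat.add_sub_cancel, show j + 2 - 1 = j + 1 from rfl]
                  have : ((j + 2 : ℕ) : ℝ) ≠ 0 := by positivity
                  field_simp
                  ring
                · have : A.card = 1 := le_antisymm h2 hAne.card_pos
                  rw [this]; simp
        have := mul_nonneg (hnn v) hT
        linarith
      · rw [if_neg hvA]
        by_cases hv0 : ξ v = 0
        · rw [hv0]; simp
        have hvI : v ∉ I := fun h' => hv0 (h.zero v h')
        have hve : v ∉ e := fun h' => hvA (Finset.mem_sdiff.2 ⟨h', hvI⟩)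
        have hset : e \ insert v I = A := by
          ext x; simp only [hA, Finset.mem_sdiff, Finset.mem_insert]
          constructor
          · tauto
          · rintro ⟨hx, hxI⟩
            refine ⟨hx, ?_⟩
            rintro (rfl | hh)
            · exact hve hx
            · exact hxI hh
        have : TT l (insert v I) (jmp E I ξ v) e ≤ T := by
          have hTe : T = (A.card : ℝ) * l ^ (A.card - 1) * ∏ u ∈ A, ξ u := rfl
          rw [hTe]
          unfold TT
          rw [hset]
          gcongr with i hi
          · intro i _; exact jmp_nonneg E I ξ hnn v i
          · exact jmp_le E I ξ hnn v i
        exact mul_nonpos_of_nonneg_of_nonpos (hnn v) (by linarith)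
    · have hc1 : (A.filter (fun u => Lnk E I u v)).card = 1 := by omega
      obtain ⟨u, hu⟩ := Finset.card_pos.1 (by omega : 0 < (A.filter (fun u => Lnk E I u v)).card)
      rw [Finset.mem_filter] at hu
      rw [hz v ⟨u, hu.1, hu.2.1, by simp [jmp, hu.2]⟩, hc1]
      simp only [Nat.cast_one, mul_one]
      calc ξ v * (0 - T) + T * ξ v = 0 := by ring
        _ ≤ _ := hrhs
  have hsum := Finset.sum_le_sum (fun v (_ : v ∈ Finset.univ) => key v)
  rw [Finset.sum_add_distrib, ← Finset.mul_sum] at hsum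
  have hk : ∑ v, ξ v * ((A.filter (fun u => Lnk E I u v)).card : ℝ) = ∑ u ∈ A, kr E I ξ u := by
    unfold kr
    rw [Finset.sum_comm]
    refine Finset.sum_congr rfl (fun v _ => ?_)
    rw [← Finset.sum_filter, Finset.sum_const, nsmul_eq_mul, mul_comm]
  rw [hk] at hsum
  have hr : ∑ v, (if v ∈ A then T * ((A.card : ℝ) - 1) / (l * A.card) else 0)
      = T * ((A.card - 1) / l) := by
    rw [← Finset.sum_filter, Finset.sum_const, nsmul_eq_mul]
    have : (Finset.univ.filter (fun v => v ∈ A)) = A := by ext; simp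
    rw [this]
    have : (A.card : ℝ) ≠ 0 := by positivity
    field_simp
  rw [hr] at hsum
  linarith

open Classical in
/-- generator identity for the total weight -/
theorem gen_sum {V : Type} [Fintype V] (E : Finset (Finset V)) (I : Finset V) (ξ : V → ℝ) :
    ∑ u, ξ u * kr E I ξ u + ∑ v, ξ v * (∑ u, jmp E I ξ v u - ∑ u, ξ u) = - ∑ v, ξ v ^ 2 := by
  have h1 : ∀ v, ∑ u, jmp E I ξ v u - ∑ u, ξ u
      = - ξ v - ∑ u, if Lnk E I u v then ξ u else 0 := by
    intro v
    rw [← Finset.sum_sub_distrib]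
    have : ∀ u, jmp E I ξ v u - ξ u
        = (if u = v then - ξ u else 0) - (if Lnk E I u v then ξ u else 0) := by
      intro u
      unfold jmp
      by_cases h1 : u = v
      · have : ¬ Lnk E I u v := fun h => h.1 h1
        rw [if_pos (Or.inl h1), if_pos h1, if_neg this]
        ring
      · by_cases h2 : Lnk E I u v <;> simp [h1, h2]
    rw [Finset.sum_congr rfl (fun u _ => this u), Finset.sum_sub_distrib]
    simp
  have h2 : ∀ v, kr E I ξ v = ∑ u, if Lnk E I u v then ξ u else 0 := by
    intro v
    unfold kr
    refine Finset.sum_congr rfl (fun u _ => ?_)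
    have : Lnk E I v u ↔ Lnk E I u v := ⟨Lnk.symm, Lnk.symm⟩
    simp [this]
  rw [← Finset.sum_add_distrib, ← Finset.sum_neg_distrib]
  refine Finset.sum_congr rfl (fun v _ => ?_)
  rw [h1 v, h2 v]
  ring



open Classical in
theorem kill_psi {V : Type} [Fintype V] {E : Finset (Finset V)} {I : Finset V} {ξ : V → ℝ}
    (h : Inv E I ξ) {l q : ℝ} (hq : 0 < q) {w : V} (hw : ξ w ≠ 0)
    (hcap : q * ξ w ≤ ∑ e ∈ E with w ∈ e, TT l I ξ e) :
    Psi E q l I ξ ≤ Psi E q l I (Function.update ξ w 0) := by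
  have hwI : w ∉ I := fun h' => hw (h.zero w h')
  have h1 : ∑ u, Function.update ξ w 0 u = ∑ u, ξ u - ξ w := by
    rw [Finset.sum_update_of_mem (Finset.mem_univ w), ← Finset.sum_sdiff (Finset.subset_univ {w})]
    simp
  have h2 : ∑ e ∈ E, TT l I (Function.update ξ w 0) e
      = ∑ e ∈ E, TT l I ξ e - ∑ e ∈ E with w ∈ e, TT l I ξ e := by
    rw [Finset.sum_filter, ← Finset.sum_sub_distrib]
    refine Finset.sum_congr rfl (fun e _ => ?_)
    by_cases hwe : w ∈ e
    · rw [if_pos hwe, sub_self]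
      unfold TT
      rw [Finset.prod_eq_zero (i := w) (by simp [hwe, hwI]) (by simp), mul_zero]
    · rw [if_neg hwe, sub_zero]
      unfold TT
      congr 1
      refine Finset.prod_congr rfl (fun u hu => ?_)
      rw [Function.update_of_ne]
      rintro rfl
      exact hwe (Finset.mem_sdiff.1 hu).1
  unfold Psi
  rw [h1, h2, mul_sub]
  have : ξ w ≤ 1 / q * ∑ e ∈ E with w ∈ e, TT l I ξ e := by
    rw [one_div, ← div_eq_inv_mul, le_div_iff₀ hq]; linarith
  linarith

open Classical in
theorem rate_bound {V : Type} [Fintype V] {E : Finset (Finset V)} {I : Finset V} {ξ : V → ℝ}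
    (h : Inv E I ξ) {l q : ℝ} (hl : 0 < l) {w : V} (hw : ξ w ≠ 0)
    (hcap : ∑ e ∈ E with w ∈ e, TT l I ξ e ≤ q * ξ w) :
    kr E I ξ w ≤ q / (2 * l) := by
  have hwI : w ∉ I := fun h' => hw (h.zero w h')
  have hwp : 0 < ξ w := lt_of_le_of_ne (h.nonneg w) (Ne.symm hw)
  set S := Finset.univ.filter (fun v => Lnk E I w v ∧ ξ v ≠ 0) with hS
  have hk : kr E I ξ w = ∑ v ∈ S, ξ v := by
    unfold kr
    rw [hS, Finset.sum_filter]
    refine Finset.sum_congr rfl (fun v _ => ?_)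
    by_cases h1 : Lnk E I w v <;> by_cases h2 : ξ v = 0 <;> simp [h1, h2]
  have hch : ∀ v ∈ S, ∃ e ∈ E, e \ I = {w, v} ∧ w ∈ e ∧ w ≠ v := by
    intro v hv
    obtain ⟨⟨hne, e, he, hwe, hve, hx⟩, hv0⟩ := (Finset.mem_filter.1 hv).2
    refine ⟨e, he, ?_, hwe, hne⟩
    have hvI : v ∉ I := fun h' => hv0 (h.zero v h')
    ext x
    simp only [Finset.mem_sdiff, Finset.mem_insert, Finset.mem_singleton]
    constructor
    · rintro ⟨hxe, hxI⟩
      by_contra hcon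
      push Not at hcon
      exact hxI (hx x hxe hcon.1 hcon.2)
    · rintro (rfl | rfl)
      · exact ⟨hwe, hwI⟩
      · exact ⟨hve, hvI⟩
  choose! f hfE hf hfw hne using hch
  have hinj : Set.InjOn f S := by
    intro a ha b hb hab
    have h1 := hf a ha
    rw [hab, hf b hb] at h1
    have : b ∈ ({w, a} : Finset V) := by rw [← h1]; simp
    simp only [Finset.mem_insert, Finset.mem_singleton] at this
    rcases this with h2 | h2
    · exact absurd h2.symm (hne b hb)
    · exact h2.symm
  have hTf : ∀ v ∈ S, TT l I ξ (f v) = 2 * l * ξ w * ξ v := by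
    intro v hv
    unfold TT
    rw [hf v hv, Finset.card_pair (hne v hv), Finset.prod_pair (hne v hv)]
    norm_num; ring
  have hle : ∑ v ∈ S, TT l I ξ (f v) ≤ ∑ e ∈ E with w ∈ e, TT l I ξ e := by
    rw [← Finset.sum_image (f := fun e => TT l I ξ e) hinj]
    refine Finset.sum_le_sum_of_subset_of_nonneg ?_
      (fun e _ _ => TT_nonneg hl.le I h.nonneg e)
    intro e he
    obtain ⟨v, hv, rfl⟩ := Finset.mem_image.1 he
    exact Finset.mem_filter.2 ⟨hfE v hv, hfw v hv⟩
  rw [Finset.sum_congr rfl hTf, ← Finset.mul_sum, ← hk] at hle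
  rw [le_div_iff₀ (by positivity)]
  have : ξ w * (kr E I ξ w * (2 * l)) ≤ ξ w * q := by nlinarith
  exact le_of_mul_le_mul_left this hwp

/-- drift of an edge -/
noncomputable def yy {V : Type} [Fintype V] (E : Finset (Finset V)) (l : ℝ) (I : Finset V)
    (ξ : V → ℝ) (e : Finset V) : ℝ := by
  classical
  exact ∑ u ∈ e \ I, kr E I ξ u - (((e \ I).card : ℝ) - 1) / l

/-- drift of `Psi` along the flow -/
noncomputable def GG {V : Type} [Fintype V] (E : Finset (Finset V)) (q l : ℝ) (I : Finset V)
    (ξ : V → ℝ) : ℝ :=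
  ∑ u, ξ u * kr E I ξ u - (1 / q) * ∑ e ∈ E, TT l I ξ e * yy E l I ξ e

open Classical in
theorem gen_psi {V : Type} [Fintype V] {E : Finset (Finset V)} {I : Finset V} {ξ : V → ℝ}
    (hlin : ∀ e ∈ E, ∀ e' ∈ E, ∀ u u', u ≠ u' → u ∈ e → u' ∈ e → u ∈ e' → u' ∈ e' → e = e')
    (htri : ∀ e ∈ E, ∀ e₁ ∈ E, ∀ e₂ ∈ E, ∀ u u' v, u ≠ u' → u ≠ v → u' ≠ v → u ∈ e → u ∈ e₁ →
      u' ∈ e → u' ∈ e₂ → v ∈ e₁ → v ∈ e₂ → e = e₁ ∨ e = e₂ ∨ e₁ = e₂)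
    (h : Inv E I ξ) {l q : ℝ} (hl : 0 < l) (hq : 0 < q) :
    - ∑ v, ξ v ^ 2 ≤ GG E q l I ξ
      + ∑ v, ξ v * (Psi E q l (insert v I) (jmp E I ξ v) - Psi E q l I ξ) := by
  have h1 := gen_sum E I ξ
  have h2 : ∑ e ∈ E, (TT l I ξ e * yy E l I ξ e
      + ∑ v, ξ v * (TT l (insert v I) (jmp E I ξ v) e - TT l I ξ e)) ≤ 0 :=
    Finset.sum_nonpos (fun e he => gen_edge hlin htri h hl he)
  rw [Finset.sum_add_distrib, Finset.sum_comm] at h2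
  have h3 : ∑ v, ξ v * (Psi E q l (insert v I) (jmp E I ξ v) - Psi E q l I ξ)
      = ∑ v, ξ v * (∑ u, jmp E I ξ v u - ∑ u, ξ u)
        - (1 / q) * ∑ v, ∑ e ∈ E, ξ v * (TT l (insert v I) (jmp E I ξ v) e - TT l I ξ e) := by
    rw [Finset.mul_sum, ← Finset.sum_sub_distrib]
    refine Finset.sum_congr rfl (fun v _ => ?_)
    unfold Psi
    rw [← Finset.mul_sum, Finset.sum_sub_distrib]
    ring
  rw [h3]
  unfold GG
  have h4 : 0 < 1 / q := by positivity
  have h5 := mul_nonpos_of_nonneg_of_nonpos h4.le h2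
  rw [mul_add] at h5
  linarith

open Classical in
theorem flow_edge {V : Type} [Fintype V] {E : Finset (Finset V)} {I : Finset V} {ξ : V → ℝ}
    (h : Inv E I ξ) {l η Y : ℝ} (hη : 0 ≤ η) (hηl : η < l) {e : Finset V} (he : e ∈ E)
    (hy : TT l I ξ e ≠ 0 → |yy E l I ξ e| ≤ Y) (hηY : η * Y ≤ 1) :
    TT (l - η) I (fun u => ξ u * (1 + η * kr E I ξ u)) e
      ≤ TT l I ξ e * (1 + η * yy E l I ξ e + η ^ 2 * Y ^ 2) := by
  have hl : 0 < l := by linarith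
  have hnn := h.nonneg
  have hkn : ∀ u, 0 ≤ kr E I ξ u := by
    intro u; unfold kr
    refine Finset.sum_nonneg (fun v _ => ?_)
    split_ifs
    · exact hnn v
    · exact le_rfl
  have hm : 1 ≤ (e \ I).card := by
    rw [Nat.one_le_iff_ne_zero, Finset.card_ne_zero, Finset.nonempty_iff_ne_empty]
    intro h0
    exact h.indep e he (Finset.sdiff_eq_empty_iff_subset.1 h0)
  by_cases hp : ∏ u ∈ e \ I, ξ u = 0
  · have : TT l I ξ e = 0 := by unfold TT; rw [hp, mul_zero]
    rw [this, zero_mul]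
    unfold TT
    rw [Finset.prod_mul_distrib, hp, zero_mul, mul_zero]
  have hT : TT l I ξ e ≠ 0 := by
    unfold TT
    have : ((e \ I).card : ℝ) ≠ 0 := by positivity
    exact mul_ne_zero (mul_ne_zero this (by positivity)) hp
  have hy := hy hT
  have hTn : 0 ≤ TT l I ξ e := TT_nonneg hl.le I hnn e
  set y := yy E l I ξ e with hyd
  have hexp : Real.exp (η * y) ≤ 1 + η * y + η ^ 2 * Y ^ 2 := by
    have h1 : |η * y| ≤ 1 := by
      rw [abs_mul, abs_of_nonneg hη]
      exact le_trans (mul_le_mul_of_nonneg_left hy hη) hηY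
    have h2 := Real.abs_exp_sub_one_sub_id_le h1
    have h3 := (abs_le.1 h2).2
    have h4 : y ^ 2 ≤ Y ^ 2 := by
      rw [← sq_abs]; exact pow_le_pow_left₀ (abs_nonneg _) hy 2
    nlinarith [mul_le_mul_of_nonneg_left h4 (sq_nonneg η)]
  refine le_trans ?_ (mul_le_mul_of_nonneg_left hexp hTn)
  have hpow : (l - η) ^ ((e \ I).card - 1)
      ≤ l ^ ((e \ I).card - 1) * Real.exp (-(η * (((e \ I).card : ℝ) - 1) / l)) := by
    have h1 : l - η ≤ l * Real.exp (-(η / l)) := by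
      have := Real.add_one_le_exp (-(η / l))
      calc l - η = l * (-(η / l) + 1) := by field_simp; ring
        _ ≤ _ := mul_le_mul_of_nonneg_left this hl.le
    calc (l - η) ^ ((e \ I).card - 1) ≤ (l * Real.exp (-(η / l))) ^ ((e \ I).card - 1) :=
          pow_le_pow_left₀ (by linarith) h1 _
      _ = _ := by
          rw [mul_pow, ← Real.exp_nat_mul, Nat.cast_sub hm]
          congr 2
          push_cast
          ring
  have hprod : ∏ u ∈ e \ I, (1 + η * kr E I ξ u)
      ≤ Real.exp (η * ∑ u ∈ e \ I, kr E I ξ u) := by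
    rw [Finset.mul_sum, Real.exp_sum]
    refine Finset.prod_le_prod (fun u _ => ?_) (fun u _ => ?_)
    · have := mul_nonneg hη (hkn u); linarith
    · have := Real.add_one_le_exp (η * kr E I ξ u); linarith
  have hPn : 0 ≤ ∏ u ∈ e \ I, ξ u := Finset.prod_nonneg (fun u _ => hnn u)
  have hPn2 : 0 ≤ ∏ u ∈ e \ I, (1 + η * kr E I ξ u) := Finset.prod_nonneg
    (fun u _ => by have := mul_nonneg hη (hkn u); linarith)
  have hyeq : Real.exp (η * y) = Real.exp (-(η * (((e \ I).card : ℝ) - 1) / l))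
      * Real.exp (η * ∑ u ∈ e \ I, kr E I ξ u) := by
    rw [← Real.exp_add]
    congr 1
    rw [hyd]; unfold yy; ring
  unfold TT
  rw [Finset.prod_mul_distrib, hyeq]
  have hmul := mul_le_mul hpow hprod hPn2 (by positivity)
  have hc : 0 ≤ ((e \ I).card : ℝ) * ∏ u ∈ e \ I, ξ u := by positivity
  have := mul_le_mul_of_nonneg_left hmul hc
  calc _ = ((e \ I).card : ℝ) * (∏ u ∈ e \ I, ξ u) *
        ((l - η) ^ ((e \ I).card - 1) * ∏ u ∈ e \ I, (1 + η * kr E I ξ u)) := by ring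
    _ ≤ _ := this
    _ = _ := by ring

/-- full potential -/
noncomputable def Phi {V : Type} [Fintype V] (E : Finset (Finset V)) (q l₁ l : ℝ) (I : Finset V)
    (ξ : V → ℝ) : ℝ := (9 / 8) * (I.card : ℝ) + (l - l₁) * Psi E q l I ξ

open Classical in
theorem flow_step {V : Type} [Fintype V] {E : Finset (Finset V)} {I : Finset V} {ξ : V → ℝ}
    (hlin : ∀ e ∈ E, ∀ e' ∈ E, ∀ u u', u ≠ u' → u ∈ e → u' ∈ e → u ∈ e' → u' ∈ e' → e = e')
    (htri : ∀ e ∈ E, ∀ e₁ ∈ E, ∀ e₂ ∈ E, ∀ u u' v, u ≠ u' → u ≠ v → u' ≠ v → u ∈ e → u ∈ e₁ →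
      u' ∈ e → u' ∈ e₂ → v ∈ e₁ → v ∈ e₂ → e = e₁ ∨ e = e₂ ∨ e₁ = e₂)
    {k : ℕ} (hk : ∀ e ∈ E, e.card = k)
    (h : Inv E I ξ) {l q l₁ η B Y : ℝ} (hl₁ : 0 < l₁) (hη : 0 ≤ η) (hηl : l₁ ≤ l - η) (hq : 0 < q)
    (hB : ∀ u, ξ u ≤ B) (hB0 : 0 ≤ B) (hBl : (l - l₁) * B ≤ 1 / 8) (hl1 : l - l₁ ≤ 1)
    (hcap : ∀ w, ξ w ≠ 0 → ∑ e ∈ E with w ∈ e, TT l I ξ e ≤ q * ξ w)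
    (hj : ∀ v, ξ v ≠ 0 → Phi E q l₁ l (insert v I) (jmp E I ξ v) ≤ Phi E q l₁ l I ξ)
    (hY : (k : ℝ) * (q / (2 * l₁)) + k / l₁ ≤ Y) (hηY : η * Y ≤ 1) :
    Phi E q l₁ l I ξ - ((Fintype.card V : ℝ) * B * (q / (2 * l₁)) + E.card * B * Y
        + E.card * B * Y ^ 2) * η ^ 2
      ≤ Phi E q l₁ (l - η) I (fun u => ξ u * (1 + η * kr E I ξ u)) := by
  have hl : 0 < l := by linarith
  have hnn := h.nonneg
  have hkn : ∀ u, 0 ≤ kr E I ξ u := by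
    intro u; unfold kr
    refine Finset.sum_nonneg (fun v _ => ?_)
    split_ifs
    · exact hnn v
    · exact le_rfl
  have hkr : ∀ w, ξ w ≠ 0 → kr E I ξ w ≤ q / (2 * l₁) := by
    intro w hw
    refine (rate_bound h hl hw (hcap w hw)).trans ?_
    gcongr; linarith
  have hY0 : 0 ≤ Y := le_trans (by positivity) hY
  have hyY : ∀ e ∈ E, TT l I ξ e ≠ 0 → |yy E l I ξ e| ≤ Y := by
    intro e he hT
    have hne : ∀ u ∈ e \ I, ξ u ≠ 0 := by
      intro u hu h0
      apply hT; unfold TT; rw [Finset.prod_eq_zero hu h0, mul_zero]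
    have hm : 1 ≤ (e \ I).card := by
      rw [Nat.one_le_iff_ne_zero, Finset.card_ne_zero, Finset.nonempty_iff_ne_empty]
      intro h0
      exact h.indep e he (Finset.sdiff_eq_empty_iff_subset.1 h0)
    have hmk : (e \ I).card ≤ k := by
      rw [← hk e he]; exact Finset.card_le_card Finset.sdiff_subset
    have hm' : (1:ℝ) ≤ (e \ I).card := by exact_mod_cast hm
    have hmk' : ((e \ I).card : ℝ) ≤ k := by exact_mod_cast hmk
    have hs : ∑ u ∈ e \ I, kr E I ξ u ≤ k * (q / (2 * l₁)) := by
      calc _ ≤ ∑ u ∈ e \ I, q / (2 * l₁) := Finset.sum_le_sum (fun u hu => hkr u (hne u hu))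
        _ = (e \ I).card * (q / (2 * l₁)) := by rw [Finset.sum_const, nsmul_eq_mul]
        _ ≤ _ := by gcongr
    have hs0 : 0 ≤ ∑ u ∈ e \ I, kr E I ξ u := Finset.sum_nonneg (fun u _ => hkn u)
    have hd : (((e \ I).card : ℝ) - 1) / l ≤ k / l₁ := by
      apply div_le_div₀ <;> linarith
    have hd0 : 0 ≤ (((e \ I).card : ℝ) - 1) / l := div_nonneg (by linarith) hl.le
    have hp1 : (0:ℝ) ≤ k * (q / (2 * l₁)) := by positivity
    have hp2 : (0:ℝ) ≤ k / l₁ := by positivity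
    unfold yy
    rw [abs_le]
    constructor <;> linarith
  have hTn : ∀ e, 0 ≤ TT l I ξ e := TT_nonneg hl.le I hnn
  have hTB : ∀ e ∈ E, TT l I ξ e ≤ q * B := by
    intro e he
    by_cases hT : TT l I ξ e = 0
    · rw [hT]; positivity
    have hne : ∀ u ∈ e \ I, ξ u ≠ 0 := by
      intro u hu h0
      apply hT; unfold TT; rw [Finset.prod_eq_zero hu h0, mul_zero]
    have hm : (e \ I).Nonempty := by
      rw [Finset.nonempty_iff_ne_empty]
      intro h0
      exact h.indep e he (Finset.sdiff_eq_empty_iff_subset.1 h0)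
    obtain ⟨w, hw⟩ := hm
    calc TT l I ξ e ≤ ∑ e ∈ E with w ∈ e, TT l I ξ e :=
          Finset.single_le_sum (f := fun e => TT l I ξ e) (fun e _ => hTn e)
            (Finset.mem_filter.2 ⟨he, (Finset.mem_sdiff.1 hw).1⟩)
      _ ≤ q * ξ w := hcap w (hne w hw)
      _ ≤ q * B := by have := hB w; gcongr
  have hST : (1 / q) * ∑ e ∈ E, TT l I ξ e ≤ E.card * B := by
    have : ∑ e ∈ E, TT l I ξ e ≤ E.card * (q * B) := by
      rw [← nsmul_eq_mul]; exact Finset.sum_le_card_nsmul _ _ _ hTB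
    calc _ ≤ (1 / q) * (E.card * (q * B)) := by gcongr
      _ = _ := by field_simp
  have hST0 : 0 ≤ (1 / q) * ∑ e ∈ E, TT l I ξ e :=
    mul_nonneg (by positivity) (Finset.sum_nonneg (fun e _ => hTn e))
  -- flow of Psi
  have hPsi : Psi E q l I ξ + η * GG E q l I ξ - η ^ 2 * (Y ^ 2 * ((1 / q) * ∑ e ∈ E, TT l I ξ e))
      ≤ Psi E q (l - η) I (fun u => ξ u * (1 + η * kr E I ξ u)) := by
    have h1 : ∑ e ∈ E, TT (l - η) I (fun u => ξ u * (1 + η * kr E I ξ u)) e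
        ≤ ∑ e ∈ E, TT l I ξ e * (1 + η * yy E l I ξ e + η ^ 2 * Y ^ 2) :=
      Finset.sum_le_sum (fun e he => flow_edge h hη (by linarith) he (hyY e he) hηY)
    have h2 : ∑ e ∈ E, TT l I ξ e * (1 + η * yy E l I ξ e + η ^ 2 * Y ^ 2)
        = ∑ e ∈ E, TT l I ξ e + η * ∑ e ∈ E, TT l I ξ e * yy E l I ξ e
          + η ^ 2 * Y ^ 2 * ∑ e ∈ E, TT l I ξ e := by
      rw [Finset.mul_sum, Finset.mul_sum, ← Finset.sum_add_distrib, ← Finset.sum_add_distrib]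
      exact Finset.sum_congr rfl (fun e _ => by ring)
    have h3 : ∑ u, ξ u * (1 + η * kr E I ξ u) = ∑ u, ξ u + η * ∑ u, ξ u * kr E I ξ u := by
      rw [Finset.mul_sum, ← Finset.sum_add_distrib]
      exact Finset.sum_congr rfl (fun e _ => by ring)
    rw [h2] at h1
    have h4 : 0 < 1 / q := by positivity
    have h5 := mul_le_mul_of_nonneg_left h1 h4.le
    unfold Psi GG
    rw [h3]
    linarith
  -- bound on GG
  have hG : GG E q l I ξ ≤ (Fintype.card V : ℝ) * B * (q / (2 * l₁)) + E.card * B * Y := by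
    have h1 : ∑ u, ξ u * kr E I ξ u ≤ (Fintype.card V : ℝ) * (B * (q / (2 * l₁))) := by
      rw [← nsmul_eq_mul, ← Finset.card_univ]
      refine Finset.sum_le_card_nsmul _ _ _ (fun u _ => ?_)
      by_cases hu : ξ u = 0
      · rw [hu, zero_mul]; positivity
      · exact mul_le_mul (hB u) (hkr u hu) (hkn u) hB0
    have h2 : - (Y * ∑ e ∈ E, TT l I ξ e) ≤ ∑ e ∈ E, TT l I ξ e * yy E l I ξ e := by
      rw [Finset.mul_sum, ← Finset.sum_neg_distrib]
      refine Finset.sum_le_sum (fun e he => ?_)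
      by_cases hT : TT l I ξ e = 0
      · rw [hT]; simp
      · have := (abs_le.1 (hyY e he hT)).1
        nlinarith [hTn e]
    have h4 : 0 < 1 / q := by positivity
    have h5 := mul_le_mul_of_nonneg_left h2 h4.le
    have h6 := mul_le_mul_of_nonneg_left hST hY0
    unfold GG
    nlinarith
  -- generator inequality
  have hgen := gen_psi hlin htri h hl hq
  have hF : 0 ≤ (l - l₁) * GG E q l I ξ - Psi E q l I ξ := by
    have h1 : ∑ v, ξ v * (Phi E q l₁ l (insert v I) (jmp E I ξ v) - Phi E q l₁ l I ξ) ≤ 0 := by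
      refine Finset.sum_nonpos (fun v _ => ?_)
      by_cases hv : ξ v = 0
      · rw [hv, zero_mul]
      · exact mul_nonpos_of_nonneg_of_nonpos (hnn v) (by linarith [hj v hv])
    have h2 : ∑ v, ξ v * (Phi E q l₁ l (insert v I) (jmp E I ξ v) - Phi E q l₁ l I ξ)
        = (9 / 8) * ∑ v, ξ v + (l - l₁) *
          ∑ v, ξ v * (Psi E q l (insert v I) (jmp E I ξ v) - Psi E q l I ξ) := by
      rw [Finset.mul_sum, Finset.mul_sum, ← Finset.sum_add_distrib]
      refine Finset.sum_congr rfl (fun v _ => ?_)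
      by_cases hv : ξ v = 0
      · rw [hv]; simp
      · have hvI : v ∉ I := fun h' => hv (h.zero v h')
        unfold Phi
        rw [Finset.card_insert_of_notMem hvI]
        push_cast
        ring
    have h3 : Psi E q l I ξ ≤ ∑ v, ξ v := by unfold Psi; linarith
    have h4 : (l - l₁) * ∑ v, ξ v ^ 2 ≤ (1 / 8) * ∑ v, ξ v := by
      have : ∑ v, ξ v ^ 2 ≤ B * ∑ v, ξ v := by
        rw [Finset.mul_sum]
        exact Finset.sum_le_sum (fun v _ => by nlinarith [hnn v, hB v])
      have hs : 0 ≤ ∑ v, ξ v := Finset.sum_nonneg (fun v _ => hnn v)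
      calc _ ≤ (l - l₁) * (B * ∑ v, ξ v) := mul_le_mul_of_nonneg_left this (by linarith)
        _ = ((l - l₁) * B) * ∑ v, ξ v := by ring
        _ ≤ _ := mul_le_mul_of_nonneg_right hBl hs
    have h5 := mul_le_mul_of_nonneg_left hgen (by linarith : 0 ≤ l - l₁)
    rw [mul_add] at h5
    linarith
  have hμ : 0 ≤ l - η - l₁ := by linarith
  have h7 := mul_le_mul_of_nonneg_left hPsi hμ
  have h8 : 0 ≤ η * ((l - l₁) * GG E q l I ξ - Psi E q l I ξ) := mul_nonneg hη hF
  have h9 : η ^ 2 * GG E q l I ξ ≤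
      η ^ 2 * ((Fintype.card V : ℝ) * B * (q / (2 * l₁)) + E.card * B * Y) :=
    mul_le_mul_of_nonneg_left hG (sq_nonneg η)
  have h10 : (l - η - l₁) * (η ^ 2 * (Y ^ 2 * ((1 / q) * ∑ e ∈ E, TT l I ξ e)))
      ≤ 1 * (η ^ 2 * (Y ^ 2 * (E.card * B))) := by
    apply mul_le_mul (by linarith) _ (by positivity) (by norm_num)
    gcongr
  unfold Phi
  generalize Psi E q (l - η) I (fun u => ξ u * (1 + η * kr E I ξ u)) = P' at *
  generalize Psi E q l I ξ = P at *
  generalize GG E q l I ξ = G at *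
  nlinarith


open Classical in
theorem normalize {V : Type} [Fintype V] {E : Finset (Finset V)} {l q l₁ B X : ℝ}
    (hq : 0 < q) (hl : l₁ ≤ l) (N : ℕ) : ∀ (I : Finset V) (ξ : V → ℝ),
    (Finset.univ.filter (fun u => ξ u ≠ 0)).card = N → Inv E I ξ → (∀ u, ξ u ≤ B) →
    X ≤ Phi E q l₁ l I ξ →
    ∃ (I' : Finset V) (ξ' : V → ℝ), Inv E I' ξ' ∧ (∀ u, ξ' u ≤ B) ∧ X ≤ Phi E q l₁ l I' ξ' ∧
      (∀ w, ξ' w ≠ 0 → ∑ e ∈ E with w ∈ e, TT l I' ξ' e ≤ q * ξ' w) ∧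
      (∀ v, ξ' v ≠ 0 → Phi E q l₁ l (insert v I') (jmp E I' ξ' v) ≤ Phi E q l₁ l I' ξ') := by
  induction N using Nat.strong_induction_on with
  | _ N ih =>
    intro I ξ hN h hB hX
    by_cases h1 : ∀ w, ξ w ≠ 0 → ∑ e ∈ E with w ∈ e, TT l I ξ e ≤ q * ξ w
    · by_cases h2 : ∀ v, ξ v ≠ 0 → Phi E q l₁ l (insert v I) (jmp E I ξ v) ≤ Phi E q l₁ l I ξ
      · exact ⟨I, ξ, h, hB, hX, h1, h2⟩
      · push Not at h2
        obtain ⟨v, hv, hlt⟩ := h2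
        refine ih _ ?_ (insert v I) (jmp E I ξ v) rfl (h.jump hv)
          (fun u => (jmp_le E I ξ h.nonneg v u).trans (hB u)) (hX.trans hlt.le)
        rw [← hN]
        apply Finset.card_lt_card
        rw [Finset.ssubset_iff_of_subset]
        · exact ⟨v, by simp [hv], by simp [jmp]⟩
        · intro u hu
          rw [Finset.mem_filter] at hu ⊢
          refine ⟨Finset.mem_univ _, fun h0 => hu.2 (le_antisymm ?_ ?_)⟩
          · exact (jmp_le E I ξ h.nonneg v u).trans h0.le
          · exact jmp_nonneg E I ξ h.nonneg v u
    · push Not at h1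
      obtain ⟨w, hw, hlt⟩ := h1
      refine ih _ ?_ I (Function.update ξ w 0) rfl (h.mono ?_ ?_) ?_ ?_
      · rw [← hN]
        apply Finset.card_lt_card
        rw [Finset.ssubset_iff_of_subset]
        · exact ⟨w, by simp [hw], by simp⟩
        · intro u hu
          simp only [Finset.mem_filter, Finset.mem_univ, true_and] at hu ⊢
          by_cases huw : u = w
          · rw [huw]; exact hw
          · rwa [Function.update_of_ne huw] at hu
      · intro u
        by_cases huw : u = w
        · rw [huw]; simp
        · rw [Function.update_of_ne huw]; exact h.nonneg u
      · intro u hu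
        by_cases huw : u = w
        · rw [huw]; simp
        · rw [Function.update_of_ne huw]; exact hu
      · intro u
        by_cases huw : u = w
        · rw [huw]; simp only [Function.update_self]; exact (h.nonneg w).trans (hB w)
        · rw [Function.update_of_ne huw]; exact hB u
      · refine hX.trans ?_
        have := kill_psi h hq hw hlt.le
        unfold Phi
        have := mul_le_mul_of_nonneg_left this (by linarith : 0 ≤ l - l₁)
        linarith

set_option maxHeartbeats 2000000 in
open Classical in
/-- Independent sets in linear triangle-free uniform hypergraphs. -/
theorem indep_set {V : Type} [Fintype V] {E : Finset (Finset V)}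
    (hlin : ∀ e ∈ E, ∀ e' ∈ E, ∀ u u', u ≠ u' → u ∈ e → u' ∈ e → u ∈ e' → u' ∈ e' → e = e')
    (htri : ∀ e ∈ E, ∀ e₁ ∈ E, ∀ e₂ ∈ E, ∀ u u' v, u ≠ u' → u ≠ v → u' ≠ v → u ∈ e → u ∈ e₁ →
      u' ∈ e → u' ∈ e₂ → v ∈ e₁ → v ∈ e₂ → e = e₁ ∨ e = e₂ ∨ e₁ = e₂)
    {k : ℕ} (hk : ∀ e ∈ E, e.card = k) (hk2 : 2 ≤ k) {l q : ℝ} (hl : 0 < l) (hl1 : l ≤ 1)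
    (hq : 0 < q) (hE : (k : ℝ) * E.card * l ^ (k - 1) ≤ (q / 4) * Fintype.card V)
    (hlq : l * Real.exp (q / 2) ≤ 1 / 4) :
    ∃ I : Finset V, (∀ e ∈ E, ¬ e ⊆ I) ∧ l * Fintype.card V / 4 ≤ I.card := by
  set n : ℝ := (Fintype.card V : ℝ) with hn
  rcases Nat.eq_zero_or_pos (Fintype.card V) with hV | hV
  · refine ⟨∅, ?_, by rw [hn, hV]; simp⟩
    intro e he hsub
    have := hk e he
    rw [Finset.subset_empty.1 hsub] at this
    simp at this; omega
  have hn0 : 0 < n := by rw [hn]; exact_mod_cast hV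
  set l₁ := l / 2 with hl₁
  set Bm := Real.exp (q / 2) with hBm
  set β := q / (2 * l₁) with hβ
  set Y := (k : ℝ) * (q / (2 * l₁)) + k / l₁ with hY
  set C := n * Bm * (q / (2 * l₁)) + E.card * Bm * Y + E.card * Bm * Y ^ 2 with hC
  have hl₁p : 0 < l₁ := by positivity
  have hBp : 0 < Bm := Real.exp_pos _
  have hYp : 0 ≤ Y := by positivity
  have hCp : 0 ≤ C := by positivity
  -- choose M
  obtain ⟨M, hM⟩ := exists_nat_gt (max 1 (max (l * Y) (8 * C * l / n)))
  have hM1 : (1:ℝ) < M := lt_of_le_of_lt (le_max_left _ _) hM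
  have hM2 : l * Y < M := lt_of_le_of_lt ((le_max_left _ _).trans (le_max_right _ _)) hM
  have hM3 : 8 * C * l / n < M := lt_of_le_of_lt ((le_max_right _ _).trans (le_max_right _ _)) hM
  have hMp : (0:ℝ) < M := by linarith
  set η := l₁ / M with hη
  have hηp : 0 < η := by positivity
  have hηY : η * Y ≤ 1 := by
    rw [hη, div_mul_eq_mul_div, div_le_one hMp, hl₁]
    nlinarith [mul_nonneg hl.le hYp]
  set X := l₁ * (3 / 4 * n) with hX
  have main : ∀ i : ℕ, i ≤ M → ∃ (I : Finset V) (ξ : V → ℝ), Inv E I ξ ∧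
      (∀ u, ξ u ≤ Real.exp (β * (i * η))) ∧ X - i * (C * η ^ 2) ≤ Phi E q l₁ (l - i * η) I ξ := by
    intro i
    induction i with
    | zero =>
      intro _
      refine ⟨∅, fun _ => 1, ⟨by intro u; norm_num, by simp, ?_, ?_⟩, by simp, ?_⟩
      · intro e he hsub
        have := hk e he
        rw [Finset.subset_empty.1 hsub] at this
        simp at this; omega
      · intro u _ e he hue hall
        have h1 : e ⊆ {u} := by
          intro x hx
          by_contra hne
          have := hall x hx (by simpa using hne)
          simp at this
        have := Finset.card_le_card h1
        rw [hk e he] at this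
        simp at this; omega
      · unfold Phi Psi
        have hT : ∑ e ∈ E, TT l ∅ (fun _ => (1:ℝ)) e = k * E.card * l ^ (k - 1) := by
          have : ∀ e ∈ E, TT l ∅ (fun _ => (1:ℝ)) e = k * l ^ (k - 1) := by
            intro e he
            unfold TT
            simp [hk e he]
          rw [Finset.sum_congr rfl this, Finset.sum_const, nsmul_eq_mul]; ring
        simp only [Nat.cast_zero, zero_mul, sub_zero, Finset.card_empty, mul_zero, zero_add]
        rw [hT]
        have h2 : (1 / q) * (k * E.card * l ^ (k - 1)) ≤ n / 4 := by
          rw [one_div, ← div_eq_inv_mul, div_le_iff₀ hq]; linarith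
        have h3 : ∑ _u : V, (1:ℝ) = n := by simp [hn]
        rw [h3, hX, show l - l₁ = l₁ by rw [hl₁]; ring]
        apply mul_le_mul_of_nonneg_left _ hl₁p.le
        linarith
    | succ i ih =>
      intro hi
      obtain ⟨I, ξ, h, hB, hP⟩ := ih (by omega)
      have hiM : ((i:ℝ) + 1) ≤ M := by exact_mod_cast hi
      have hiη : ((i:ℝ) + 1) * η ≤ l₁ := by
        calc ((i:ℝ) + 1) * η ≤ M * η := by gcongr
          _ = l₁ := by rw [hη]; field_simp
      have hll : l = 2 * l₁ := by rw [hl₁]; ring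
      have hi0 : (0:ℝ) ≤ i * η := by positivity
      obtain ⟨I', ξ', h', hB', hP', hcap, hj⟩ := normalize hq
        (by nlinarith : l₁ ≤ l - i * η) _ I ξ rfl h hB hP
      have hβ0 : 0 ≤ β := by positivity
      have hexpB : Real.exp (β * (i * η)) ≤ Bm := by
        rw [hBm, Real.exp_le_exp]
        calc β * (i * η) ≤ β * l₁ := by apply mul_le_mul_of_nonneg_left _ hβ0; nlinarith
          _ = q / 2 := by rw [hβ]; field_simp
      have hBm' : ∀ u, ξ' u ≤ Bm := fun u => (hB' u).trans hexpB
      have hfs := flow_step hlin htri hk h' hl₁p hηp.le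
        (by nlinarith : l₁ ≤ (l - i * η) - η) hq hBm' hBp.le
        (by
          calc (l - i * η - l₁) * Bm ≤ l₁ * Bm := by
                apply mul_le_mul_of_nonneg_right _ hBp.le; linarith
            _ ≤ 1 / 8 := by rw [hl₁]; linarith)
        (by linarith : l - i * η - l₁ ≤ 1) hcap hj le_rfl hηY
      have hkn : ∀ u, 0 ≤ kr E I' ξ' u := by
        intro u; unfold kr
        refine Finset.sum_nonneg (fun v _ => ?_)
        split_ifs
        · exact h'.nonneg v
        · exact le_rfl
      refine ⟨I', fun u => ξ' u * (1 + η * kr E I' ξ' u), h'.mono ?_ ?_, ?_, ?_⟩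
      · intro u
        exact mul_nonneg (h'.nonneg u) (by have := mul_nonneg hηp.le (hkn u); linarith)
      · intro u hu
        simp [hu]
      · intro u
        by_cases hu : ξ' u = 0
        · simp only [hu, zero_mul]; positivity
        have hlp : 0 < l - i * η := by nlinarith
        have hkb : kr E I' ξ' u ≤ β := by
          refine (rate_bound h' hlp hu (hcap u hu)).trans ?_
          rw [hβ]
          gcongr
          nlinarith
        calc ξ' u * (1 + η * kr E I' ξ' u) ≤ Real.exp (β * (i * η)) * Real.exp (β * η) := by
              apply mul_le_mul (hB' u) _ _ (by positivity)
              · have := Real.add_one_le_exp (β * η)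
                nlinarith
              · have := mul_nonneg hηp.le (hkn u); linarith
          _ = _ := by
              rw [← Real.exp_add]; congr 1; push_cast; ring
      · have e1 : l - ((i + 1 : ℕ) : ℝ) * η = l - i * η - η := by push_cast; ring
        rw [e1]
        refine le_trans ?_ hfs
        push_cast
        linarith
  obtain ⟨I, ξ, h, hB, hP⟩ := main M le_rfl
  refine ⟨I, h.indep, ?_⟩
  have hMη : (M:ℝ) * η = l₁ := by rw [hη]; field_simp
  have e1 : l - M * η - l₁ = 0 := by rw [hMη, hl₁]; ring
  unfold Phi at hP
  rw [e1, zero_mul, add_zero] at hP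
  have e2 : (M:ℝ) * (C * η ^ 2) = C * l₁ * η := by rw [← hMη]; ring
  rw [e2] at hP
  have hCη : C * η ≤ n / 16 := by
    rw [hη, ← mul_div_assoc, div_le_iff₀ hMp]
    rw [div_lt_iff₀ hn0] at hM3
    rw [hl₁]; linarith
  have : C * l₁ * η ≤ l₁ * (n / 16) := by
    calc C * l₁ * η = l₁ * (C * η) := by ring
      _ ≤ _ := mul_le_mul_of_nonneg_left hCη hl₁p.le
  have hfin : 0 ≤ l * n := by positivity
  rw [hX] at hP
  have : l₁ * n = l * n / 2 := by rw [hl₁]; ring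
  nlinarith


theorem no_mult {r e v : ℕ} (hgcd : Int.gcd ((e : ℤ) - 1) ((e : ℤ) * r - v) = 1) {t x : ℤ}
    (ht : 0 < t) (ht' : t < (e : ℤ) - 1) : t * ((v : ℤ) - r) ≠ ((e : ℤ) - 1) * x := by
  intro h
  have hc : IsCoprime ((e : ℤ) - 1) ((e : ℤ) * r - v) := Int.isCoprime_iff_gcd_eq_one.2 hgcd
  have hd : ((e : ℤ) - 1) ∣ t * ((e : ℤ) * r - v) :=
    ⟨t * r - x, by linear_combination -h⟩
  have := hc.dvd_of_dvd_mul_right hd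
  have := Int.le_of_dvd ht this
  omega

theorem sup_inter_bound {n : ℕ} {A B C : Finset (Finset (Fin n))} (hA : C ⊆ A) (hB : C ⊆ B) :
    ((A ∪ B).sup id).card + (C.sup id).card ≤ (A.sup id).card + (B.sup id).card := by
  rw [Finset.sup_union, ← Finset.card_union_add_card_inter (A.sup id) (B.sup id)]
  have h1 : C.sup id ⊆ A.sup id ∩ B.sup id :=
    Finset.subset_inter (Finset.sup_mono hA) (Finset.sup_mono hB)
  have := Finset.card_le_card h1
  change (A.sup id ∪ B.sup id).card + _ ≤ _
  omega

theorem struct_lin {n r e v : ℕ} (he : 3 ≤ e)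
    (hgcd : Int.gcd ((e : ℤ) - 1) ((e : ℤ) * r - v) = 1)
    {S : Finset (Finset (Fin n))}
    (hbad : ∀ F ⊆ S, 2 ≤ F.card → F.card ≤ 3 * e →
      ((F.card : ℤ) - 1) * ((v : ℤ) - r) ≤ ((e : ℤ) - 1) * (((F.sup id).card : ℤ) - r))
    {A B : Finset (Finset (Fin n))} (hA : A ⊆ S) (hB : B ⊆ S) (hAe : A.card = e) (hBe : B.card = e)
    (hAv : (A.sup id).card ≤ v) (hBv : (B.sup id).card ≤ v)
    {x y : Finset (Fin n)} (hxy : x ≠ y) (hxA : x ∈ A) (hyA : y ∈ A) (hxB : x ∈ B) (hyB : y ∈ B) :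
    A = B := by
  by_contra hne
  have h2 : 2 ≤ (A ∩ B).card := by
    have : ({x, y} : Finset _) ⊆ A ∩ B := by
      intro z hz
      simp only [Finset.mem_insert, Finset.mem_singleton] at hz
      rcases hz with rfl | rfl <;> simp [*]
    have h := Finset.card_le_card this
    rwa [Finset.card_pair hxy] at h
  have hlt : (A ∩ B).card < e := by
    rcases lt_or_ge (A ∩ B).card e with h | h
    · exact h
    exfalso; apply hne
    have h1 : A ∩ B = A := Finset.eq_of_subset_of_card_le Finset.inter_subset_left (by omega)
    have h2 : A ∩ B = B := Finset.eq_of_subset_of_card_le Finset.inter_subset_right (by omega)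
    rw [← h1, h2]
  have hcard := Finset.card_union_add_card_inter A B
  have b1 := hbad (A ∩ B) (Finset.inter_subset_left.trans hA) h2 (by omega)
  have b2 := hbad (A ∪ B) (Finset.union_subset hA hB) (by omega) (by omega)
  have hs := sup_inter_bound (Finset.inter_subset_left : A ∩ B ⊆ A)
    (Finset.inter_subset_right : A ∩ B ⊆ B)
  have hno := no_mult (x := (((A ∩ B).sup id).card : ℤ) - r) hgcd
    (t := ((A ∩ B).card : ℤ) - 1) (by omega) (by omega)
  have b1' := lt_of_le_of_ne b1 hno
  have hw : (((A ∪ B).sup id).card : ℤ) ≤ 2 * v - ((A ∩ B).sup id).card := by omega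
  have hU : ((A ∪ B).card : ℤ) = 2 * e - (A ∩ B).card := by omega
  rw [hU] at b2
  have he1 : (0:ℤ) ≤ (e : ℤ) - 1 := by omega
  have := mul_le_mul_of_nonneg_left hw he1
  nlinarith

theorem struct_tri {n r e v : ℕ} (he : 3 ≤ e)
    (hgcd : Int.gcd ((e : ℤ) - 1) ((e : ℤ) * r - v) = 1)
    {S : Finset (Finset (Fin n))} (hS : ∀ x ∈ S, x.card = r)
    (hbad : ∀ F ⊆ S, 2 ≤ F.card → F.card ≤ 3 * e →
      ((F.card : ℤ) - 1) * ((v : ℤ) - r) ≤ ((e : ℤ) - 1) * (((F.sup id).card : ℤ) - r))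
    {A B C : Finset (Finset (Fin n))} (hA : A ⊆ S) (hB : B ⊆ S) (hC : C ⊆ S)
    (hAe : A.card = e) (hBe : B.card = e) (hCe : C.card = e)
    (hAv : (A.sup id).card ≤ v) (hBv : (B.sup id).card ≤ v) (hCv : (C.sup id).card ≤ v)
    {x y z : Finset (Fin n)} (hxy : x ≠ y) (hxz : x ≠ z) (hyz : y ≠ z)
    (hxA : x ∈ A) (hxB : x ∈ B) (hyA : y ∈ A) (hyC : y ∈ C) (hzB : z ∈ B) (hzC : z ∈ C) :
    A = B ∨ A = C ∨ B = C := by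
  by_contra hcon
  push Not at hcon
  obtain ⟨nAB, nAC, nBC⟩ := hcon
  have iAB : A ∩ B = {x} := by
    ext w
    simp only [Finset.mem_inter, Finset.mem_singleton]
    constructor
    · rintro ⟨h1, h2⟩
      by_contra hw
      exact nAB (struct_lin he hgcd hbad hA hB hAe hBe hAv hBv hw h1 hxA h2 hxB)
    · rintro rfl; exact ⟨hxA, hxB⟩
  have iABC : (A ∪ B) ∩ C = {y, z} := by
    ext w
    simp only [Finset.mem_inter, Finset.mem_union, Finset.mem_insert, Finset.mem_singleton]
    constructor
    · rintro ⟨h1 | h1, h2⟩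
      · left; by_contra hw
        exact nAC (struct_lin he hgcd hbad hA hC hAe hCe hAv hCv hw h1 hyA h2 hyC)
      · right; by_contra hw
        exact nBC (struct_lin he hgcd hbad hB hC hBe hCe hBv hCv hw h1 hzB h2 hzC)
    · rintro (rfl | rfl)
      · exact ⟨Or.inl hyA, hyC⟩
      · exact ⟨Or.inr hzB, hzC⟩
  have c1 := Finset.card_union_add_card_inter A B
  have c2 := Finset.card_union_add_card_inter (A ∪ B) C
  rw [iAB, Finset.card_singleton] at c1
  rw [iABC, Finset.card_pair hyz] at c2
  have s1 := sup_inter_bound (C := {x}) (by simpa using hxA : {x} ⊆ A) (by simpa using hxB : {x} ⊆ B)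
  have s2 := sup_inter_bound (A := A ∪ B) (B := C) (C := {y, z})
    (by rw [← iABC]; exact Finset.inter_subset_left)
    (by rw [← iABC]; exact Finset.inter_subset_right)
  have hx : (({x} : Finset (Finset (Fin n))).sup id).card = r := by
    simp [hS x (hA hxA)]
  have b1 := hbad {y, z} (by rw [← iABC]; exact Finset.inter_subset_right.trans hC)
    (by rw [Finset.card_pair hyz]) (by rw [Finset.card_pair hyz]; omega)
  have b2 := hbad (A ∪ B ∪ C) (Finset.union_subset (Finset.union_subset hA hB) hC)
    (by omega) (by omega)
  rw [Finset.card_pair hyz] at b1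
  have hno := no_mult (x := ((({y, z} : Finset (Finset (Fin n))).sup id).card : ℤ) - r) hgcd
    (t := (2 : ℤ) - 1) (by omega) (by omega)
  have b1' := lt_of_le_of_ne b1 hno
  have hU : ((A ∪ B ∪ C).card : ℤ) = 3 * e - 3 := by omega
  rw [hU] at b2
  have hw : (((A ∪ B ∪ C).sup id).card : ℤ) ≤
    3 * v - r - (({y, z} : Finset (Finset (Fin n))).sup id).card := by omega
  have he1 : (0:ℤ) ≤ (e : ℤ) - 1 := by omega
  have := mul_le_mul_of_nonneg_left hw he1
  push_cast at b1'
  nlinarith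

/-- counting families with small union -/
theorem count_fam {n t : ℕ} (ht : t ≤ n) (P : Finset (Finset (Finset (Fin n))))
    (hP : ∀ F ∈ P, (F.sup id).card ≤ t) : P.card ≤ n ^ t * 2 ^ 2 ^ t := by
  have hsub : P ⊆ (Finset.powersetCard t (Finset.univ : Finset (Fin n))).biUnion
      (fun U => U.powerset.powerset) := by
    intro F hF
    obtain ⟨U, hU, hUc⟩ := Finset.exists_superset_card_eq (hP F hF) (by simpa using ht)
    simp only [Finset.mem_biUnion, Finset.mem_powersetCard, Finset.mem_powerset]
    refine ⟨U, ⟨Finset.subset_univ _, hUc⟩, ?_⟩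
    intro x hx
    rw [Finset.mem_powerset]
    exact (Finset.le_sup (f := id) hx).trans hU
  refine (Finset.card_le_card hsub).trans ?_
  refine (Finset.card_biUnion_le_card_mul _ _ (2 ^ 2 ^ t) ?_).trans ?_
  · intro U hU
    rw [Finset.card_powerset, Finset.card_powerset, (Finset.mem_powersetCard.1 hU).2]
  · rw [Finset.card_powersetCard, Finset.card_univ, Fintype.card_fin]
    gcongr
    exact Nat.choose_le_pow n t

theorem count_weight {n K : ℕ} (hn : 0 < n) (P : Finset (Finset (Finset (Fin n))))
    (hP : ∀ F ∈ P, (F.sup id).card ≤ K) :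
    ∑ F ∈ P, ((n : ℝ) ^ (F.sup id).card)⁻¹ ≤ ((K : ℝ) + 1) * 2 ^ 2 ^ K := by
  have hmap : ∀ F ∈ P, (F.sup id).card ∈ Finset.range (K + 1) := by
    intro F hF; rw [Finset.mem_range]; have := hP F hF; omega
  rw [← Finset.sum_fiberwise_of_maps_to hmap]
  have : ∀ t ∈ Finset.range (K + 1),
      ∑ F ∈ P with (F.sup id).card = t, ((n : ℝ) ^ (F.sup id).card)⁻¹ ≤ 2 ^ 2 ^ K := by
    intro t ht
    have htK : t ≤ K := by rw [Finset.mem_range] at ht; omega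
    by_cases htn : t ≤ n
    · have hc := count_fam htn (P.filter (fun F => (F.sup id).card = t))
        (fun F hF => (Finset.mem_filter.1 hF).2.le)
      have e1 : ∑ F ∈ P with (F.sup id).card = t, ((n : ℝ) ^ (F.sup id).card)⁻¹
          = (P.filter (fun F => (F.sup id).card = t)).card * ((n : ℝ) ^ t)⁻¹ := by
        rw [← nsmul_eq_mul, ← Finset.sum_const]
        refine Finset.sum_congr rfl (fun F hF => ?_)
        rw [(Finset.mem_filter.1 hF).2]
      rw [e1, ← div_eq_mul_inv, div_le_iff₀ (by positivity)]
      have hc' : ((P.filter (fun F => (F.sup id).card = t)).card : ℝ) ≤ n ^ t * 2 ^ 2 ^ t := by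
        exact_mod_cast hc
      refine hc'.trans ?_
      rw [mul_comm]
      gcongr
      · norm_num
      · norm_num
    · have : P.filter (fun F => (F.sup id).card = t) = ∅ := by
        rw [Finset.filter_eq_empty_iff]
        intro F _ h
        have := Finset.card_le_univ (F.sup id)
        rw [Fintype.card_fin] at this
        omega
      rw [this, Finset.sum_empty]; positivity
  calc _ ≤ ∑ t ∈ Finset.range (K + 1), (2:ℝ) ^ 2 ^ K := Finset.sum_le_sum this
    _ = _ := by rw [Finset.sum_const, Finset.card_range, nsmul_eq_mul]; push_cast; ring

open Classical in
theorem bern_sum {W : Type} (U F : Finset W) (hF : F ⊆ U) (p : ℝ) :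
    ∑ S ∈ U.powerset, p ^ S.card * (1 - p) ^ (U.card - S.card) * (if F ⊆ S then 1 else 0)
      = p ^ F.card := by
  simp only [mul_ite, mul_one, mul_zero]
  rw [← Finset.sum_filter]
  have : U.powerset.filter (fun S => F ⊆ S) = (U \ F).powerset.image (fun S => F ∪ S) := by
    ext S
    simp only [Finset.mem_filter, Finset.mem_powerset, Finset.mem_image]
    constructor
    · rintro ⟨h1, h2⟩
      exact ⟨S \ F, Finset.sdiff_subset_sdiff h1 le_rfl, Finset.union_sdiff_of_subset h2⟩
    · rintro ⟨T, hT, rfl⟩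
      exact ⟨Finset.union_subset hF (hT.trans Finset.sdiff_subset), Finset.subset_union_left⟩
  have hdisj : ∀ T ∈ (U \ F).powerset, Disjoint F T := by
    intro T hT
    exact Finset.disjoint_of_subset_right (Finset.mem_powerset.1 hT) Finset.disjoint_sdiff
  rw [this, Finset.sum_image]
  · have h1 : ∀ T ∈ (U \ F).powerset, p ^ (F ∪ T).card * (1 - p) ^ (U.card - (F ∪ T).card)
        = p ^ F.card * (p ^ T.card * (1 - p) ^ ((U \ F).card - T.card)) := by
      intro T hT
      rw [Finset.card_union_of_disjoint (hdisj T hT), Finset.card_sdiff_of_subset hF, pow_add,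
        Nat.sub_sub]
      ring
    rw [Finset.sum_congr rfl h1, ← Finset.mul_sum, Finset.sum_pow_mul_eq_add_pow]
    simp
  · intro T hT T' hT' h
    have e1 := hdisj T hT
    have e2 := hdisj T' hT'
    have : (F ∪ T) \ F = (F ∪ T') \ F := by
      have h' : F ∪ T = F ∪ T' := h
      rw [h']
    rwa [Finset.union_sdiff_cancel_left e1, Finset.union_sdiff_cancel_left e2] at this

open Classical in
theorem deletion {W : Type} [Nonempty W] (U : Finset W) (Bd Ed : Finset (Finset W))
    (hBd : ∀ F ∈ Bd, F ⊆ U) (hEd : ∀ F ∈ Ed, F ⊆ U) (hne : ∀ F ∈ Bd, F.Nonempty)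
    {k : ℕ} (hk : ∀ F ∈ Ed, F.card = k) {p D : ℝ} (hp0 : 0 ≤ p) (hp1 : p ≤ 1) (hD : 0 < D)
    (hb : ∑ F ∈ Bd, p ^ F.card ≤ p * U.card / 4) (he : Ed.card * p ^ k ≤ D * (p * U.card)) :
    ∃ S ⊆ U, (∀ F ∈ Bd, ¬ F ⊆ S) ∧ p * U.card / 2 ≤ S.card ∧
      ((Ed.filter (fun F => F ⊆ S)).card : ℝ) ≤ 4 * D * S.card := by
  set wt : Finset W → ℝ := fun S => p ^ S.card * (1 - p) ^ (U.card - S.card) with hwt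
  have hwt0 : ∀ S, 0 ≤ wt S := fun S => by
    have : 0 ≤ 1 - p := by linarith
    rw [hwt]; positivity
  set val : Finset W → ℝ := fun S => (S.card : ℝ) - (Bd.filter (fun F => F ⊆ S)).card
    - (Ed.filter (fun F => F ⊆ S)).card / (4 * D) with hval
  have hone : ∑ S ∈ U.powerset, wt S = 1 := by
    have := bern_sum U ∅ (Finset.empty_subset _) p
    simpa using this
  have e1 : ∑ S ∈ U.powerset, wt S * (S.card : ℝ) = p * U.card := by
    have : ∀ S ∈ U.powerset, wt S * (S.card : ℝ)
        = ∑ x ∈ U, wt S * (if {x} ⊆ S then 1 else 0) := by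
      intro S hS
      rw [← Finset.mul_sum]
      congr 1
      simp only [Finset.singleton_subset_iff]
      rw [Finset.sum_boole, Finset.filter_mem_eq_inter,
        Finset.inter_eq_right.2 (Finset.mem_powerset.1 hS)]
    rw [Finset.sum_congr rfl this, Finset.sum_comm]
    rw [Finset.sum_congr rfl (fun x hx => bern_sum U {x} (by simpa using hx) p)]
    simp [mul_comm]
  have e2 : ∀ Q : Finset (Finset W), (∀ F ∈ Q, F ⊆ U) →
      ∑ S ∈ U.powerset, wt S * ((Q.filter (fun F => F ⊆ S)).card : ℝ) = ∑ F ∈ Q, p ^ F.card := by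
    intro Q hQ
    have : ∀ S ∈ U.powerset, wt S * ((Q.filter (fun F => F ⊆ S)).card : ℝ)
        = ∑ F ∈ Q, wt S * (if F ⊆ S then 1 else 0) := by
      intro S hS
      rw [← Finset.mul_sum, Finset.sum_boole]
    rw [Finset.sum_congr rfl this, Finset.sum_comm]
    exact Finset.sum_congr rfl (fun F hF => bern_sum U F (hQ F hF) p)
  have e3 : ∑ S ∈ U.powerset, wt S * val S = p * U.card - ∑ F ∈ Bd, p ^ F.card
      - (∑ F ∈ Ed, p ^ F.card) / (4 * D) := by
    rw [← e1, ← e2 Bd hBd, ← e2 Ed hEd, Finset.sum_div, ← Finset.sum_sub_distrib,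
      ← Finset.sum_sub_distrib]
    refine Finset.sum_congr rfl (fun S _ => ?_)
    rw [hval]; ring
  have e4 : ∑ F ∈ Ed, p ^ F.card = Ed.card * p ^ k := by
    rw [Finset.sum_congr rfl (fun F hF => by rw [hk F hF]), Finset.sum_const, nsmul_eq_mul]
  have e5 : (∑ F ∈ Ed, p ^ F.card) / (4 * D) ≤ p * U.card / 4 := by
    rw [e4, div_le_iff₀ (by positivity)]; linarith
  have hex : ∃ S ∈ U.powerset, p * U.card / 2 ≤ val S := by
    by_contra hcon
    push Not at hcon
    have h1 : ∑ S ∈ U.powerset, wt S * val S < p * U.card / 2 := by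
      have h2 : ∑ S ∈ U.powerset, wt S * (p * U.card / 2) = p * U.card / 2 := by
        rw [← Finset.sum_mul, hone, one_mul]
      rw [← h2]
      have h3 : ∃ S ∈ U.powerset, 0 < wt S := by
        by_contra hc
        push Not at hc
        have := Finset.sum_nonpos hc
        linarith
      obtain ⟨S, hS, hSp⟩ := h3
      refine Finset.sum_lt_sum (fun T hT => mul_le_mul_of_nonneg_left (hcon T hT).le (hwt0 T))
        ⟨S, hS, mul_lt_mul_of_pos_left (hcon S hS) hSp⟩
    linarith
  obtain ⟨S0, hS0, hv⟩ := hex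
  choose! g hg using hne
  set R := (Bd.filter (fun F => F ⊆ S0)).image g with hR
  have hRc : R.card ≤ (Bd.filter (fun F => F ⊆ S0)).card := Finset.card_image_le
  have hsd : (S0.card : ℝ) - (Bd.filter (fun F => F ⊆ S0)).card ≤ (S0 \ R).card := by
    have := Finset.le_card_sdiff R S0
    have h1 : S0.card ≤ (S0 \ R).card + (Bd.filter (fun F => F ⊆ S0)).card := by omega
    have h2 : (S0.card : ℝ) ≤ (S0 \ R).card + (Bd.filter (fun F => F ⊆ S0)).card := by
      exact_mod_cast h1
    linarith
  have hEc : ((Ed.filter (fun F => F ⊆ S0 \ R)).card : ℝ) ≤ (Ed.filter (fun F => F ⊆ S0)).card := by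
    norm_cast
    apply Finset.card_le_card
    intro F hF
    rw [Finset.mem_filter] at hF ⊢
    exact ⟨hF.1, hF.2.trans Finset.sdiff_subset⟩
  have hv' : p * U.card / 2 ≤ (S0.card : ℝ) - (Bd.filter (fun F => F ⊆ S0)).card
    - (Ed.filter (fun F => F ⊆ S0)).card / (4 * D) := hv
  have hq0 : 0 ≤ ((Ed.filter (fun F => F ⊆ S0)).card : ℝ) / (4 * D) := by positivity
  refine ⟨S0 \ R, Finset.sdiff_subset.trans (Finset.mem_powerset.1 hS0), ?_, by linarith, ?_⟩
  · intro F hF hsub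
    have h1 := hsub (hg F hF)
    rw [Finset.mem_sdiff] at h1
    apply h1.2
    exact Finset.mem_image_of_mem g
      (Finset.mem_filter.2 ⟨hF, hsub.trans Finset.sdiff_subset⟩)
  · have h0 : 0 ≤ p * (U.card : ℝ) / 2 := by positivity
    have h1 : ((Ed.filter (fun F => F ⊆ S0)).card : ℝ) / (4 * D) ≤ (S0 \ R).card := by linarith
    rw [div_le_iff₀ (by positivity)] at h1
    linarith


open Classical in
theorem indep_set' {W : Type} (S : Finset W) {E : Finset (Finset W)} (hES : ∀ e ∈ E, e ⊆ S)
    (hlin : ∀ e ∈ E, ∀ e' ∈ E, ∀ u u', u ≠ u' → u ∈ e → u' ∈ e → u ∈ e' → u' ∈ e' → e = e')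
    (htri : ∀ e ∈ E, ∀ e₁ ∈ E, ∀ e₂ ∈ E, ∀ u u' v, u ≠ u' → u ≠ v → u' ≠ v → u ∈ e → u ∈ e₁ →
      u' ∈ e → u' ∈ e₂ → v ∈ e₁ → v ∈ e₂ → e = e₁ ∨ e = e₂ ∨ e₁ = e₂)
    {k : ℕ} (hk : ∀ e ∈ E, e.card = k) (hk2 : 2 ≤ k) {l q : ℝ} (hl : 0 < l) (hl1 : l ≤ 1)
    (hq : 0 < q) (hE : (k : ℝ) * E.card * l ^ (k - 1) ≤ (q / 4) * S.card)
    (hlq : l * Real.exp (q / 2) ≤ 1 / 4) :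
    ∃ I ⊆ S, (∀ e ∈ E, ¬ e ⊆ I) ∧ l * S.card / 4 ≤ I.card := by
  have hc : Fintype.card {x // x ∈ S} = S.card := Fintype.card_coe S
  set g : Finset W → Finset {x // x ∈ S} := fun e => e.subtype (fun x => x ∈ S) with hg
  have hmem : ∀ (e : Finset W) (x : {x // x ∈ S}), x ∈ g e ↔ (x : W) ∈ e := by
    intro e x; simp [hg]
  have hE' : ((E.image g).card : ℝ) ≤ E.card := by exact_mod_cast Finset.card_image_le
  obtain ⟨I, hI, hIc⟩ := indep_set (V := {x // x ∈ S}) (E := E.image g) (k := k) (l := l) (q := q)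
    (by
      intro a ha b hb u u' huu
      obtain ⟨a, hha, rfl⟩ := Finset.mem_image.1 ha
      obtain ⟨b, hhb, rfl⟩ := Finset.mem_image.1 hb
      simp only [hmem]
      intro h1 h2 h3 h4
      rw [hlin a hha b hhb u u' (fun h => huu (Subtype.ext h)) h1 h2 h3 h4])
    (by
      intro a ha b hb c hc u u' v h1 h2 h3
      obtain ⟨a, hha, rfl⟩ := Finset.mem_image.1 ha
      obtain ⟨b, hhb, rfl⟩ := Finset.mem_image.1 hb
      obtain ⟨c, hhc, rfl⟩ := Finset.mem_image.1 hc
      simp only [hmem]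
      intro g1 g2 g3 g4 g5 g6
      rcases htri a hha b hhb c hhc u u' v (fun h => h1 (Subtype.ext h)) (fun h => h2 (Subtype.ext h))
        (fun h => h3 (Subtype.ext h)) g1 g2 g3 g4 g5 g6 with h | h | h
      · left; rw [h]
      · right; left; rw [h]
      · right; right; rw [h])
    (by
      intro a ha
      obtain ⟨a, hha, rfl⟩ := Finset.mem_image.1 ha
      rw [← hk a hha, hg, Finset.card_subtype, Finset.filter_true_of_mem (hES a hha)])
    hk2 hl hl1 hq
    (by
      rw [hc]
      refine le_trans ?_ hE
      gcongr) hlq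
  refine ⟨I.map (Function.Embedding.subtype _), ?_, ?_, ?_⟩
  · intro x hx
    obtain ⟨y, _, rfl⟩ := Finset.mem_map.1 hx
    exact y.2
  · intro a ha hsub
    apply hI (g a) (Finset.mem_image_of_mem g ha)
    intro x hx
    obtain ⟨y, hy, hyx⟩ := Finset.mem_map.1 (hsub ((hmem a x).1 hx))
    have : y = x := Subtype.ext hyx
    rwa [← this]
  · rw [Finset.card_map, ← hc]; exact hIc


open Classical in
theorem core {n r e v : ℕ} (he : 3 ≤ e) (hrn : r ≤ n) (hvn : v ≤ n) (hn : 0 < n)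
    (hgcd : Int.gcd ((e : ℤ) - 1) ((e : ℤ) * r - v) = 1)
    {p D l q M : ℝ} (hp0 : 0 ≤ p) (hp1 : p ≤ 1) (hD : 0 < D)
    (hM0 : 0 ≤ M)
    (hM : ∀ m t : ℕ, 2 ≤ m → m ≤ 3 * e →
      ((e : ℤ) - 1) * ((t : ℤ) - r) < ((m : ℤ) - 1) * ((v : ℤ) - r) → p ^ m ≤ M * ((n : ℝ) ^ t)⁻¹)
    (hMb : M * ((((3 * e * r : ℕ) : ℝ) + 1) * 2 ^ 2 ^ (3 * e * r)) ≤ p * (n.choose r) / 4)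
    (hed : (n : ℝ) ^ v * 2 ^ 2 ^ v * p ^ e ≤ D * (p * n.choose r))
    (hl : 0 < l) (hl1 : l ≤ 1) (hq : 0 < q) (hE : (e : ℝ) * (4 * D) * l ^ (e - 1) ≤ q / 4)
    (hlq : l * Real.exp (q / 2) ≤ 1 / 4) :
    ∃ H : Finset (Finset (Fin n)), (∀ A ∈ H, A.card = r) ∧
      l * (p * n.choose r / 2) / 4 ≤ H.card ∧
      ∀ S ⊆ H, S.card = e → v + 1 ≤ (S.sup id).card := by
  set U : Finset (Finset (Fin n)) := Finset.powersetCard r Finset.univ with hU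
  have hUc : U.card = n.choose r := by rw [hU, Finset.card_powersetCard]; simp
  have hUr : ∀ x ∈ U, x.card = r := fun x hx => (Finset.mem_powersetCard.1 hx).2
  set Bd := U.powerset.filter (fun F => 2 ≤ F.card ∧ F.card ≤ 3 * e ∧
    ((e : ℤ) - 1) * (((F.sup id).card : ℤ) - r) < ((F.card : ℤ) - 1) * ((v : ℤ) - r)) with hBd
  set Ed := U.powerset.filter (fun F => F.card = e ∧ (F.sup id).card ≤ v) with hEd
  have hBm : ∀ F ∈ Bd, F ⊆ U ∧ 2 ≤ F.card ∧ F.card ≤ 3 * e ∧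
    ((e : ℤ) - 1) * (((F.sup id).card : ℤ) - r) < ((F.card : ℤ) - 1) * ((v : ℤ) - r) := by
    intro F hF
    rw [hBd, Finset.mem_filter, Finset.mem_powerset] at hF
    exact hF
  have hEm : ∀ F ∈ Ed, F ⊆ U ∧ F.card = e ∧ (F.sup id).card ≤ v := by
    intro F hF
    rw [hEd, Finset.mem_filter, Finset.mem_powerset] at hF
    exact hF
  have hsup : ∀ F ∈ Bd, (F.sup id).card ≤ 3 * e * r := by
    intro F hF
    obtain ⟨h1, h2, h3, _⟩ := hBm F hF
    have : (F.sup id).card ≤ F.card * r := by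
      rw [Finset.sup_eq_biUnion]
      exact Finset.card_biUnion_le_card_mul _ _ _ (fun x hx => (hUr x (h1 hx)).le)
    exact this.trans (Nat.mul_le_mul_right _ h3)
  have : Nonempty (Finset (Fin n)) := ⟨∅⟩
  obtain ⟨S, hSU, hSB, hSc, hSE⟩ := deletion U Bd Ed (fun F hF => (hBm F hF).1)
    (fun F hF => (hEm F hF).1)
    (fun F hF => Finset.card_pos.1 (by have := (hBm F hF).2.1; omega))
    (k := e) (fun F hF => (hEm F hF).2.1) hp0 hp1 hD
    (by
      rw [hUc]
      refine le_trans ?_ hMb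
      calc ∑ F ∈ Bd, p ^ F.card ≤ ∑ F ∈ Bd, M * ((n : ℝ) ^ (F.sup id).card)⁻¹ := by
            refine Finset.sum_le_sum (fun F hF => ?_)
            obtain ⟨h1, h2, h3, h4⟩ := hBm F hF
            exact hM _ _ h2 h3 h4
        _ = M * ∑ F ∈ Bd, ((n : ℝ) ^ (F.sup id).card)⁻¹ := by rw [Finset.mul_sum]
        _ ≤ _ := mul_le_mul_of_nonneg_left (count_weight hn Bd hsup) hM0)
    (by
      rw [hUc]
      refine le_trans ?_ hed
      have := count_fam hvn Ed (fun F hF => (hEm F hF).2.2)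
      have : (Ed.card : ℝ) ≤ (n : ℝ) ^ v * 2 ^ 2 ^ v := by exact_mod_cast this
      gcongr)
  rw [hUc] at hSc
  have hbad : ∀ F ⊆ S, 2 ≤ F.card → F.card ≤ 3 * e →
      ((F.card : ℤ) - 1) * ((v : ℤ) - r) ≤ ((e : ℤ) - 1) * (((F.sup id).card : ℤ) - r) := by
    intro F hF h2 h3
    by_contra hcon
    push Not at hcon
    refine hSB F ?_ hF
    rw [hBd, Finset.mem_filter, Finset.mem_powerset]
    exact ⟨hF.trans hSU, h2, h3, hcon⟩
  have hEm' : ∀ F ∈ Ed.filter (fun F => F ⊆ S), F ⊆ S ∧ F.card = e ∧ (F.sup id).card ≤ v := by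
    intro F hF
    rw [Finset.mem_filter] at hF
    exact ⟨hF.2, (hEm F hF.1).2⟩
  have hSE' : ((Ed.filter (fun F => F ⊆ S)).card : ℝ) ≤ 4 * D * S.card := by convert hSE
  obtain ⟨I, hIS, hIE, hIc⟩ := indep_set' S (E := Ed.filter (fun F => F ⊆ S)) (k := e) (l := l)
    (q := q) (fun F hF => (hEm' F hF).1)
    (by
      intro A hA B hB x y hxy h1 h2 h3 h4
      obtain ⟨a1, a2, a3⟩ := hEm' A hA
      obtain ⟨b1, b2, b3⟩ := hEm' B hB
      exact struct_lin he hgcd hbad a1 b1 a2 b2 a3 b3 hxy h1 h2 h3 h4)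
    (by
      intro A hA B hB C hC x y z hxy hxz hyz h1 h2 h3 h4 h5 h6
      obtain ⟨a1, a2, a3⟩ := hEm' A hA
      obtain ⟨b1, b2, b3⟩ := hEm' B hB
      obtain ⟨c1, c2, c3⟩ := hEm' C hC
      exact struct_tri he hgcd (fun x hx => hUr x (hSU hx)) hbad a1 b1 c1 a2 b2 c2 a3 b3 c3
        hxy hxz hyz h1 h2 h3 h4 h5 h6)
    (fun F hF => (hEm' F hF).2.1) (by omega) hl hl1 hq
    (by
      have hl0 : 0 ≤ l ^ (e - 1) := by positivity
      calc (e : ℝ) * (Ed.filter (fun F => F ⊆ S)).card * l ^ (e - 1)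
          ≤ (e : ℝ) * (4 * D * S.card) * l ^ (e - 1) := by
            refine mul_le_mul_of_nonneg_right (mul_le_mul_of_nonneg_left ?_ (Nat.cast_nonneg _)) hl0
            exact hSE'
        _ = (e : ℝ) * (4 * D) * l ^ (e - 1) * S.card := by ring
        _ ≤ q / 4 * S.card := mul_le_mul_of_nonneg_right hE (Nat.cast_nonneg _)) hlq
  refine ⟨I, fun A hA => hUr A (hSU (hIS hA)), ?_, ?_⟩
  · refine le_trans ?_ hIc
    gcongr
  · intro T hT hTe
    by_contra hcon
    refine hIE T ?_ hT
    rw [Finset.mem_filter, hEd, Finset.mem_filter, Finset.mem_powerset]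
    exact ⟨⟨hT.trans (hIS.trans hSU), hTe, by omega⟩, hT.trans hIS⟩


set_option maxHeartbeats 1000000 in
theorem analytic {r e v : ℕ} (hr : 3 ≤ r) (he : 3 ≤ e) (hv : r + 1 ≤ v)
    (hgcd : Int.gcd ((e : ℤ) - 1) ((e : ℤ) * r - v) = 1) :
    ∃ c : ℝ, 0 < c ∧ ∃ N : ℕ, ∀ n : ℕ, N ≤ n →
      ∃ H : Finset (Finset (Fin n)),
        (∀ A ∈ H, A.card = r) ∧
        c * (n : ℝ) ^ (((e : ℝ) * r - v) / ((e : ℝ) - 1)) *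
          Real.log n ^ ((1 : ℝ) / ((e : ℝ) - 1)) ≤ H.card ∧
        ∀ S ⊆ H, S.card = e → v + 1 ≤ (S.sup id).card := by
  have he3 : (3:ℝ) ≤ e := by exact_mod_cast he
  have hvr : (r:ℝ) + 1 ≤ v := by exact_mod_cast hv
  obtain ⟨w, hw⟩ : ∃ w : ℝ, w = (e:ℝ) - 1 := ⟨_, rfl⟩
  have hw2 : 2 ≤ w := by linarith
  have hwp : 0 < w := by linarith
  obtain ⟨a, ha⟩ : ∃ a : ℝ, a = ((v:ℝ) - r) / w := ⟨_, rfl⟩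
  have haw : a * w = (v:ℝ) - r := by rw [ha]; field_simp
  obtain ⟨ε, hε⟩ : ∃ ε : ℝ, ε = 1 / (6 * e * w) := ⟨_, rfl⟩
  obtain ⟨δ, hδ⟩ : ∃ δ : ℝ, δ = 1 / (2 * w) := ⟨_, rfl⟩
  have hε0 : 0 < ε := by rw [hε]; positivity
  have hδ0 : 0 < δ := by rw [hδ]; positivity
  have hδw : δ * w = 1 / 2 := by rw [hδ]; field_simp
  have hεδ : ε * (3 * e) = δ := by rw [hε, hδ]; field_simp; norm_num
  obtain ⟨θ, hθ⟩ : ∃ θ : ℝ, θ = ε * w := ⟨_, rfl⟩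
  have hθ0 : 0 < θ := by rw [hθ]; positivity
  obtain ⟨c0, hc0⟩ : ∃ c0 : ℝ, c0 = 1 / (2 ^ r * r.factorial) := ⟨_, rfl⟩
  have hc00 : 0 < c0 := by rw [hc0]; positivity
  obtain ⟨C, hC⟩ : ∃ C : ℝ, C = 2 ^ 2 ^ v / c0 := ⟨_, rfl⟩
  have hC0 : 0 < C := by rw [hC]; positivity
  have hCc : C * c0 = 2 ^ 2 ^ v := by rw [hC]; field_simp
  obtain ⟨κ, hκ⟩ : ∃ κ : ℝ, κ = ε / (16 * e * C) := ⟨_, rfl⟩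
  have hκ0 : 0 < κ := by rw [hκ]; positivity
  refine ⟨1 / 8 * c0 * κ ^ (1 / w), by positivity, ?_⟩
  have hK : ∃ K : ℝ, 0 < K ∧ K = (((3 * e * r : ℕ) : ℝ) + 1) * 2 ^ 2 ^ (3 * e * r) :=
    ⟨_, by positivity, rfl⟩
  obtain ⟨K, hK0, hK⟩ := hK
  -- eventual conditions
  have ev1 : ∀ᶠ n : ℕ in Filter.atTop, K * (n:ℝ) ^ (-δ) ≤ c0 / 4 := by
    have h := ((tendsto_rpow_neg_atTop hδ0).comp tendsto_natCast_atTop_atTop).const_mul K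
    rw [mul_zero] at h
    exact h.eventually_le_const (by positivity)
  have ev2 : ∀ᶠ n : ℕ in Filter.atTop, κ * Real.log n * (n:ℝ) ^ (-(θ/2)) ≤ (1/4) ^ w := by
    have h1 : Filter.Tendsto (fun x : ℝ => Real.log x / x ^ (θ/2)) Filter.atTop (nhds 0) :=
      (isLittleO_log_rpow_atTop (by positivity : 0 < θ/2)).tendsto_div_nhds_zero
    have h := (h1.comp tendsto_natCast_atTop_atTop).const_mul κ
    rw [mul_zero] at h
    have h2 : (0:ℝ) < (1/4) ^ w := by positivity
    filter_upwards [h.eventually_le_const h2] with n hn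
    rw [Real.rpow_neg (Nat.cast_nonneg n), mul_assoc, ← div_eq_mul_inv]
    exact hn
  obtain ⟨N, hN⟩ := Filter.eventually_atTop.1
    (ev1.and (ev2.and (Filter.eventually_ge_atTop (2 * r + v + 3))))
  refine ⟨N, fun n hnN => ?_⟩
  obtain ⟨h1, h2, h3⟩ := hN n hnN
  have hn0 : (0:ℝ) < n := by
    have : 0 < n := by omega
    exact_mod_cast this
  have hn1 : (1:ℝ) ≤ n := by
    have : 1 ≤ n := by omega
    exact_mod_cast this
  have hlog : 0 < Real.log n := Real.log_pos (by
    have : 1 < n := by omega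
    exact_mod_cast this)
  obtain ⟨p, hp⟩ : ∃ p : ℝ, p = (n:ℝ) ^ (-a + ε) := ⟨_, rfl⟩
  have hp0 : 0 < p := by rw [hp]; positivity
  have haε : ε ≤ a := by
    rw [hε, ha, div_le_div_iff₀ (by positivity) hwp]
    have t1 : 1 ≤ (v:ℝ) - r := by linarith
    have t2 : 1 * w ≤ 6 * e * w := by nlinarith
    have t3 : 0 ≤ 6 * e * w := by positivity
    nlinarith
  have hp1 : p ≤ 1 := by
    rw [hp]; exact Real.rpow_le_one_of_one_le_of_nonpos hn1 (by linarith)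
  have hch : c0 * (n:ℝ) ^ r ≤ n.choose r := by
    have hpow' : ((n + 1 - r : ℕ) : ℝ) ^ r / r.factorial ≤ n.choose r :=
      Nat.pow_le_choose r n
    refine le_trans ?_ hpow'
    have hh : (n:ℝ) / 2 ≤ ((n + 1 - r : ℕ) : ℝ) := by
      have : n ≤ 2 * (n + 1 - r) := by omega
      have : (n:ℝ) ≤ 2 * ((n + 1 - r : ℕ) : ℝ) := by exact_mod_cast this
      linarith
    calc c0 * (n:ℝ) ^ r = ((n:ℝ) / 2) ^ r / r.factorial := by
          rw [hc0, div_pow]; field_simp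
      _ ≤ _ := by gcongr
  obtain ⟨L, hL⟩ : ∃ L : ℝ, L = Real.log n := ⟨_, rfl⟩
  have hL0 : 0 < L := hL ▸ hlog
  have hexp : ∀ t : ℝ, (n:ℝ) ^ t = Real.exp (L * t) := fun t => by
    rw [hL, Real.rpow_def_of_pos hn0]
  obtain ⟨q, hq⟩ : ∃ q : ℝ, q = ε * L := ⟨_, rfl⟩
  have hq0 : 0 < q := by rw [hq]; positivity
  obtain ⟨l, hl⟩ : ∃ l : ℝ, l = (κ * L * (n:ℝ) ^ (-θ)) ^ (1 / w) := ⟨_, rfl⟩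
  have hl0 : 0 < l := by rw [hl]; positivity
  have hlw : l ^ (e - 1) = κ * L * (n:ℝ) ^ (-θ) := by
    have : ((e - 1 : ℕ) : ℝ) = w := by
      rw [hw, Nat.cast_sub (by omega)]; simp
    rw [← Real.rpow_natCast, this, hl, ← Real.rpow_mul (by positivity), one_div_mul_cancel hwp.ne',
      Real.rpow_one]
  have hlexp : l * Real.exp (q / 2) ≤ 1 / 4 := by
    have e1 : Real.exp (q / 2) = ((n:ℝ) ^ (θ / 2)) ^ (1 / w) := by
      rw [← Real.rpow_mul hn0.le, hexp, hq, hθ]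
      congr 1; field_simp
    rw [e1, hl, ← Real.mul_rpow (by positivity) (by positivity)]
    have e2 : κ * L * (n:ℝ) ^ (-θ) * (n:ℝ) ^ (θ / 2) = κ * L * (n:ℝ) ^ (-(θ/2)) := by
      rw [mul_assoc, ← Real.rpow_add hn0]; congr 2; ring
    rw [e2, hL]
    calc _ ≤ ((1/4 : ℝ) ^ w) ^ (1 / w) := Real.rpow_le_rpow (by positivity) h2 (by positivity)
      _ = 1 / 4 := by rw [← Real.rpow_mul (by norm_num), mul_one_div_cancel hwp.ne', Real.rpow_one]
  have hl1 : l ≤ 1 := by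
    have : 1 ≤ Real.exp (q / 2) := Real.one_le_exp (by positivity)
    nlinarith
  obtain ⟨H, hH1, hH2, hH3⟩ := core (n := n) (r := r) (e := e) (v := v) he (by omega) (by omega)
    (by omega) hgcd (p := p) (D := C * (n:ℝ) ^ θ) (l := l) (q := q)
    (M := (n:ℝ) ^ r * p * (n:ℝ) ^ (-δ)) hp0.le hp1 (by positivity) (by positivity)
    (by
      intro m t hm hm3 hmt
      have hmt' : ((e : ℤ) - 1) * ((t : ℤ) - r) + 1 ≤ ((m : ℤ) - 1) * ((v : ℤ) - r) := hmt
      have hR : ((e : ℝ) - 1) * ((t : ℝ) - r) + 1 ≤ ((m : ℝ) - 1) * ((v : ℝ) - r) := by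
        exact_mod_cast hmt'
      have hm3' : (m:ℝ) ≤ 3 * e := by exact_mod_cast hm3
      have k1 : (t:ℝ) - r + 2 * δ ≤ (m - 1) * a := by
        rw [← hw, ← haw] at hR
        have : w * ((t:ℝ) - r + 2 * δ) ≤ w * ((m - 1) * a) := by
          linear_combination hR + 2 * hδw
        exact le_of_mul_le_mul_left this hwp
      have k2 : (m - 1) * ε ≤ δ := by
        have := mul_le_mul_of_nonneg_left hm3' hε0.le
        linarith
      rw [← Real.rpow_natCast p m, hp, ← Real.rpow_natCast (n:ℝ) r, ← Real.rpow_natCast (n:ℝ) t,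
        ← Real.rpow_neg hn0.le, ← Real.rpow_mul hn0.le, ← Real.rpow_add hn0, ← Real.rpow_add hn0,
        ← Real.rpow_add hn0]
      apply Real.rpow_le_rpow_of_exponent_le hn1
      nlinarith)
    (by
      rw [← hK]
      have : p * (c0 * (n:ℝ) ^ r) ≤ p * n.choose r := by gcongr
      have h4 : (n:ℝ) ^ r * p * (K * (n:ℝ) ^ (-δ)) ≤ (n:ℝ) ^ r * p * (c0 / 4) := by gcongr
      nlinarith)
    (by
      have e1 : (n:ℝ) ^ v * p ^ e = (n:ℝ) ^ θ * p * (n:ℝ) ^ r := by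
        rw [← Real.rpow_natCast p e, hp, ← Real.rpow_natCast (n:ℝ) r, ← Real.rpow_natCast (n:ℝ) v,
          ← Real.rpow_mul hn0.le, ← Real.rpow_add hn0, ← Real.rpow_add hn0, ← Real.rpow_add hn0]
        congr 1
        have : (e:ℝ) = w + 1 := by linarith
        rw [this, hθ]; linear_combination -haw
      calc (n:ℝ) ^ v * 2 ^ 2 ^ v * p ^ e = 2 ^ 2 ^ v * ((n:ℝ) ^ v * p ^ e) := by ring
        _ = C * (n:ℝ) ^ θ * (p * (c0 * (n:ℝ) ^ r)) := by rw [e1, ← hCc]; ring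
        _ ≤ _ := by gcongr)
    hl0 hl1 hq0
    (by
      rw [hlw, hκ, hq, Real.rpow_neg hn0.le]
      have : (n:ℝ) ^ θ ≠ 0 := by positivity
      apply le_of_eq
      field_simp
      norm_num) hlexp
  refine ⟨H, hH1, le_trans ?_ hH2, hH3⟩
  have e3 : l * p = κ ^ (1 / w) * L ^ (1 / w) * (n:ℝ) ^ (-a) := by
    rw [hl, hp, Real.mul_rpow (by positivity) (by positivity),
      Real.mul_rpow hκ0.le hL0.le, ← Real.rpow_mul hn0.le, mul_assoc, ← Real.rpow_add hn0]
    congr 2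
    rw [hθ]; field_simp; ring
  have e4 : (n:ℝ) ^ (((e : ℝ) * r - v) / ((e : ℝ) - 1)) = (n:ℝ) ^ (-a) * (n:ℝ) ^ r := by
    rw [← Real.rpow_natCast (n:ℝ) r, ← Real.rpow_add hn0, ← hw]
    congr 1
    have : (e:ℝ) = w + 1 := by linarith
    rw [this, ha]; field_simp; ring
  rw [e4, ← hL, ← hw]
  calc 1 / 8 * c0 * κ ^ (1 / w) * ((n:ℝ) ^ (-a) * (n:ℝ) ^ r) * L ^ (1 / w)
      = 1 / 8 * (l * p) * (c0 * (n:ℝ) ^ r) := by rw [e3]; ring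
    _ ≤ 1 / 8 * (l * p) * n.choose r := by gcongr
    _ = _ := by ring

end SparseHG

/-- For fixed `r ≥ 3`, `e ≥ 3`, `v ≥ r+1` with `gcd(e-1, er-v) = 1`,
`f_r(n,v,e) = Ω(n^((er-v)/(e-1)) (log n)^(1/(e-1)))`: for all sufficiently large `n` there is a
`𝒢_r(v,e)`-free `r`-graph on `[n]` with at least `c n^((er-v)/(e-1)) (log n)^(1/(e-1))` edges. -/
theorem stmt_1 (r e v : ℕ) (hr : 3 ≤ r) (he : 3 ≤ e) (hv : r + 1 ≤ v)
    (hgcd : Int.gcd ((e : ℤ) - 1) ((e : ℤ) * r - v) = 1) :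
    ∃ c : ℝ, 0 < c ∧ ∃ N : ℕ, ∀ n : ℕ, N ≤ n →
      ∃ H : Finset (Finset (Fin n)),
        (∀ A ∈ H, A.card = r) ∧
        c * (n : ℝ) ^ (((e : ℝ) * r - v) / ((e : ℝ) - 1)) *
          Real.log n ^ ((1 : ℝ) / ((e : ℝ) - 1)) ≤ H.card ∧
        ∀ S ⊆ H, S.card = e → v + 1 ≤ (S.sup id).card := by
  exact SparseHG.analytic hr he hv hgcd
end
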